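/- arXiv:2010.04985 — 3 statements merged into one kernel-verified Lean document; each statement's English description precedes it below -/
import Mathlib

section
/- Let 𝒟 be a finite multiset of subsets of [n] and K ⊆ [n] a kernel, and suppose that for every S ∈ 𝒟 the petal S \ K has non-empty intersection with the petals of at most t other members of 𝒟 (counted with multiplicity). Then 𝒟 can be partitioned into t + 1 sub-multisets 𝒮_1, …, 𝒮_{t+1}, each of which is a simple daisy with kernel K (i.e., within each 𝒮_i the petals S \ K are pairwise disjoint), and each of size ⌊|𝒟|/(t+1)⌋ or ⌈|𝒟|/(t+1)⌉. -/
open scoped Classical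

namespace HS
open Finset Relation

variable {V ι : Type*}

/-- proper colouring of `S` with palette `C` -/
structure Col (G : SimpleGraph V) (S : Finset V) (C : Finset ι) (f : V → ι) : Prop where
  mem : ∀ v ∈ S, f v ∈ C
  proper : ∀ v ∈ S, ∀ w ∈ S, G.Adj v w → f v ≠ f w

/-- colour class -/
noncomputable def cls (S : Finset V) (f : V → ι) (c : ι) : Finset V := S.filter (fun v => f v = c)

/-- equitable colourability -/
def Good (G : SimpleGraph V) (S : Finset V) (C : Finset ι) (s : ℕ) : Prop :=
  ∃ f : V → ι, Col G S C f ∧ ∀ c ∈ C, (cls S f c).card = s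

/-- degree into the set `S` -/
noncomputable def dg (G : SimpleGraph V) (S : Finset V) (v : V) : ℕ :=
  (S.filter (fun w => G.Adj v w)).card

/-- class `c` has a vertex movable to class `d` -/
def Mv (G : SimpleGraph V) (S : Finset V) (C : Finset ι) (f : V → ι) (c d : ι) : Prop :=
  c ∈ C ∧ d ∈ C ∧ c ≠ d ∧ ∃ v ∈ S, f v = c ∧ ∀ w ∈ S, f w = d → ¬ G.Adj v w

/-- relation avoiding a point -/
def Av (R : ι → ι → Prop) (U : ι) (c d : ι) : Prop := R c d ∧ c ≠ U ∧ d ≠ U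

theorem nodup_chain {R : ι → ι → Prop} {c a : ι} (h : ReflTransGen R c a) :
    ∃ l : List ι, List.IsChain R (c :: l) ∧ (c :: l).Nodup ∧ (c :: l).getLast (by simp) = a := by
  induction h using ReflTransGen.head_induction_on with
  | refl => exact ⟨[], by simp, by simp, by simp⟩
  | head hcd hd ih =>
    rename_i c d
    obtain ⟨l, h1, h2, h3⟩ := ih
    by_cases hc : c ∈ d :: l
    · obtain ⟨l1, l2, e⟩ := List.append_of_mem hc
      refine ⟨l2, ?_, ?_, ?_⟩
      · rw [e] at h1; exact (List.isChain_append.1 h1).2.1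
      · rw [e] at h2; exact (List.nodup_append.1 h2).2.1
      · simp only [e] at h3
        rw [← h3, List.getLast_append_of_ne_nil]
    · refine ⟨d :: l, ?_, ?_, ?_⟩
      · exact List.isChain_cons_cons.2 ⟨hcd, h1⟩
      · exact List.nodup_cons.2 ⟨hc, h2⟩
      · rw [List.getLast_cons (by simp)]; exact h3

theorem digraph (A : Finset ι) (R : ι → ι → Prop) (a : ι) (haA : a ∈ A)
    (hacc : ∀ X ∈ A, ReflTransGen R X a)
    (hne : ∃ X ∈ A, X ≠ a) :
    ∃ U ∈ A, ∃ T ⊆ A, T.Nonempty ∧ U ∉ T ∧ a ∉ T ∧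
      (∀ W ∈ T, ∀ X ∈ A, X ≠ W → ReflTransGen (Av R W) X a) ∧
      (∀ W ∈ T, ∀ Y ∈ A, R W Y → Y = U ∨ Y ∈ T) := by
  set T : ι → Finset ι := fun U => A.filter (fun X => X ≠ U ∧ ¬ ReflTransGen (Av R U) X a) with hT
  have hTa : ∀ X ∈ A, X ≠ a → X ∈ T a := by
    intro X hX hXa
    simp only [hT, mem_filter]
    refine ⟨hX, hXa, fun h => ?_⟩
    rcases ReflTransGen.cases_tail h with h | ⟨d, _, h⟩
    · exact hXa h.symm
    · exact h.2.2 rfl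
  obtain ⟨X0, hX0, hX0a⟩ := hne
  have hex : (A.filter (fun U => (T U).Nonempty)).Nonempty :=
    ⟨a, mem_filter.2 ⟨haA, X0, hTa X0 hX0 hX0a⟩⟩
  obtain ⟨U, hU, hmin⟩ := exists_min_image _ (fun U => (T U).card) hex
  rw [mem_filter] at hU
  have hTU : ∀ W, W ∈ T U ↔ W ∈ A ∧ W ≠ U ∧ ¬ ReflTransGen (Av R U) W a := by
    intro W; simp [hT]
  refine ⟨U, hU.1, T U, filter_subset _ _, hU.2, ?_, ?_, ?_, ?_⟩
  · simp [hT]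
  · rw [hTU]; exact fun h => h.2.2 .refl
  · intro W hW X hX hXW
    by_contra hcon
    have hW' := (hTU W).1 hW
    have claim : ∀ Z, ReflTransGen (Av R U) Z a → ReflTransGen (Av R W) Z a := by
      intro Z hZ
      induction hZ using ReflTransGen.head_induction_on with
      | refl => exact .refl
      | head hcd hd ih =>
        refine .head ⟨hcd.1, ?_, ?_⟩ ih
        · rintro rfl; exact hW'.2.2 (.head hcd hd)
        · rintro rfl; exact hW'.2.2 hd
    have claim2 : ∀ Z, ReflTransGen R Z a →
        ReflTransGen (Av R U) Z a ∨ ReflTransGen (Av R W) U a := by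
      intro Z hZ
      induction hZ using ReflTransGen.head_induction_on with
      | refl => exact .inl .refl
      | head hcd hd ih =>
        rename_i c d
        rcases ih with ih | ih
        · by_cases hdU : d = U
          · subst hdU; exact .inr (claim _ ih)
          by_cases hcU : c = U
          · subst hcU
            refine .inr (.head ⟨hcd, hW'.2.1.symm, ?_⟩ (claim _ ih))
            rintro rfl; exact hW'.2.2 ih
          · exact .inl (.head ⟨hcd, hcU, hdU⟩ ih)
        · exact .inr ih
    have hsub : T W ⊆ (T U).erase W := by
      intro Z hZ
      simp only [hT, mem_filter] at hZ
      rw [mem_erase, hTU]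
      refine ⟨hZ.2.1, hZ.1, ?_, fun h => hZ.2.2 (claim _ h)⟩
      rintro rfl
      rcases claim2 _ (hacc _ hZ.1) with h | h
      · exact hZ.2.2 (claim _ h)
      · exact hZ.2.2 h
    have h1 := card_le_card hsub
    rw [card_erase_of_mem hW] at h1
    have h2 := hmin W (mem_filter.2 ⟨hW'.1, X, by simp only [hT, mem_filter]; exact ⟨hX, hXW, hcon⟩⟩)
    have h3 := card_pos.2 ⟨W, hW⟩

    omega
  · intro W hW Y hY hWY
    by_contra! hcon
    rw [hTU] at hW hcon
    have : ReflTransGen (Av R U) Y a := by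
      by_contra h; exact hcon.2 ⟨hY, hcon.1, h⟩
    exact hW.2.2 (.head ⟨hWY, hW.2.1, hcon.1⟩ this)

theorem Mv.update {G : SimpleGraph V} {S : Finset V} {C : Finset ι} {f : V → ι} {c d e : ι} {z : V}
    (h : Mv G S C f c d) (hc : c ≠ f z) (hd : d ≠ e) : Mv G S C (Function.update f z e) c d := by
  obtain ⟨h1, h2, h3, v, hv, hvc, h4⟩ := h
  refine ⟨h1, h2, h3, v, hv, ?_, ?_⟩
  · rw [Function.update_of_ne]; exact hvc
    rintro rfl; exact hc hvc.symm
  · intro w hw hwd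
    by_cases hwz : w = z
    · subst hwz; simp at hwd; exact absurd hwd.symm hd
    · rw [Function.update_of_ne hwz] at hwd; exact h4 w hw hwd

theorem Col.update {G : SimpleGraph V} {S : Finset V} {C : Finset ι} {f : V → ι} {e : ι} {z : V}
    (h : Col G S C f) (he : e ∈ C) (hz : ∀ w ∈ S, f w = e → ¬ G.Adj z w) :
    Col G S C (Function.update f z e) := by
  constructor
  · intro v hv
    by_cases hvz : v = z
    · subst hvz; simpa using he
    · rw [Function.update_of_ne hvz]; exact h.mem v hv
  · intro v hv w hw hvw
    by_cases hvz : v = z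
    · subst hvz
      rw [Function.update_self, Function.update_of_ne hvw.ne']
      exact fun h => hz w hw h.symm hvw
    · by_cases hwz : w = z
      · subst hwz
        rw [Function.update_self, Function.update_of_ne hvz]
        exact fun h => hz v hv h hvw.symm
      · rw [Function.update_of_ne hvz, Function.update_of_ne hwz]
        exact h.proper v hv w hw hvw

theorem cls_update {S : Finset V} {f : V → ι} {c d : ι} {z : V} (hzS : z ∈ S) (hz : f z = c)
    (hcd : c ≠ d) (e : ι) :
    (cls S (Function.update f z d) e).card + (if e = c then 1 else 0) =
      (cls S f e).card + (if e = d then 1 else 0) := by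
  by_cases hec : e = c
  · subst hec
    have : cls S (Function.update f z d) e = (cls S f e).erase z := by
      ext v; by_cases hv : v = z
      · subst hv; simp [cls, hcd.symm]
      · simp [cls, hv]
    have hm : z ∈ cls S f e := by simp [cls, hzS, hz]
    rw [this, card_erase_of_mem hm]
    have := card_pos.2 ⟨z, hm⟩
    simp [hcd]; omega
  · by_cases hed : e = d
    · subst hed
      have : cls S (Function.update f z e) e = insert z (cls S f e) := by
        ext v; by_cases hv : v = z
        · subst hv; simp [cls, hzS]
        · simp [cls, hv]
      have hm : z ∉ cls S f e := by simp [cls, hz, hcd]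
      rw [this, card_insert_of_notMem hm]
      simp [hec]
    · have : cls S (Function.update f z d) e = cls S f e := by
        ext v; by_cases hv : v = z
        · subst hv; simp [cls, hz, Ne.symm hed, Ne.symm hec]
        · simp [cls, hv]
      simp [this, hec, hed]

theorem shift (G : SimpleGraph V) (S : Finset V) (C : Finset ι) (a : ι) (l : List ι) :
    ∀ (c : ι) (f : V → ι), Col G S C f → List.IsChain (Mv G S C f) (c :: l) → (c :: l).Nodup →
      (c :: l).getLast (by simp) = a →
    ∃ f' : V → ι, Col G S C f' ∧
      (∀ v, f' v = f v ∨ (f v ∈ c :: l ∧ f' v ∈ c :: l)) ∧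
      ∀ e, (cls S f' e).card + (if e = c then 1 else 0) =
        (cls S f e).card + (if e = a then 1 else 0) := by
  induction l with
  | nil =>
    intro c f hf _ _ h
    simp at h; subst h
    exact ⟨f, hf, fun v => .inl rfl, fun e => rfl⟩
  | cons d l ih =>
    intro c f hf hch hnd hlast
    rw [List.isChain_cons_cons] at hch
    obtain ⟨⟨hc, hd, hcd, z, hzS, hzc, hz⟩, hch⟩ := hch
    rw [List.nodup_cons] at hnd
    rw [List.getLast_cons (by simp)] at hlast
    have hch' : List.IsChain (Mv G S C (Function.update f z d)) (d :: l) := by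
      have hnd2 := hnd
      have key : List.IsChain (fun x y => Mv G S C f x y ∧ x ∈ d :: l ∧ y ∈ l) (d :: l) := by
        rw [List.isChain_iff_getElem] at hch ⊢
        intro i hi
        refine ⟨hch i hi, List.getElem_mem _, ?_⟩
        simp
      refine key.imp ?_
      rintro x y ⟨h1, h2, h3⟩
      refine h1.update ?_ ?_
      · rw [hzc]; rintro rfl; exact hnd.1 h2
      · rintro rfl; exact (List.nodup_cons.1 hnd.2).1 h3
    obtain ⟨f', h1, h2, h3⟩ := ih d _ (hf.update hd hz) hch' hnd.2 hlast
    refine ⟨f', h1, ?_, ?_⟩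
    · intro v
      by_cases hv : v = z
      · subst hv
        rcases h2 v with h | h
        · right; rw [h, hzc]; simp
        · right; rw [hzc]; exact ⟨by simp, List.mem_cons_of_mem _ h.2⟩
      · rcases h2 v with h | h
        · left; rw [h, Function.update_of_ne hv]
        · right; rw [Function.update_of_ne hv] at h
          exact ⟨List.mem_cons_of_mem _ h.1, List.mem_cons_of_mem _ h.2⟩
    · intro e
      have e1 := h3 e
      have e2 := cls_update hzS hzc hcd e
      omega

theorem dg_filter (G : SimpleGraph V) (S : Finset V) (f : V → ι) (D : Finset ι) (v : V) :
    dg G (S.filter (fun w => f w ∈ D)) v = ∑ c ∈ D, dg G (cls S f c) v := by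
  unfold dg
  rw [card_eq_sum_card_fiberwise (f := f) (t := D)]
  · refine sum_congr rfl fun c hc => ?_
    congr 1
    ext w; simp only [mem_filter, cls]
    constructor
    · tauto
    · rintro ⟨⟨h1, rfl⟩, h2⟩; tauto
  · intro w hw; simp at hw; exact hw.1.2

theorem card_filter_cls (S : Finset V) (f : V → ι) (D : Finset ι) :
    (S.filter (fun w => f w ∈ D)).card = ∑ c ∈ D, (cls S f c).card := by
  rw [card_eq_sum_card_fiberwise (f := f) (t := D)]
  · refine sum_congr rfl fun c hc => ?_
    congr 1
    ext w; simp only [mem_filter, cls]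
    constructor
    · tauto
    · rintro ⟨h1, rfl⟩; tauto
  · intro w hw; simp at hw; exact hw.2

theorem dg_union (G : SimpleGraph V) (S : Finset V) (p : V → Prop) [DecidablePred p] (v : V) :
    dg G S v = dg G (S.filter p) v + dg G (S.filter (fun w => ¬ p w)) v := by
  unfold dg
  rw [filter_filter, filter_filter, ← card_filter_add_card_filter_not (s := S.filter (fun w => G.Adj v w)) p,
    filter_filter, filter_filter]
  simp only [and_comm]

theorem dg_comm (G : SimpleGraph V) (P Q : Finset V) :
    ∑ y ∈ P, dg G Q y = ∑ x ∈ Q, dg G P x := by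
  unfold dg
  simp only [card_filter]
  rw [sum_comm]
  simp only [G.adj_comm]

theorem dg_mono (G : SimpleGraph V) {P Q : Finset V} (h : P ⊆ Q) (v : V) : dg G P v ≤ dg G Q v :=
  card_le_card (filter_subset_filter _ h)

theorem dg_pos {G : SimpleGraph V} {P : Finset V} {v : V} :
    1 ≤ dg G P v ↔ ∃ w ∈ P, G.Adj v w := by
  unfold dg
  rw [Nat.one_le_iff_ne_zero, ← Nat.pos_iff_ne_zero, card_pos]
  simp [Finset.Nonempty]

/-- `z` is the only neighbour of `y` in the class of `z`, a class in `T`; `y` lies outside `A`. -/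
def Solo (G : SimpleGraph V) (S : Finset V) (f : V → ι) (A T : Finset ι) (z y : V) : Prop :=
  z ∈ S ∧ f z ∈ T ∧ y ∈ S ∧ f y ∉ A ∧ G.Adj z y ∧ dg G (cls S f (f z)) y = 1

theorem solo_count (G : SimpleGraph V) (S : Finset V) (f : V → ι) (A T : Finset ι) (y : V)
    (hy : y ∈ S) (hyA : f y ∉ A) :
    (S.filter (fun z => Solo G S f A T z y)).card =
      (T.filter (fun W => dg G (cls S f W) y = 1)).card := by
  refine card_bij (fun z _ => f z) ?_ ?_ ?_
  · intro z hz
    rw [mem_filter] at hz ⊢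
    exact ⟨hz.2.2.1, hz.2.2.2.2.2.2⟩
  · intro z hz z' hz' e
    rw [mem_filter] at hz hz'
    have h := hz.2.2.2.2.2.2
    unfold dg at h
    rw [card_eq_one] at h
    obtain ⟨x, hx⟩ := h
    have h1 : z ∈ ({x} : Finset V) := by
      rw [← hx]; simp only [mem_filter, cls]; exact ⟨⟨hz.1, trivial⟩, hz.2.2.2.2.2.1.symm⟩
    have h2 : z' ∈ ({x} : Finset V) := by
      rw [← hx]; simp only [mem_filter, cls]; exact ⟨⟨hz'.1, e.symm⟩, hz'.2.2.2.2.2.1.symm⟩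
    simp at h1 h2; rw [h1, h2]
  · intro W hW
    rw [mem_filter] at hW
    obtain ⟨z, hz, hyz⟩ := dg_pos.1 hW.2.ge
    simp only [cls, mem_filter] at hz
    obtain ⟨hzS, rfl⟩ := hz
    exact ⟨z, by rw [mem_filter]; exact ⟨hzS, hzS, hW.1, hy, hyA, hyz.symm, hW.2⟩, rfl⟩

theorem dg_split {G : SimpleGraph V} {S : Finset V} (f : V → ι) (A : Finset ι) (v : V) :
    dg G S v = ∑ c ∈ A, dg G (cls S f c) v + dg G (S.filter (fun w => f w ∉ A)) v := by
  rw [dg_union G S (fun w => f w ∈ A), dg_filter]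

theorem exists_pair {G : SimpleGraph V} {S : Finset V} {C : Finset ι} {f : V → ι} {s q : ℕ}
    {A T : Finset ι} {U : ι}
    (hdeg : ∀ v ∈ S, dg G S v < C.card) (hq : C.card = A.card + q)
    (hBA : ∀ y ∈ S, f y ∉ A → ∀ c ∈ A, 1 ≤ dg G (cls S f c) y)
    (hB : (S.filter (fun w => f w ∉ A)).card = q * s + 1)
    (hTA : T ⊆ A) (hTne : T.Nonempty) (hUA : U ∈ A) (hUT : U ∉ T)
    (hTs : ∀ W ∈ T, (cls S f W).card = s)
    (hT : ∀ x ∈ S, f x ∈ T → ∀ c ∈ A, c ≠ U → c ∉ T → 1 ≤ dg G (cls S f c) x)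
    (hsolo : ∀ z y, Solo G S f A T z y → ∀ X ∈ A, X ≠ f z → 1 ≤ dg G (cls S f X) z) :
    ∃ z y₁ y₂, Solo G S f A T z y₁ ∧ Solo G S f A T z y₂ ∧ y₁ ≠ y₂ ∧ ¬ G.Adj y₁ y₂ := by
  set B := S.filter (fun w => f w ∉ A) with hBdef
  have hmB : ∀ y, y ∈ B ↔ y ∈ S ∧ f y ∉ A := by intro y; simp [hBdef]
  have hTpos := card_pos.2 hTne
  -- degrees into B
  have hsoloB : ∀ z y, Solo G S f A T z y → dg G B z ≤ q := by
    intro z y h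
    have h1 := hdeg z h.1
    rw [dg_split f A, ← hBdef] at h1
    have h2 : ∑ c ∈ A.erase (f z), 1 ≤ ∑ c ∈ A.erase (f z), dg G (cls S f c) z :=
      sum_le_sum fun c hc => hsolo z y h c (mem_of_mem_erase hc) (ne_of_mem_erase hc)
    have h3 : ∑ c ∈ A.erase (f z), dg G (cls S f c) z ≤ ∑ c ∈ A, dg G (cls S f c) z :=
      sum_le_sum_of_subset (erase_subset _ _)
    rw [sum_const, card_erase_of_mem (hTA h.2.1)] at h2
    simp at h2
    omega
  have hxB : ∀ x ∈ S, f x ∈ T → dg G B x ≤ q + T.card := by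
    intro x hx hxT
    have h1 := hdeg x hx
    rw [dg_split f A, ← hBdef] at h1
    have hi : insert U T ⊆ A := insert_subset hUA hTA
    have h2 : ∑ c ∈ A \ insert U T, 1 ≤ ∑ c ∈ A \ insert U T, dg G (cls S f c) x :=
      sum_le_sum fun c hc => by
        simp at hc
        exact hT x hx hxT c hc.1 hc.2.1 hc.2.2
    have h3 : ∑ c ∈ A \ insert U T, dg G (cls S f c) x ≤ ∑ c ∈ A, dg G (cls S f c) x :=
      sum_le_sum_of_subset sdiff_subset
    rw [sum_const, card_sdiff_of_subset hi, card_insert_of_notMem hUT] at h2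
    have h4 := card_le_card hi
    rw [card_insert_of_notMem hUT] at h4
    simp at h2
    omega
  -- number of solo neighbours
  have hSy : ∀ y ∈ B, T.card + (dg G B y + 1) ≤ (S.filter (fun z => Solo G S f A T z y)).card + q
      ∧ dg G B y + 1 ≤ q := by
    intro y hy
    rw [hmB] at hy
    rw [solo_count G S f A T y hy.1 hy.2]
    have h1 := hdeg y hy.1
    rw [dg_split f A, ← hBdef] at h1
    have h2 : ∑ c ∈ A, (1 + if c ∈ T ∧ dg G (cls S f c) y ≠ 1 then 1 else 0) ≤
        ∑ c ∈ A, dg G (cls S f c) y := sum_le_sum fun c hc => by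
      have := hBA y hy.1 hy.2 c hc
      split_ifs with h
      · have := h.2; omega
      · omega
    rw [sum_add_distrib, ← card_filter] at h2
    have h3 : (T.filter (fun c => ¬ dg G (cls S f c) y = 1)).card ≤
        (A.filter (fun c => c ∈ T ∧ dg G (cls S f c) y ≠ 1)).card := by
      refine card_le_card fun c hc => ?_
      simp only [mem_filter] at hc ⊢
      exact ⟨hTA hc.1, hc⟩
    have h4 := card_filter_add_card_filter_not (s := T) (fun c => dg G (cls S f c) y = 1)
    simp at h2
    simp only [ne_eq] at h3
    omega
  -- q < |T|
  have hqt : q < T.card := by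
    obtain ⟨W, hW⟩ := hTne
    set P : V → Prop := fun z => ∃ y, Solo G S f A T z y with hP
    set So := (cls S f W).filter P with hSo
    set D := (cls S f W).filter (fun z => ¬ P z) with hD
    have hc : So.card + D.card = s := by
      rw [← hTs W hW]; exact card_filter_add_card_filter_not _
    have h1 : ∑ y ∈ B, 2 ≤ ∑ y ∈ B, (2 * dg G So y + dg G D y) := by
      refine sum_le_sum fun y hy => ?_
      rw [hmB] at hy
      have e := dg_union G (cls S f W) P y
      rw [← hSo, ← hD] at e
      have e1 := hBA y hy.1 hy.2 W (hTA hW)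
      by_cases h0 : 1 ≤ dg G So y
      · omega
      by_contra hlt
      apply h0
      have e2 : dg G (cls S f W) y = 1 := by omega
      obtain ⟨z, hz, hyz⟩ := dg_pos.1 e1
      refine dg_pos.2 ⟨z, mem_filter.2 ⟨hz, y, ?_⟩, hyz⟩
      simp only [cls, mem_filter] at hz
      obtain ⟨hzS, rfl⟩ := hz
      exact ⟨hzS, hW, hy.1, hy.2, hyz.symm, e2⟩
    rw [sum_add_distrib, ← mul_sum, dg_comm G B So, dg_comm G B D] at h1
    have h2 : ∑ x ∈ So, dg G B x ≤ So.card * q := by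
      rw [← smul_eq_mul]
      refine sum_le_card_nsmul _ _ _ fun x hx => ?_
      obtain ⟨y, hy⟩ := (mem_filter.1 hx).2
      exact hsoloB x y hy
    have h3 : ∑ x ∈ D, dg G B x ≤ D.card * (q + T.card) := by
      rw [← smul_eq_mul]
      refine sum_le_card_nsmul _ _ _ fun x hx => ?_
      have := (mem_filter.1 hx).1
      simp only [cls, mem_filter] at this
      exact hxB x this.1 (this.2 ▸ hW)
    rw [sum_const, hB, smul_eq_mul] at h1
    by_contra hcon
    push Not at hcon
    have h4 : D.card * T.card ≤ D.card * q := Nat.mul_le_mul_left _ hcon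
    subst hc
    nlinarith
  by_contra! hcon
  have hclique : ∀ z y, Solo G S f A T z y →
      (B.filter (fun y' => Solo G S f A T z y')).card ≤ dg G B y + 1 := by
    intro z y hzy
    have : B.filter (fun y' => Solo G S f A T z y') ⊆ insert y (B.filter (fun w => G.Adj y w)) := by
      intro y' hy'
      rw [mem_filter] at hy'
      by_cases h : y' = y
      · simp [h]
      · exact mem_insert_of_mem (mem_filter.2 ⟨hy'.1, hcon z y y' hzy hy'.2 (Ne.symm h)⟩)
    exact (card_le_card this).trans (card_insert_le _ _)
  set sz : V → ℕ := fun z => (B.filter (fun y' => Solo G S f A T z y')).card with hsz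
  have hlow : ∀ y ∈ B, (T.card : ℚ) ≤ ∑ z ∈ S, if Solo G S f A T z y then (q : ℚ) / sz z else 0 := by
    intro y hy
    obtain ⟨h1, h2⟩ := hSy y hy
    rw [← sum_filter]
    set c := dg G B y + 1 with hc
    have hcpos : (0 : ℚ) < c := by rw [hc]; positivity
    have h3 : ∑ z ∈ S.filter (fun z => Solo G S f A T z y), (q : ℚ) / c ≤
        ∑ z ∈ S.filter (fun z => Solo G S f A T z y), (q : ℚ) / sz z := by
      refine sum_le_sum fun z hz => ?_
      have hz := (mem_filter.1 hz).2
      have hpos : 0 < sz z := card_pos.2 ⟨y, mem_filter.2 ⟨hy, hz⟩⟩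
      have := hclique z y hz
      have h5 : (sz z : ℚ) ≤ c := by exact_mod_cast this
      have h6 : (0 : ℚ) < sz z := by exact_mod_cast hpos
      gcongr
    refine le_trans ?_ h3
    rw [sum_const, nsmul_eq_mul, ← mul_div_assoc, le_div_iff₀ hcpos]
    have h1' : (T.card : ℚ) + c ≤ (S.filter (fun z => Solo G S f A T z y)).card + q := by
      exact_mod_cast h1
    have h2' : (c : ℚ) ≤ q := by exact_mod_cast h2
    have h3' : (q : ℚ) ≤ T.card := by exact_mod_cast hqt.le
    nlinarith [mul_nonneg (sub_nonneg.2 h2') (sub_nonneg.2 h3'),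
      mul_le_mul_of_nonneg_right h1' (Nat.cast_nonneg (α := ℚ) q)]
  have hup : ∀ z ∈ S, (∑ y ∈ B, if Solo G S f A T z y then (q : ℚ) / sz z else 0) ≤
      if f z ∈ T then (q : ℚ) else 0 := by
    intro z hz
    rw [← sum_filter, sum_const, nsmul_eq_mul]
    by_cases h0 : sz z = 0
    · have : ((B.filter (fun y' => Solo G S f A T z y')).card : ℚ) = 0 := by exact_mod_cast h0
      rw [this]; split_ifs <;> simp
    · obtain ⟨y, hy⟩ := card_pos.1 (Nat.pos_of_ne_zero h0)
      have hy := (mem_filter.1 hy).2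
      rw [if_pos hy.2.1]
      have h0' : (sz z : ℚ) ≠ 0 := by exact_mod_cast h0
      change (sz z : ℚ) * (q / sz z) ≤ q
      rw [mul_div_cancel₀ _ h0']
  have h1 : (B.card : ℚ) * T.card ≤ ∑ y ∈ B, ∑ z ∈ S, if Solo G S f A T z y then (q : ℚ) / sz z else 0 := by
    rw [← nsmul_eq_mul]
    exact card_nsmul_le_sum _ _ _ hlow
  rw [sum_comm] at h1
  have h2 := h1.trans (sum_le_sum hup)
  rw [← sum_filter, sum_const, card_filter_cls, sum_congr rfl hTs, sum_const, hB] at h2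
  simp only [nsmul_eq_mul, smul_eq_mul] at h2
  push_cast at h2
  have : (0 : ℚ) < T.card := by exact_mod_cast hTpos
  nlinarith

theorem Col.mono {G : SimpleGraph V} {S S' : Finset V} {C : Finset ι} {f : V → ι}
    (h : Col G S C f) (hS : S' ⊆ S) : Col G S' C f :=
  ⟨fun v hv => h.mem v (hS hv), fun v hv w hw => h.proper v (hS hv) w (hS hw)⟩

theorem Col.insert {G : SimpleGraph V} {S : Finset V} {C : Finset ι} {f : V → ι} {y : V} {e : ι}
    (h : Col G S C f) (hy : y ∉ S) (he : e ∈ C) (hz : ∀ w ∈ S, f w = e → ¬ G.Adj y w) :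
    Col G (insert y S) C (Function.update f y e) ∧
    ∀ c, (cls (insert y S) (Function.update f y e) c).card =
      (cls S f c).card + if c = e then 1 else 0 := by
  have hne : ∀ v ∈ S, v ≠ y := by rintro v hv rfl; exact hy hv
  refine ⟨⟨?_, ?_⟩, ?_⟩
  · intro v hv
    rcases mem_insert.1 hv with rfl | hv
    · simpa using he
    · rw [Function.update_of_ne (hne v hv)]; exact h.mem v hv
  · intro v hv w hw hvw
    rcases mem_insert.1 hv with hvy | hv'
    · subst hvy
      rcases mem_insert.1 hw with hwy | hw'
      · exact absurd hwy.symm hvw.ne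
      · rw [Function.update_self, Function.update_of_ne (hne w hw')]
        exact fun h => hz w hw' h.symm hvw
    · rcases mem_insert.1 hw with hwy | hw'
      · rw [hwy, Function.update_self, Function.update_of_ne (hne v hv')]
        exact fun h => hz v hv' h (hwy ▸ hvw.symm)
      · rw [Function.update_of_ne (hne v hv'), Function.update_of_ne (hne w hw')]
        exact h.proper v hv' w hw' hvw
  · intro c
    have hsame : S.filter (fun v => Function.update f y e v = c) = cls S f c := by
      refine filter_congr fun v hv => ?_
      rw [Function.update_of_ne (hne v hv)]
    unfold cls at hsame ⊢
    rw [filter_insert, hsame, Function.update_self]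
    by_cases hc : c = e
    · subst hc
      simp only [if_true]
      rw [card_insert_of_notMem]
      exact fun h => hy (mem_filter.1 h).1
    · rw [if_neg (Ne.symm hc), if_neg hc]; rfl

theorem combine {G : SimpleGraph V} {S S₁ : Finset V} {C A : Finset ι} {f₁ f₂ : V → ι}
    (hA : A ⊆ C) (hS : S₁ ⊆ S) (h₁ : Col G S₁ A f₁) (h₂ : Col G (S \ S₁) (C \ A) f₂) :
    Col G S C (fun v => if v ∈ S₁ then f₁ v else f₂ v) ∧
    (∀ c ∈ A, cls S (fun v => if v ∈ S₁ then f₁ v else f₂ v) c = cls S₁ f₁ c) ∧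
    (∀ c ∈ C \ A, cls S (fun v => if v ∈ S₁ then f₁ v else f₂ v) c = cls (S \ S₁) f₂ c) := by
  have m2 : ∀ v ∈ S, v ∉ S₁ → f₂ v ∈ C ∧ f₂ v ∉ A := fun v hv hv1 =>
    mem_sdiff.1 (h₂.mem v (mem_sdiff.2 ⟨hv, hv1⟩))
  refine ⟨⟨?_, ?_⟩, ?_, ?_⟩
  · intro v hv
    by_cases h : v ∈ S₁
    · simp only [h, if_true]; exact hA (h₁.mem v h)
    · simp only [h, if_false]; exact (m2 v hv h).1
  · intro v hv w hw hvw
    by_cases h : v ∈ S₁ <;> by_cases h' : w ∈ S₁ <;> simp only [h, h', if_true, if_false]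
    · exact h₁.proper v h w h' hvw
    · intro e; exact (m2 w hw h').2 (e ▸ h₁.mem v h)
    · intro e; exact (m2 v hv h).2 (e ▸ h₁.mem w h')
    · exact h₂.proper v (mem_sdiff.2 ⟨hv, h⟩) w (mem_sdiff.2 ⟨hw, h'⟩) hvw
  · intro c hc
    ext v
    simp only [cls, mem_filter]
    by_cases h : v ∈ S₁
    · simp [h, hS h]
    · simp only [h, if_false, false_and, iff_false]
      rintro ⟨hv, rfl⟩; exact (m2 v hv h).2 hc
  · intro c hc
    ext v
    simp only [cls, mem_filter, mem_sdiff]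
    by_cases h : v ∈ S₁
    · simp only [h, if_true, not_true, and_false, false_and, iff_false]
      rintro ⟨hv, rfl⟩; exact (mem_sdiff.1 hc).2 (h₁.mem v h)
    · simp [h]

theorem chain_mem {R : ι → ι → Prop} {c : ι} {l : List ι} (h : List.IsChain R (c :: l)) :
    List.IsChain (fun x y => R x y ∧ x ∈ c :: l ∧ y ∈ l) (c :: l) := by
  rw [List.isChain_iff_getElem] at h ⊢
  intro i hi
  refine ⟨h i hi, List.getElem_mem _, ?_⟩
  simp

theorem chain_tail {R : ι → ι → Prop} {l : List ι} : ∀ {c : ι}, List.IsChain R (c :: l) →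
    ∀ x ∈ l, ∃ y, R y x := by
  induction l with
  | nil => simp
  | cons d l ih =>
    intro c h x hx
    rw [List.isChain_cons_cons] at h
    rcases List.mem_cons.1 hx with rfl | hx
    · exact ⟨c, h.1⟩
    · exact ih h.2 x hx

theorem solo_unique {G : SimpleGraph V} {S : Finset V} {f : V → ι} {A T : Finset ι} {z y : V}
    (h : Solo G S f A T z y) : ∀ w ∈ S, f w = f z → G.Adj y w → w = z := by
  intro w hw hwz hyw
  have h1 := h.2.2.2.2.2
  unfold dg at h1
  rw [card_eq_one] at h1
  obtain ⟨x, hx⟩ := h1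
  have h1 : z ∈ ({x} : Finset V) := by
    rw [← hx, mem_filter, cls, mem_filter]; exact ⟨⟨h.1, rfl⟩, h.2.2.2.2.1.symm⟩
  have h2 : w ∈ ({x} : Finset V) := by
    rw [← hx, mem_filter, cls, mem_filter]; exact ⟨⟨hw, hwz⟩, hyw⟩
  rw [mem_singleton] at h1 h2
  rw [h1, h2]

theorem cls_filter {S : Finset V} {f : V → ι} {A : Finset ι} {c : ι} (hc : c ∈ A) :
    cls (S.filter (fun v => f v ∈ A)) f c = cls S f c := by
  ext v; simp only [cls, mem_filter]
  constructor
  · tauto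
  · rintro ⟨h, rfl⟩; tauto

theorem case1 {G : SimpleGraph V} {S : Finset V} {C A T : Finset ι} {f : V → ι} {s : ℕ}
    {a X : ι} {z y : V} (hf : Col G S C f) (hA : A ⊆ C)
    (hsz : ∀ c ∈ A, (cls S f c).card + (if c = a then 1 else 0) = s)
    (hzy : Solo G S f A T z y) (hzA : f z ∈ A) (hXA : X ∈ A) (hXz : X ≠ f z)
    (hzX : ∀ w ∈ S, f w = X → ¬ G.Adj z w)
    (hpath : ReflTransGen (fun c d => Mv G S C f c d ∧ d ≠ f z ∧ c ≠ f z ∧ c ∈ A ∧ d ∈ A) X a)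
    (hg : Good G ((S.filter (fun w => f w ∉ A)).erase y) (C \ A) s) :
    Good G S C s := by
  obtain ⟨g, hgc, hgs⟩ := hg
  obtain ⟨l, hl1, hl2, hl3⟩ := nodup_chain hpath
  set S₀ := S.filter (fun v => f v ∈ A) with hS₀
  have hlA : ∀ x ∈ X :: l, x ≠ f z := by
    intro x hx
    rcases List.mem_cons.1 hx with rfl | hx
    · exact hXz
    · obtain ⟨_, h⟩ := chain_tail hl1 x hx; exact h.2.1
  have hf0 : Col G S₀ A f := ⟨fun v hv => (mem_filter.1 hv).2,
    fun v hv w hw => hf.proper v (mem_filter.1 hv).1 w (mem_filter.1 hw).1⟩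
  have hf1 : Col G S₀ A (Function.update f z X) :=
    hf0.update hXA fun w hw => hzX w (mem_filter.1 hw).1
  have hzS0 : z ∈ S₀ := mem_filter.2 ⟨hzy.1, hzA⟩
  have hch : List.IsChain (Mv G S₀ A (Function.update f z X)) (X :: l) := by
    refine (chain_mem hl1).imp ?_
    rintro c d ⟨⟨⟨_, _, h1, v, hv, hvc, hvd⟩, h2, h3, h4, h5⟩, _, h6⟩
    refine Mv.update ⟨h4, h5, h1, v, mem_filter.2 ⟨hv, hvc ▸ h4⟩, hvc,
      fun w hw => hvd w (mem_filter.1 hw).1⟩ h3 ?_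
    rintro rfl; exact (List.nodup_cons.1 hl2).1 h6
  obtain ⟨f', hf', hfl, hsz'⟩ := shift G S₀ A a l X _ hf1 hch hl2 hl3
  have hyS0 : y ∉ S₀ := fun h => hzy.2.2.2.1 (mem_filter.1 h).2
  have hfin := hf'.insert hyS0 hzA (by
    intro w hw hwz hyw
    have hw1 : Function.update f z X w = f z := by
      rcases hfl w with h | h
      · rw [← h, hwz]
      · exact absurd hwz (hlA _ h.2)
    by_cases hwz' : w = z
    · subst hwz'; rw [Function.update_self] at hw1; exact hXz hw1
    · rw [Function.update_of_ne hwz'] at hw1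
      exact hwz' (solo_unique hzy w (mem_filter.1 hw).1 hw1 hyw))
  have hsub : insert y S₀ ⊆ S := insert_subset hzy.2.2.1 (filter_subset _ _)
  have hdiff : S \ insert y S₀ = (S.filter (fun w => f w ∉ A)).erase y := by
    ext v; simp only [hS₀, mem_sdiff, mem_insert, mem_filter, mem_erase]; tauto
  rw [← hdiff] at hgc hgs
  obtain ⟨k1, k2, k3⟩ := combine hA hsub hfin.1 hgc
  refine ⟨_, k1, fun c hc => ?_⟩
  by_cases hcA : c ∈ A
  · rw [k2 c hcA, hfin.2]
    have e1 := hsz' c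
    have e2 := cls_update hzS0 rfl hXz.symm c
    have e3 := hsz c hcA
    rw [← cls_filter hcA, ← hS₀] at e3
    omega
  · rw [k3 c (mem_sdiff.2 ⟨hc, hcA⟩)]
    exact hgs c (mem_sdiff.2 ⟨hc, hcA⟩)

/-- nearly equitable colouring -/
structure Near (G : SimpleGraph V) (S : Finset V) (C : Finset ι) (f : V → ι) (s : ℕ) (a b : ι) :
    Prop where
  col : Col G S C f
  ha : a ∈ C
  hb : b ∈ C
  hab : a ≠ b
  sz : ∀ c ∈ C, (cls S f c).card + (if c = a then 1 else 0) = s + if c = b then 1 else 0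

/-- accessible classes -/
noncomputable def Acc (G : SimpleGraph V) (S : Finset V) (C : Finset ι) (f : V → ι) (a : ι) :
    Finset ι := C.filter (fun c => ReflTransGen (Mv G S C f) c a)

theorem free_color {G : SimpleGraph V} {S : Finset V} {C : Finset ι} (f : V → ι) {v : V}
    (h : dg G S v < C.card) : ∃ c ∈ C, ∀ w ∈ S, f w = c → ¬ G.Adj v w := by
  by_contra! hcon
  have h1 : ∑ c ∈ C, 1 ≤ ∑ c ∈ C, dg G (cls S f c) v := sum_le_sum fun c hc => by
    obtain ⟨w, hw, hwc, hvw⟩ := hcon c hc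
    exact dg_pos.2 ⟨w, mem_filter.2 ⟨hw, hwc⟩, hvw⟩
  rw [← dg_filter] at h1
  have := dg_mono G (filter_subset (fun w => f w ∈ C) S) v
  simp at h1
  omega

theorem case2 {G : SimpleGraph V} {S : Finset V} {C T : Finset ι} {f : V → ι} {s : ℕ}
    {a b : ι} {z y₁ y₂ : V} (hf : Near G S C f s a b)
    (hTA : T ⊆ Acc G S C f a) (haT : a ∉ T) (hbA : b ∉ Acc G S C f a)
    (hz1 : Solo G S f (Acc G S C f a) T z y₁) (hz2 : Solo G S f (Acc G S C f a) T z y₂)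
    (hne : y₁ ≠ y₂) (hadj : ¬ G.Adj y₁ y₂)
    (hsolo : ∀ X ∈ Acc G S C f a, X ≠ f z → 1 ≤ dg G (cls S f X) z)
    (hterm : ∀ X ∈ Acc G S C f a, X ≠ f z → ReflTransGen (Av (Mv G S C f) (f z)) X a)
    (hdeg : dg G S z < C.card)
    (hg : Good G ((S.filter (fun w => f w ∉ Acc G S C f a)).erase y₁) (C \ Acc G S C f a) s) :
    ∃ f' b', Near G S C f' s a b' ∧ (Acc G S C f a).card < (Acc G S C f' a).card := by
  obtain ⟨g, hgc, hgs⟩ := hg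
  set A := Acc G S C f a with hAdef
  have hmA : ∀ c, c ∈ A ↔ c ∈ C ∧ ReflTransGen (Mv G S C f) c a := by
    intro c; rw [hAdef, Acc, mem_filter]
  have hA : A ⊆ C := filter_subset _ _
  set S₀ := S.filter (fun v => f v ∈ A) with hS₀
  set B := S.filter (fun v => f v ∉ A) with hB
  have hzA := hTA hz1.2.1
  have hzS0 : z ∈ S₀ := mem_filter.2 ⟨hz1.1, hzA⟩
  have hy1B : y₁ ∈ B := mem_filter.2 ⟨hz1.2.2.1, hz1.2.2.2.1⟩
  have hy1S0 : y₁ ∉ S₀.erase z := fun h => hz1.2.2.2.1 (mem_filter.1 (mem_of_mem_erase h)).2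
  have hzB : z ∉ B.erase y₁ := fun h => (mem_filter.1 (mem_of_mem_erase h)).2 hzA
  have hf0 : Col G S₀ A f := ⟨fun v hv => (mem_filter.1 hv).2,
    fun v hv w hw => hf.col.proper v (mem_filter.1 hv).1 w (mem_filter.1 hw).1⟩
  have h1 := (hf0.mono (erase_subset z S₀)).insert hy1S0 hzA (by
    intro w hw hwz hyw
    exact ne_of_mem_erase hw
      (solo_unique hz1 w (mem_filter.1 (mem_of_mem_erase hw)).1 hwz hyw))
  -- colour for z
  have hdz : dg G (B.erase y₁) z < (C \ A).card := by
    have e1 := hdeg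
    rw [dg_split f A, ← hB] at e1
    have e2 : ∑ c ∈ A.erase (f z), 1 ≤ ∑ c ∈ A.erase (f z), dg G (cls S f c) z :=
      sum_le_sum fun c hc => hsolo c (mem_of_mem_erase hc) (ne_of_mem_erase hc)
    have e3 : ∑ c ∈ A.erase (f z), dg G (cls S f c) z ≤ ∑ c ∈ A, dg G (cls S f c) z :=
      sum_le_sum_of_subset (erase_subset _ _)
    rw [sum_const, card_erase_of_mem hzA] at e2
    have e4 : dg G (B.erase y₁) z + 1 ≤ dg G B z := by
      have : y₁ ∈ B.filter (fun w => G.Adj z w) := mem_filter.2 ⟨hy1B, hz1.2.2.2.2.1⟩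
      unfold dg
      rw [filter_erase, card_erase_of_mem this]
      have := card_pos.2 ⟨_, this⟩
      omega
    rw [card_sdiff_of_subset hA]
    have := card_le_card hA
    have := card_pos.2 ⟨_, hzA⟩
    simp at e2
    omega
  obtain ⟨Y, hYC, hY⟩ := free_color g hdz
  have h2 := hgc.insert hzB hYC hY
  have hsub : insert y₁ (S₀.erase z) ⊆ S :=
    insert_subset hz1.2.2.1 ((erase_subset _ _).trans (filter_subset _ _))
  have hzy : z ≠ y₁ := hz1.2.2.2.2.1.ne
  have hdiff : S \ insert y₁ (S₀.erase z) = insert z (B.erase y₁) := by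
    ext v; simp only [hS₀, hB, mem_sdiff, mem_insert, mem_filter, mem_erase]
    by_cases hv : v = z
    · subst hv; simp [hz1.1, hzy]
    · simp only [hv]; tauto
  rw [← hdiff] at h2
  obtain ⟨k1, k2, k3⟩ := combine hA hsub h1.1 h2.1
  set h : V → ι := fun v => if v ∈ insert y₁ (S₀.erase z) then Function.update f y₁ (f z) v
    else Function.update g z Y v with hh
  have hYA := (mem_sdiff.1 hYC).2
  have haA : a ∈ A := (hmA a).2 ⟨hf.ha, .refl⟩
  have hnear : Near G S C h s a Y := by
    refine ⟨k1, hf.ha, (mem_sdiff.1 hYC).1, ?_, ?_⟩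
    · rintro rfl; exact hYA haA
    · intro c hc
      by_cases hcA : c ∈ A
      · rw [k2 c hcA, h1.2]
        have e1 := hf.sz c hc
        have e2 : (cls (S₀.erase z) f c).card + (if c = f z then 1 else 0) = (cls S f c).card := by
          rw [← cls_filter (S := S) hcA, ← hS₀]
          by_cases hcz : c = f z
          · subst hcz
            rw [if_pos rfl, cls, filter_erase]
            exact card_erase_add_one (mem_filter.2 ⟨hzS0, rfl⟩)
          · rw [if_neg hcz, cls, filter_erase, erase_eq_of_notMem]; rfl
            intro hm; exact hcz (mem_filter.1 hm).2.symm
        have e3 : c ≠ b := by rintro rfl; exact hbA hcA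
        have e4 : c ≠ Y := by rintro rfl; exact hYA hcA
        rw [if_neg e3] at e1
        rw [if_neg e4]
        omega
      · have hcm := mem_sdiff.2 ⟨hc, hcA⟩
        rw [k3 c hcm, h2.2, hgs c hcm]
        have e3 : c ≠ a := by rintro rfl; exact hcA haA
        simp [e3]
  refine ⟨h, Y, hnear, ?_⟩
  -- classes in A other than that of z are unchanged
  have hval : ∀ v ∈ S, f v ∈ A → v ≠ z → h v = f v := by
    intro v hv hvA hvz
    have hm : v ∈ insert y₁ (S₀.erase z) :=
      mem_insert_of_mem (mem_erase.2 ⟨hvz, mem_filter.2 ⟨hv, hvA⟩⟩)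
    have : v ≠ y₁ := by rintro rfl; exact hz1.2.2.2.1 hvA
    simp only [hh, if_pos hm, Function.update_of_ne this]
  have hback : ∀ v ∈ S, h v ∈ A → v = y₁ ∧ h v = f z ∨ v ≠ z ∧ f v = h v := by
    intro v hv hvA
    by_cases hm : v ∈ insert y₁ (S₀.erase z)
    · by_cases hvy : v = y₁
      · left; refine ⟨hvy, ?_⟩
        simp only [hh, if_pos hm]; rw [hvy, Function.update_self]
      · right
        have hm' := mem_of_mem_insert_of_ne hm hvy
        refine ⟨ne_of_mem_erase hm', ?_⟩
        simp only [hh, if_pos hm, Function.update_of_ne hvy]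
    · exfalso
      have := h2.1.mem v (mem_sdiff.2 ⟨hv, hm⟩)
      simp only [hh, if_neg hm] at hvA
      exact (mem_sdiff.1 this).2 hvA
  have hmv : ∀ v ∈ S, f v ∈ A → v ≠ z → ∀ d ∈ A, d ≠ f z → f v ≠ d →
      (∀ w ∈ S, f w = d → ¬ G.Adj v w) → Mv G S C h (f v) d := by
    intro v hv hvA hvz d hd hdz hvd hw
    refine ⟨hA hvA, hA hd, hvd, v, hv, hval v hv hvA hvz, ?_⟩
    intro w hwS hwd
    rcases hback w hwS (hwd ▸ hd) with ⟨_, e⟩ | ⟨_, e⟩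
    · exact absurd (hwd.symm.trans e) hdz
    · exact hw w hwS (e.trans hwd)
  have hreach : ∀ X, ReflTransGen (Av (Mv G S C f) (f z)) X a →
      ReflTransGen (Mv G S C f) X a ∧ ReflTransGen (Mv G S C h) X a := by
    intro X hX
    induction hX using ReflTransGen.head_induction_on with
    | refl => exact ⟨.refl, .refl⟩
    | head hcd hd ih =>
      have hc := ReflTransGen.head hcd.1 ih.1
      refine ⟨hc, .head ?_ ih.2⟩
      obtain ⟨⟨m1, m2, m3, v, hv, rfl, hvd⟩, m4, m5⟩ := hcd
      refine hmv v hv ((hmA _).2 ⟨m1, hc⟩) ?_ _ ((hmA _).2 ⟨m2, ih.1⟩) m5 m3 hvd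
      rintro rfl; exact m4 rfl
  have hW : ReflTransGen (Mv G S C h) (f z) a := by
    rcases ReflTransGen.cases_head ((hmA _).1 hzA).2 with e | ⟨d, hd, hda⟩
    · exact absurd (e ▸ hz1.2.1) haT
    · obtain ⟨m1, m2, m3, v, hv, hvz, hvd⟩ := hd
      have hdA : d ∈ A := (hmA d).2 ⟨m2, hda⟩
      refine .head ?_ (hreach d (hterm d hdA m3.symm)).2
      rw [← hvz]
      refine hmv v hv (hvz ▸ hzA) ?_ d hdA m3.symm (hvz ▸ m3) hvd
      rintro rfl
      obtain ⟨w, hw, hvw⟩ := dg_pos.1 (hsolo d hdA m3.symm)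
      exact hvd w (mem_filter.1 hw).1 (mem_filter.1 hw).2 hvw
  have hy2 : h y₂ ∉ A := by
    intro hm
    rcases hback y₂ hz2.2.2.1 hm with ⟨e, _⟩ | ⟨_, e⟩
    · exact hne e.symm
    · exact hz2.2.2.2.1 (e ▸ hm)
  have hy2C := k1.mem y₂ hz2.2.2.1
  have hy2acc : ReflTransGen (Mv G S C h) (h y₂) a := by
    refine .head ⟨hy2C, hA hzA, ?_, y₂, hz2.2.2.1, rfl, ?_⟩ hW
    · intro e; exact hy2 (e ▸ hzA)
    · intro w hw hwz hyw
      rcases hback w hw (hwz ▸ hzA) with ⟨rfl, _⟩ | ⟨e1, e2⟩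
      · exact hadj hyw.symm
      · exact e1 (solo_unique hz2 w hw (e2.trans hwz) hyw)
  refine card_lt_card (ssubset_iff.2 ⟨h y₂, hy2, ?_⟩)
  intro c hc
  rw [Acc, mem_filter]
  rcases mem_insert.1 hc with rfl | hc
  · exact ⟨hy2C, hy2acc⟩
  · refine ⟨hA hc, ?_⟩
    by_cases hcz : c = f z
    · rw [hcz]; exact hW
    · exact (hreach c (hterm c hc hcz)).2

theorem near_good {G : SimpleGraph V} {S : Finset V} {C : Finset ι} {s : ℕ}
    (hdeg : ∀ v ∈ S, dg G S v < C.card)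
    (IH : ∀ y ∈ S, (∃ w ∈ S, G.Adj y w) → ∀ S' ⊆ S.erase y, ∀ C' : Finset ι,
      S'.card = C'.card * s → (∀ v ∈ S', dg G S' v < C'.card) → Good G S' C' s) :
    ∀ (k : ℕ) (f : V → ι) (a b : ι), Near G S C f s a b → C.card < (Acc G S C f a).card + k →
      Good G S C s := by
  intro k
  induction k with
  | zero =>
    intro f a b hf hk
    have : (Acc G S C f a).card ≤ C.card := card_le_card (filter_subset _ _)
    omega
  | succ k ihk =>
    intro f a b hf hk
    by_cases hbA : b ∈ Acc G S C f a
    · -- the large class is accessible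
      rw [Acc, mem_filter] at hbA
      obtain ⟨l, hl1, hl2, hl3⟩ := nodup_chain hbA.2
      obtain ⟨f', h1, _, h3⟩ := shift G S C a l b f hf.col hl1 hl2 hl3
      refine ⟨f', h1, fun c hc => ?_⟩
      have e1 := h3 c
      have e2 := hf.sz c hc
      omega
    set A := Acc G S C f a with hAdef
    have hmA : ∀ c, c ∈ A ↔ c ∈ C ∧ ReflTransGen (Mv G S C f) c a := by
      intro c; rw [hAdef, Acc, mem_filter]
    have hA : A ⊆ C := filter_subset _ _
    have haA : a ∈ A := (hmA a).2 ⟨hf.ha, .refl⟩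
    obtain ⟨q, hq⟩ := Nat.exists_eq_add_of_le (card_le_card hA)
    set B := S.filter (fun w => f w ∉ A) with hBdef
    have hBA : ∀ y ∈ S, f y ∉ A → ∀ c ∈ A, 1 ≤ dg G (cls S f c) y := by
      intro y hy hyA c hc
      by_contra hcon
      rw [dg_pos] at hcon
      push Not at hcon
      apply hyA
      rw [hmA]
      refine ⟨hf.col.mem y hy, .head ⟨hf.col.mem y hy, hA hc, ?_, y, hy, rfl, ?_⟩ ((hmA c).1 hc).2⟩
      · rintro rfl; exact hyA hc
      · intro w hw hwc; exact hcon w (mem_filter.2 ⟨hw, hwc⟩)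
    have hszA : ∀ c ∈ A, (cls S f c).card + (if c = a then 1 else 0) = s := by
      intro c hc
      have := hf.sz c (hA hc)
      rwa [if_neg (show c ≠ b by rintro rfl; exact hbA hc)] at this
    have hBeq : B = S.filter (fun w => f w ∈ C \ A) := by
      refine filter_congr fun v hv => ?_
      simp [hf.col.mem v hv]
    have hqC : (C \ A).card = q := by rw [card_sdiff_of_subset hA]; omega
    have hBcard : B.card = q * s + 1 := by
      rw [hBeq, card_filter_cls]
      have : ∀ c ∈ C \ A, (cls S f c).card = s + if b = c then 1 else 0 := by
        intro c hc
        rw [mem_sdiff] at hc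
        have := hf.sz c hc.1
        rw [if_neg (show c ≠ a by rintro rfl; exact hc.2 haA)] at this
        simpa [eq_comm] using this
      rw [sum_congr rfl this, sum_add_distrib, sum_const, sum_ite_eq,
        if_pos (mem_sdiff.2 ⟨hf.hb, hbA⟩), hqC, smul_eq_mul]
    have hdB : ∀ y ∈ B, dg G B y < q := by
      intro y hy
      have hy' := mem_filter.1 hy
      have h1 := hdeg y hy'.1
      rw [dg_split f A, ← hBdef] at h1
      have h2 : ∑ c ∈ A, 1 ≤ ∑ c ∈ A, dg G (cls S f c) y :=
        sum_le_sum fun c hc => hBA y hy'.1 hy'.2 c hc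
      simp at h2
      omega
    have hne : ∃ X ∈ A, X ≠ a := by
      by_contra! hcon
      have hAa : A = {a} := by
        ext c; rw [mem_singleton]
        exact ⟨hcon c, by rintro rfl; exact haA⟩
      have h1 : ∑ y ∈ B, 1 ≤ ∑ y ∈ B, dg G (cls S f a) y := sum_le_sum fun y hy =>
        hBA y (mem_filter.1 hy).1 (mem_filter.1 hy).2 a haA
      rw [dg_comm] at h1
      have h2 : ∑ x ∈ cls S f a, dg G B x ≤ (cls S f a).card * q := by
        rw [← smul_eq_mul]
        refine sum_le_card_nsmul _ _ _ fun x hx => ?_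
        have h3 := hdeg x (mem_filter.1 hx).1
        have h4 := dg_mono G (filter_subset (fun w => f w ∉ A) S) x
        rw [← hBdef] at h4
        rw [hq, hAa, card_singleton] at h3
        omega
      have h3 := hszA a haA
      rw [if_pos rfl] at h3
      simp only [sum_const, smul_eq_mul, mul_one] at h1
      subst h3
      nlinarith
    obtain ⟨U, hUA, T, hTA, hTne, hUT, haT, hterm, hTout⟩ :=
      digraph A (Mv G S C f) a haA (fun X hX => ((hmA X).1 hX).2) hne
    have hTs : ∀ W ∈ T, (cls S f W).card = s := by
      intro W hW
      have := hszA W (hTA hW)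
      rwa [if_neg (show W ≠ a by rintro rfl; exact haT hW)] at this
    have hT : ∀ x ∈ S, f x ∈ T → ∀ c ∈ A, c ≠ U → c ∉ T → 1 ≤ dg G (cls S f c) x := by
      intro x hx hxT c hc hcU hcT
      by_contra hcon
      rw [dg_pos] at hcon
      push Not at hcon
      have hm : Mv G S C f (f x) c := by
        refine ⟨hA (hTA hxT), hA hc, ?_, x, hx, rfl, ?_⟩
        · rintro rfl; exact hcT hxT
        · intro w hw hwc; exact hcon w (mem_filter.2 ⟨hw, hwc⟩)
      rcases hTout _ hxT c hc hm with h | h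
      · exact hcU h
      · exact hcT h
    have hgood : ∀ z y, Solo G S f A T z y → Good G (B.erase y) (C \ A) s := by
      intro z y h
      have hyB : y ∈ B := mem_filter.2 ⟨h.2.2.1, h.2.2.2.1⟩
      refine IH y h.2.2.1 ⟨z, h.1, h.2.2.2.2.1.symm⟩ _ (erase_subset_erase _ (filter_subset _ _)) _
        ?_ ?_
      · rw [card_erase_of_mem hyB, hBcard, hqC]; simp
      · intro v hv
        rw [hqC]
        exact (dg_mono G (erase_subset _ _) v).trans_lt (hdB v (mem_of_mem_erase hv))
    by_cases hsolo : ∀ z y, Solo G S f A T z y → ∀ X ∈ A, X ≠ f z → 1 ≤ dg G (cls S f X) z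
    · obtain ⟨z, y₁, y₂, h1, h2, hy, hadj⟩ :=
        exists_pair hdeg hq hBA hBcard hTA hTne hUA hUT hTs hT hsolo
      obtain ⟨f', b', hn, hc⟩ := case2 hf hTA haT hbA h1 h2 hy hadj (hsolo z y₁ h1)
        (hterm (f z) h1.2.1) (hdeg z h1.1) (hgood z y₁ h1)
      rw [← hAdef] at hc
      refine ihk f' a b' hn ?_
      omega
    · push Not at hsolo
      obtain ⟨z, y, hzy, X, hX, hXz, hd⟩ := hsolo
      refine case1 hf.col hA hszA hzy (hTA hzy.2.1) hX hXz ?_ ?_ (hgood z y hzy)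
      · intro w hw hwX hzw
        have hwc : w ∈ cls S f X := mem_filter.2 ⟨hw, hwX⟩
        have := dg_pos.2 ⟨w, hwc, hzw⟩
        omega
      · have hp := hterm (f z) hzy.2.1 X hX hXz
        have key : ∀ X, ReflTransGen (Av (Mv G S C f) (f z)) X a →
            ReflTransGen (Mv G S C f) X a ∧ ReflTransGen
            (fun c d => Mv G S C f c d ∧ d ≠ f z ∧ c ≠ f z ∧ c ∈ A ∧ d ∈ A) X a := by
          intro X hX
          induction hX using ReflTransGen.head_induction_on with
          | refl => exact ⟨.refl, .refl⟩
          | head hcd hd ih =>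
            have hc := ReflTransGen.head hcd.1 ih.1
            exact ⟨hc, .head ⟨hcd.1, hcd.2.2, hcd.2.1, (hmA _).2 ⟨hcd.1.1, hc⟩,
              (hmA _).2 ⟨hcd.1.2.1, ih.1⟩⟩ ih.2⟩
        exact (key X hp).2

theorem base [Nonempty ι] (S : Finset V) (C : Finset ι) (s : ℕ) (hcard : S.card = C.card * s) :
    ∃ f : V → ι, (∀ v ∈ S, f v ∈ C) ∧ ∀ c ∈ C, (cls S f c).card = s := by
  induction C using Finset.induction_on generalizing S with
  | empty =>
    have : S = ∅ := by simpa using hcard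
    subst this
    exact ⟨fun _ => Classical.arbitrary ι, by simp, by simp⟩
  | insert c C hc ih =>
    rw [card_insert_of_notMem hc, Nat.add_mul, one_mul] at hcard
    obtain ⟨S', hS', hs⟩ := exists_subset_card_eq (show s ≤ S.card by omega)
    obtain ⟨f, h1, h2⟩ := ih (S \ S') (by rw [card_sdiff_of_subset hS']; omega)
    refine ⟨fun v => if v ∈ S' then c else f v, ?_, ?_⟩
    · intro v hv
      by_cases h : v ∈ S'
      · simp [h]
      · simp only [h, if_false]; exact mem_insert_of_mem (h1 v (mem_sdiff.2 ⟨hv, h⟩))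
    · intro d hd
      rcases mem_insert.1 hd with rfl | hd
      · rw [← hs]; congr 1
        ext v; simp only [cls, mem_filter]
        by_cases h : v ∈ S'
        · simp [h, hS' h]
        · simp only [h, if_false, iff_false]
          rintro ⟨hv, rfl⟩; exact hc (h1 v (mem_sdiff.2 ⟨hv, h⟩))
      · rw [← h2 d hd]; congr 1
        ext v; simp only [cls, mem_filter, mem_sdiff]
        by_cases h : v ∈ S'
        · simp only [h, if_true, not_true, and_false, false_and, iff_false]
          rintro ⟨hv, rfl⟩; exact hc hd
        · simp [h]

theorem hajnal_szemeredi [Nonempty ι] (s : ℕ) : ∀ (k : ℕ) (G : SimpleGraph V) (S : Finset V) (C : Finset ι),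
    (S.filter (fun v => ∃ w ∈ S, G.Adj v w)).card < k →
    S.card = C.card * s → (∀ v ∈ S, dg G S v < C.card) → Good G S C s := by
  intro k
  induction k with
  | zero => intro G S C h; omega
  | succ k ih =>
    intro G S C hk hcard hdeg
    by_cases hu : ∃ u ∈ S, ∃ w ∈ S, G.Adj u w
    swap
    · push Not at hu
      obtain ⟨f, h1, h2⟩ := base S C s hcard
      exact ⟨f, ⟨h1, fun v hv w hw hvw => absurd hvw (hu v hv w hw)⟩, h2⟩
    obtain ⟨u, huS, huw⟩ := hu
    have IH : ∀ y ∈ S, (∃ w ∈ S, G.Adj y w) → ∀ S' ⊆ S.erase y, ∀ C' : Finset ι,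
      S'.card = C'.card * s → (∀ v ∈ S', dg G S' v < C'.card) → Good G S' C' s := by
      intro y hy hyw S' hS' C' hc hd
      refine ih G S' C' (lt_of_lt_of_le (card_lt_card (ssubset_iff.2 ⟨y, ?_, ?_⟩)) (Nat.lt_succ_iff.1 hk)) hc hd
      · intro h; exact notMem_erase y S (hS' (mem_filter.1 h).1)
      · intro v hv
        rcases mem_insert.1 hv with rfl | hv
        · exact mem_filter.2 ⟨hy, hyw⟩
        · rw [mem_filter] at hv
          obtain ⟨hv, w, hw, hvw⟩ := hv
          exact mem_filter.2 ⟨mem_of_mem_erase (hS' hv), w, mem_of_mem_erase (hS' hw), hvw⟩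
    obtain ⟨G', hG'⟩ : ∃ G' : SimpleGraph V, ∀ v w, G'.Adj v w ↔ G.Adj v w ∧ v ≠ u ∧ w ≠ u :=
      ⟨{ Adj := fun v w => G.Adj v w ∧ v ≠ u ∧ w ≠ u
         symm := ⟨fun v w h => ⟨h.1.symm, h.2.2, h.2.1⟩⟩
         loopless := ⟨fun v h => h.1.ne rfl⟩ }, fun _ _ => Iff.rfl⟩
    obtain ⟨f, hf, hfs⟩ : Good G' S C s := by
      refine ih G' S C (lt_of_lt_of_le (card_lt_card (ssubset_iff.2 ⟨u, ?_, ?_⟩)) (Nat.lt_succ_iff.1 hk)) hcard ?_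
      · intro h
        obtain ⟨_, w, _, hw⟩ := mem_filter.1 h
        exact ((hG' _ _).1 hw).2.1 rfl
      · intro v hv
        rcases mem_insert.1 hv with rfl | hv
        · exact mem_filter.2 ⟨huS, huw⟩
        · rw [mem_filter] at hv
          obtain ⟨hv, w, hw, hvw⟩ := hv
          exact mem_filter.2 ⟨hv, w, hw, ((hG' _ _).1 hvw).1⟩
      · intro v hv
        refine lt_of_le_of_lt (card_le_card fun w hw => ?_) (hdeg v hv)
        rw [mem_filter] at hw ⊢
        exact ⟨hw.1, ((hG' _ _).1 hw.2).1⟩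
    obtain ⟨d, hd, hdu⟩ := free_color f (hdeg u huS)
    have hcol : Col G S C (Function.update f u d) := by
      have h1 := hf.update (z := u) hd (fun w _ _ h => ((hG' _ _).1 h).2.1 rfl)
      refine ⟨h1.mem, fun v hv w hw hvw => ?_⟩
      by_cases hvu : v = u
      · subst hvu
        rw [Function.update_self, Function.update_of_ne hvw.ne']
        exact fun e => hdu w hw e.symm hvw
      · by_cases hwu : w = u
        · subst hwu
          rw [Function.update_self, Function.update_of_ne hvu]
          exact fun e => hdu v hv e hvw.symm
        · exact h1.proper v hv w hw ((hG' _ _).2 ⟨hvw, hvu, hwu⟩)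
    by_cases hdf : f u = d
    · have : Function.update f u d = f := by rw [← hdf, Function.update_eq_self]
      rw [this] at hcol
      exact ⟨f, hcol, hfs⟩
    · refine near_good hdeg IH (C.card + 1) (Function.update f u d) (f u) d
        ⟨hcol, hf.mem u huS, hd, hdf, ?_⟩ (by omega)
      intro c hc
      rw [cls_update huS rfl hdf c, hfs c hc]

end HS

/-- **Equitable partition of a daisy into simple daisies** (via Hajnal–Szemerédi).
If every petal `S \ K` of a member `S` of the multiset `𝒟` intersects the petals of at
most `t` other members (counted with multiplicity), then `𝒟` can be partitioned into
`t + 1` sub-multisets, each a simple daisy with kernel `K` (pairwise disjoint petals),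
each of size `⌊|𝒟|/(t+1)⌋` or `⌈|𝒟|/(t+1)⌉`. -/
theorem daisy_equitable_partition (n t : ℕ)
    (𝒟 : Multiset (Finset (Fin n))) (K : Finset (Fin n))
    (hdeg : ∀ S ∈ 𝒟,
      Multiset.countP (fun T => ((T \ K) ∩ (S \ K)).Nonempty) (𝒟.erase S) ≤ t) :
    ∃ 𝒮 : Fin (t + 1) → Multiset (Finset (Fin n)),
      (∑ i, 𝒮 i) = 𝒟 ∧
      (∀ i, (𝒮 i).Pairwise fun S T => Disjoint (S \ K) (T \ K)) ∧
      (∀ i, Multiset.card (𝒮 i) = Multiset.card 𝒟 / (t + 1) ∨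
            Multiset.card (𝒮 i) = (Multiset.card 𝒟 + t) / (t + 1)) := by
  obtain ⟨N, hN⟩ : ∃ N, Multiset.card 𝒟 = N := ⟨_, rfl⟩
  obtain ⟨g, hg⟩ : ∃ g : Fin N → Finset (Fin n), (Finset.univ : Finset (Fin N)).val.map g = 𝒟 := by
    subst hN
    rw [← Multiset.coe_toList 𝒟, Multiset.coe_card]
    refine ⟨𝒟.toList.get, ?_⟩
    rw [Fin.univ_val_map, List.ofFn_get]
  obtain ⟨s, p, hs, hp⟩ : ∃ s p, N + p = (t + 1) * s ∧ p ≤ t := by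
    refine ⟨(N + t) / (t + 1), (t + 1) * ((N + t) / (t + 1)) - N, ?_, ?_⟩
    · have := Nat.div_add_mod (N + t) (t + 1)
      have := Nat.mod_lt (N + t) (show 0 < t + 1 from Nat.succ_pos t)
      omega
    · have := Nat.div_add_mod (N + t) (t + 1)
      omega
  let adj : Fin N ⊕ Fin p → Fin N ⊕ Fin p → Prop := fun v w =>
    match v, w with
    | .inl i, .inl j => i ≠ j ∧ ((g j \ K) ∩ (g i \ K)).Nonempty
    | .inr i, .inr j => i ≠ j
    | _, _ => False
  obtain ⟨G, hG⟩ : ∃ G : SimpleGraph (Fin N ⊕ Fin p), ∀ v w, G.Adj v w ↔ adj v w := by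
    refine ⟨{ Adj := adj, symm := ⟨?_⟩, loopless := ⟨?_⟩ }, fun _ _ => Iff.rfl⟩
    · rintro (i | i) (j | j) h
      · exact ⟨h.1.symm, by rw [Finset.inter_comm]; exact h.2⟩
      · exact h
      · exact h
      · exact Ne.symm h
    · rintro (i | i) h
      · exact h.1 rfl
      · exact h rfl
  have hdegG : ∀ v ∈ (Finset.univ : Finset (Fin N ⊕ Fin p)),
      HS.dg G Finset.univ v < (Finset.univ : Finset (Fin (t + 1))).card := by
    intro v _
    rw [Finset.card_univ, Fintype.card_fin, Nat.lt_succ_iff]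
    rcases v with i | i
    · have h1 := hdeg (g i) (by rw [← hg]; exact Multiset.mem_map_of_mem g (Finset.mem_univ i))
      rw [← hg, ← Multiset.map_erase_of_mem g _ (Finset.mem_univ i), ← Finset.erase_val,
        Multiset.countP_map] at h1
      refine le_trans ?_ h1
      change _ ≤ ((Finset.univ.erase i).filter (fun j => ((g j \ K) ∩ (g i \ K)).Nonempty)).card
      rw [← Finset.card_map (Function.Embedding.inl (β := Fin p))]
      refine Finset.card_le_card ?_
      rintro (j | j) hj
      · have := (hG _ _).1 (Finset.mem_filter.1 hj).2
        simp only [Finset.mem_map, Finset.mem_filter, Finset.mem_erase]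
        exact ⟨j, ⟨⟨this.1.symm, Finset.mem_univ _⟩, this.2⟩, rfl⟩
      · exact ((hG _ _).1 (Finset.mem_filter.1 hj).2).elim
    · refine le_trans ?_ hp
      have : (Finset.univ.map (Function.Embedding.inr (α := Fin N) (β := Fin p))).card = p := by simp
      refine le_trans (Finset.card_le_card ?_) this.le
      rintro (j | j) hj
      · exact ((hG _ _).1 (Finset.mem_filter.1 hj).2).elim
      · simp
  obtain ⟨f, hf, hfs⟩ := HS.hajnal_szemeredi (ι := Fin (t + 1)) s _ G Finset.univ Finset.univ
    (Nat.lt_succ_self _) (by simp [hs]) hdegG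
  refine ⟨fun i => (Finset.univ.filter (fun j => f (.inl j) = i)).val.map g, ?_, ?_, ?_⟩
  · rw [← hg]
    ext S
    rw [Multiset.count_sum', ]
    simp only [Multiset.count_map]
    have := Finset.card_eq_sum_card_fiberwise (s := Finset.univ.filter (fun j => S = g j))
      (t := (Finset.univ : Finset (Fin (t + 1)))) (f := fun j => f (.inl j)) (by intro x _; simp)
    change _ = (Finset.univ.filter (fun j => S = g j)).card
    rw [this]
    refine Finset.sum_congr rfl fun c _ => ?_
    change ((Finset.univ.filter (fun j => f (.inl j) = c)).filter (fun j => S = g j)).card = _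
    rw [Finset.filter_comm]
  · intro i
    refine ⟨(Finset.univ.filter (fun j => f (.inl j) = i)).toList.map g, ?_, ?_⟩
    · rw [← Multiset.map_coe, Finset.coe_toList]
    · rw [List.pairwise_map]
      refine (Finset.nodup_toList _).imp_of_mem ?_
      intro a b ha hb hab
      rw [Finset.mem_toList, Finset.mem_filter] at ha hb
      rw [Finset.disjoint_iff_inter_eq_empty, ← Finset.not_nonempty_iff_eq_empty]
      intro hne
      refine hf.proper (.inl a) (Finset.mem_univ _) (.inl b) (Finset.mem_univ _)
        ((hG _ _).2 ⟨hab, ?_⟩) (ha.2.trans hb.2.symm)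
      rw [Finset.inter_comm]; exact hne
  · intro c
    rw [Multiset.card_map, hN]
    change (Finset.univ.filter (fun j => f (.inl j) = c)).card = _ ∨
      (Finset.univ.filter (fun j => f (.inl j) = c)).card = _
    have h1 := hfs c (Finset.mem_univ _)
    have h2 : (HS.cls Finset.univ f c).card =
        (Finset.univ.filter (fun j => f (.inl j) = c)).card +
        (Finset.univ.filter (fun j => f (.inr j) = c)).card := by
      rw [← Finset.card_disjSum]
      congr 1
      ext (j | j) <;> simp [HS.cls]
    have h3 : (Finset.univ.filter (fun j => f (.inr j) = c)).card ≤ 1 := by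
      rw [Finset.card_le_one]
      intro a ha b hb
      by_contra hab
      rw [Finset.mem_filter] at ha hb
      exact hf.proper (.inr a) (Finset.mem_univ _) (.inr b) (Finset.mem_univ _)
        ((hG _ _).2 hab) (ha.2.trans hb.2.symm)
    have h4 : (Finset.univ.filter (fun j => f (.inr j) = c)).card ≤ p := by
      simpa using Finset.card_filter_le (Finset.univ : Finset (Fin p)) (fun j => f (.inr j) = c)
    have hceil : (N + t) / (t + 1) = s := by
      rw [Nat.div_eq_iff (show 0 < t + 1 from Nat.succ_pos t)]
      have : s * (t + 1) = (t + 1) * s := mul_comm _ _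
      constructor <;> omega
    rw [hceil]
    rcases Nat.eq_zero_or_pos (Finset.univ.filter (fun j => f (.inr j) = c)).card with h0 | h0
    · right; omega
    · left
      symm
      have hs1 : (Finset.univ.filter (fun j => f (.inl j) = c)).card + 1 = s := by omega
      rw [Nat.div_eq_iff (show 0 < t + 1 from Nat.succ_pos t)]
      rw [← hs1, mul_add, mul_one] at hs
      rw [mul_comm]
      constructor <;> omega
end

section
/- For every ρ ∈ (0,1) there exist a universal constant c > 0 and, for each ℓ ∈ ℕ and finite alphabet Σ, a threshold n₀ such that for all n ≥ n₀ the following holds. Let M be a (ρ_0, ρ_1)-robust ℓ-local randomized algorithm computing a partial function f : Σ^n ⇀ {0,1} with error rate 1/3, where max(ρ_0, ρ_1) ≥ ρ. Set q = c·ℓ·log₂(ℓ+2) and γ = 48·|Σ|^q·ln|Σ|. Then there exists a sample-based algorithm N computing f with error rate 1/3 whose sample complexity is at most 2γ·n^{1−1/(2q²)}. -/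
open scoped Classical

/-- Decision trees over strings in `Fin n → A` with outputs in `O`: internal nodes are
labeled by coordinates, with one child per symbol, and leaves are labeled by outputs. -/
inductive DTree (A : Type) (n : ℕ) (O : Type) : Type
  | leaf : O → DTree A n O
  | node : Fin n → (A → DTree A n O) → DTree A n O

namespace DTree

/-- Evaluate a decision tree on input `x`, following the path determined by `x`. -/
def eval {A O : Type} {n : ℕ} : DTree A n O → (Fin n → A) → O
  | leaf b, _ => b
  | node i ts, x => (ts (x i)).eval x

/-- The set of coordinates queried by a decision tree on input `x`. -/
def queries {A O : Type} {n : ℕ} : DTree A n O → (Fin n → A) → Finset (Fin n)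
  | leaf _, _ => ∅
  | node i ts, x => insert i ((ts (x i)).queries x)

/-- The depth (maximum number of queries along a branch) of a decision tree. -/
def depth {A O : Type} [Fintype A] {n : ℕ} : DTree A n O → ℕ
  | leaf _ => 0
  | node _ ts => 1 + Finset.univ.sup fun a => (ts a).depth

end DTree

/-- A randomized local algorithm is modeled as a finite multiset `M` of decision trees,
one per outcome of the coin flips (uniformly distributed).  `prP M x P` is the
probability, over a uniformly random tree of `M`, that the output on input `x`
satisfies `P`. -/
noncomputable def prP {A O : Type} {n : ℕ} (M : Multiset (DTree A n O)) (x : Fin n → A)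
    (P : O → Prop) : ℝ :=
  ((Multiset.countP (fun t => P (t.eval x)) M : ℕ) : ℝ) / ((Multiset.card M : ℕ) : ℝ)

/-- Relative Hamming distance on `Fin n → A`. -/
noncomputable def relDist {A : Type} [DecidableEq A] {n : ℕ} (x y : Fin n → A) : ℝ :=
  ((Finset.univ.filter fun i => x i ≠ y i).card : ℝ) / (n : ℝ)

/-- A sample-based algorithm over `Σⁿ` with outputs in `O`: it selects a random set `Q`
of coordinates by including each coordinate independently with probability `p`, reads
the input restricted to `Q`, and outputs a randomized value in `O` whose distribution
depends only on `Q` and the restriction of the input to `Q`. -/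
structure SampleAlg (A : Type) (n : ℕ) (O : Type) [Fintype O] where
  /-- the sampling probability -/
  p : ℝ
  /-- `out Q x o` is the probability of outputting `o` given sample set `Q` on input `x` -/
  out : Finset (Fin n) → ((Fin n) → A) → O → ℝ
  p_nonneg : 0 ≤ p
  p_le_one : p ≤ 1
  out_nonneg : ∀ Q x o, 0 ≤ out Q x o
  out_sum : ∀ Q x, ∑ o, out Q x o = 1
  local_out : ∀ Q x y, (∀ i ∈ Q, x i = y i) → out Q x = out Q y

namespace SampleAlg

/-- The probability that the output of the sample-based algorithm `N` on input `x`
satisfies `P`, over the binomial choice of the sample set and the internal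
randomness. -/
noncomputable def pr {A O : Type} [Fintype O] {n : ℕ} (N : SampleAlg A n O)
    (x : (Fin n) → A) (P : O → Prop) : ℝ :=
  ∑ Q : Finset (Fin n),
    N.p ^ Q.card * (1 - N.p) ^ (n - Q.card) * ∑ o : O, if P o then N.out Q x o else 0

/-- `N` has sample complexity at most `s`: it enforces the cap `s`, i.e. whenever the
number of sampled coordinates exceeds `s` it ignores the input (outputs arbitrarily,
without reading the samples). -/
def complexityLE {A O : Type} [Fintype O] {n : ℕ} (N : SampleAlg A n O) (s : ℝ) : Prop :=
  ∀ Q : Finset (Fin n), s < (Q.card : ℝ) → ∀ x y, N.out Q x = N.out Q y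

end SampleAlg



/-- Expectation over a random subset of `s`, each element kept with probability `p`. -/
noncomputable def Ex {α : Type} (p : ℝ) (s : Finset α) (F : Finset α → ℝ) : ℝ :=
  ∑ Q ∈ s.powerset, p ^ Q.card * (1 - p) ^ (s.card - Q.card) * F Q

section Expectation
set_option linter.unusedSectionVars false
variable {α : Type} [DecidableEq α] {p : ℝ}

lemma Ex_insert (a : α) (s : Finset α) (ha : a ∉ s) (F : Finset α → ℝ) :
    Ex p (insert a s) F = Ex p s (fun Q => (1 - p) * F Q + p * F (insert a Q)) := by
  unfold Ex
  rw [Finset.sum_powerset_insert ha, ← Finset.sum_add_distrib]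
  refine Finset.sum_congr rfl fun Q hQ => ?_
  have hQs := Finset.mem_powerset.1 hQ
  have haQ : a ∉ Q := fun h => ha (hQs h)
  have hle := Finset.card_le_card hQs
  rw [Finset.card_insert_of_notMem ha, Finset.card_insert_of_notMem haQ,
    Nat.add_sub_add_right, Nat.succ_sub hle, pow_succ, pow_succ]
  ring

lemma Ex_mono (hp0 : 0 ≤ p) (hp1 : p ≤ 1) (s : Finset α) (F G : Finset α → ℝ)
    (h : ∀ Q, F Q ≤ G Q) : Ex p s F ≤ Ex p s G := by
  unfold Ex
  refine Finset.sum_le_sum fun Q _ => mul_le_mul_of_nonneg_left (h Q) ?_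
  have : 0 ≤ 1 - p := by linarith
  positivity

lemma Ex_mul_const (s : Finset α) (F : Finset α → ℝ) (c : ℝ) :
    Ex p s (fun Q => F Q * c) = Ex p s F * c := by
  unfold Ex
  rw [Finset.sum_mul]
  exact Finset.sum_congr rfl fun Q _ => by ring

lemma Ex_neg (s : Finset α) (F : Finset α → ℝ) :
    Ex p s (fun Q => - F Q) = - Ex p s F := by
  unfold Ex
  rw [← Finset.sum_neg_distrib]
  exact Finset.sum_congr rfl fun Q _ => by ring

lemma Ex_add (s : Finset α) (F G : Finset α → ℝ) :
    Ex p s (fun Q => F Q + G Q) = Ex p s F + Ex p s G := by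
  unfold Ex
  rw [← Finset.sum_add_distrib]
  exact Finset.sum_congr rfl fun Q _ => by ring

lemma Ex_sum {ι : Type} (T : Finset ι) (s : Finset α) (F : ι → Finset α → ℝ) :
    Ex p s (fun Q => ∑ i ∈ T, F i Q) = ∑ i ∈ T, Ex p s (F i) := by
  unfold Ex
  rw [Finset.sum_comm]
  exact Finset.sum_congr rfl fun Q _ => by rw [Finset.mul_sum]

lemma Ex_subset (s S : Finset α) (hS : S ⊆ s) :
    Ex p s (fun Q => if S ⊆ Q then 1 else 0) = p ^ S.card := by
  have h := Finset.prod_add (fun _ : α => p) (fun v => if v ∈ S then 0 else (1 - p)) s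
  have h1 : ∏ i ∈ s, (p + (if i ∈ S then 0 else (1 - p))) = p ^ S.card := by
    rw [← Finset.prod_subset hS (f := fun i => p + (if i ∈ S then 0 else (1 - p)))]
    · rw [Finset.prod_congr rfl (g := fun _ => p)]
      · simp
      · intro x hx; simp [hx]
    · intro x _ hx; simp [hx]
  rw [← h1, h]
  unfold Ex
  refine Finset.sum_congr rfl fun Q hQ => ?_
  have hQs := Finset.mem_powerset.1 hQ
  rw [Finset.prod_const, mul_assoc]
  congr 1
  beta_reduce
  split_ifs with hSQ
  · rw [Finset.prod_congr rfl (g := fun _ => 1 - p)]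
    · rw [Finset.prod_const, Finset.card_sdiff_of_subset hQs, mul_one]
    · intro x hx
      rw [if_neg (fun h => (Finset.mem_sdiff.1 hx).2 (hSQ h))]
  · obtain ⟨v, hv, hvQ⟩ := Finset.not_subset.1 hSQ
    rw [mul_zero, Finset.prod_eq_zero (Finset.mem_sdiff.2 ⟨hS hv, hvQ⟩)]
    simp [hv]

lemma Ex_const (s : Finset α) (c : ℝ) : Ex p s (fun _ => c) = c := by
  have := Ex_subset (p := p) s ∅ (by simp)
  have h2 := Ex_mul_const (p := p) s (fun _ => 1) c
  simp at this
  simpa [this] using h2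

lemma exp_le_add_exp_sq (x : ℝ) : Real.exp x ≤ x + Real.exp (x ^ 2) := by
  have h1 := Real.add_one_le_exp (x ^ 2)
  by_cases hx : |x| ≤ 1
  · have := Real.abs_exp_sub_one_sub_id_le hx
    have := (abs_le.1 this).2
    linarith
  · push Not at hx
    rcases lt_abs.1 hx with h | h
    · have : Real.exp x ≤ Real.exp (x ^ 2) := Real.exp_le_exp.2 (by nlinarith)
      linarith
    · have : Real.exp x ≤ 1 := Real.exp_le_one_iff.2 (by linarith)
      nlinarith

lemma two_point (hp0 : 0 ≤ p) (hp1 : p ≤ 1) (u v m l c : ℝ) (h : |v - u| ≤ c) :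
    (1 - p) * Real.exp (l * (u - m)) + p * Real.exp (l * (v - m)) ≤
      Real.exp (l * ((1 - p) * u + p * v - m)) * Real.exp (l ^ 2 * c ^ 2) := by
  set w := (1 - p) * u + p * v with hw
  have e1 : l * (u - m) = l * (w - m) + l * (u - w) := by ring
  have e2 : l * (v - m) = l * (w - m) + l * (v - w) := by ring
  have hsq : (v - u) ^ 2 ≤ c ^ 2 := sq_le_sq.2 (h.trans (le_abs_self c))
  have huw : u - w = - p * (v - u) := by rw [hw]; ring
  have hvw : v - w = (1 - p) * (v - u) := by rw [hw]; ring
  have a1 := exp_le_add_exp_sq (l * (u - w))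
  have a2 := exp_le_add_exp_sq (l * (v - w))
  have hp2 : p ^ 2 ≤ 1 := by nlinarith
  have hp3 : (1 - p) ^ 2 ≤ 1 := by nlinarith
  have b1 : Real.exp ((l * (u - w)) ^ 2) ≤ Real.exp (l ^ 2 * c ^ 2) := by
    refine Real.exp_le_exp.2 ?_
    rw [mul_pow, huw]
    refine mul_le_mul_of_nonneg_left ?_ (sq_nonneg l)
    nlinarith [sq_nonneg (v - u)]
  have b2 : Real.exp ((l * (v - w)) ^ 2) ≤ Real.exp (l ^ 2 * c ^ 2) := by
    refine Real.exp_le_exp.2 ?_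
    rw [mul_pow, hvw]
    refine mul_le_mul_of_nonneg_left ?_ (sq_nonneg l)
    nlinarith [sq_nonneg (v - u)]
  rw [e1, e2, Real.exp_add, Real.exp_add]
  have key : (1 - p) * Real.exp (l * (u - w)) + p * Real.exp (l * (v - w)) ≤
      Real.exp (l ^ 2 * c ^ 2) := by
    have c1 := mul_le_mul_of_nonneg_left (a1.trans (add_le_add_right b1 _)) (by linarith : 0 ≤ 1 - p)
    have c2 := mul_le_mul_of_nonneg_left (a2.trans (add_le_add_right b2 _)) hp0
    have z : (1 - p) * (l * (u - w)) + p * (l * (v - w)) = 0 := by rw [huw, hvw]; ring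
    nlinarith
  have := mul_le_mul_of_nonneg_left key (Real.exp_pos (l * (w - m))).le
  nlinarith

lemma mcdiarmid_mgf (hp0 : 0 ≤ p) (hp1 : p ≤ 1) (c : α → ℝ) (l : ℝ) (s : Finset α) :
    ∀ F : Finset α → ℝ, (∀ v Q, |F (insert v Q) - F Q| ≤ c v) →
    Ex p s (fun Q => Real.exp (l * (F Q - Ex p s F))) ≤
      Real.exp (l ^ 2 * ∑ v ∈ s, c v ^ 2) := by
  induction s using Finset.induction_on with
  | empty => intro F _; simp [Ex]
  | insert a s ha ih =>
    intro F hF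
    set F1 : Finset α → ℝ := fun Q => (1 - p) * F Q + p * F (insert a Q) with hF1
    have hm : Ex p (insert a s) F = Ex p s F1 := Ex_insert a s ha F
    rw [hm, Ex_insert a s ha]
    have h1 : Ex p s (fun Q => (1 - p) * Real.exp (l * (F Q - Ex p s F1)) +
        p * Real.exp (l * (F (insert a Q) - Ex p s F1))) ≤
        Ex p s (fun Q => Real.exp (l * (F1 Q - Ex p s F1)) * Real.exp (l ^ 2 * c a ^ 2)) :=
      Ex_mono hp0 hp1 _ _ _ fun Q => two_point hp0 hp1 _ _ _ _ _ (hF a Q)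
    refine h1.trans ?_
    rw [Ex_mul_const, Finset.sum_insert ha, mul_add, add_comm, Real.exp_add]
    refine mul_le_mul_of_nonneg_right (ih F1 ?_) (Real.exp_pos _).le
    intro v Q
    have e : F1 (insert v Q) - F1 Q = (1 - p) * (F (insert v Q) - F Q) +
        p * (F (insert v (insert a Q)) - F (insert a Q)) := by
      rw [hF1]; simp only [Finset.insert_comm a v Q]; ring
    rw [e]
    have i1 := hF v Q
    have i2 := hF v (insert a Q)
    have hq : 0 ≤ 1 - p := by linarith
    calc _ ≤ |(1 - p) * (F (insert v Q) - F Q)| +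
        |p * (F (insert v (insert a Q)) - F (insert a Q))| := abs_add_le _ _
      _ ≤ (1 - p) * c v + p * c v := by
        rw [abs_mul, abs_mul, abs_of_nonneg hq, abs_of_nonneg hp0]
        gcongr
      _ = c v := by ring

/-- Upper tail bound. -/
lemma mcdiarmid (hp0 : 0 ≤ p) (hp1 : p ≤ 1) (c : α → ℝ) (s : Finset α)
    (F : Finset α → ℝ) (hF : ∀ v Q, |F (insert v Q) - F Q| ≤ c v) (V t : ℝ)
    (hV : 0 < V) (hcV : ∑ v ∈ s, c v ^ 2 ≤ V) (ht : 0 ≤ t) :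
    Ex p s (fun Q => if Ex p s F + t ≤ F Q then 1 else 0) ≤ Real.exp (-(t ^ 2 / (4 * V))) := by
  set l := t / (2 * V) with hl
  have hl0 : 0 ≤ l := by positivity
  have h1 : Ex p s (fun Q => if Ex p s F + t ≤ F Q then 1 else 0) ≤
      Ex p s (fun Q => Real.exp (l * (F Q - Ex p s F)) * Real.exp (-(l * t))) := by
    refine Ex_mono hp0 hp1 _ _ _ fun Q => ?_
    rw [← Real.exp_add]
    split_ifs with h
    · refine Real.one_le_exp ?_
      nlinarith
    · exact (Real.exp_pos _).le
  refine h1.trans ?_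
  rw [Ex_mul_const]
  have h2 := mcdiarmid_mgf hp0 hp1 c l s F hF
  have h3 : Real.exp (l ^ 2 * ∑ v ∈ s, c v ^ 2) ≤ Real.exp (l ^ 2 * V) := by
    refine Real.exp_le_exp.2 ?_
    gcongr
  refine (mul_le_mul_of_nonneg_right (h2.trans h3) (Real.exp_pos _).le).trans ?_
  rw [← Real.exp_add]
  refine Real.exp_le_exp.2 (le_of_eq ?_)
  rw [hl]; field_simp; ring

/-- Lower tail bound. -/
lemma mcdiarmid_lower (hp0 : 0 ≤ p) (hp1 : p ≤ 1) (c : α → ℝ) (s : Finset α)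
    (F : Finset α → ℝ) (hF : ∀ v Q, |F (insert v Q) - F Q| ≤ c v) (V t : ℝ)
    (hV : 0 < V) (hcV : ∑ v ∈ s, c v ^ 2 ≤ V) (ht : 0 ≤ t) :
    Ex p s (fun Q => if F Q ≤ Ex p s F - t then 1 else 0) ≤ Real.exp (-(t ^ 2 / (4 * V))) := by
  have h := mcdiarmid hp0 hp1 c s (fun Q => - F Q) (fun v Q => by
    rw [← abs_neg]; convert hF v Q using 2; ring) V t hV hcV ht
  rw [Ex_neg] at h
  convert h using 3 with Q
  exact if_congr (by constructor <;> intro h <;> linarith) rfl rfl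

/-- Markov bound on the sample size. -/
lemma Ex_card (hp0 : 0 ≤ p) (hp1 : p ≤ 1) (s : Finset α) (b : ℝ) (hb : 0 < b)
    (h : 12 * (p * s.card) ≤ b) :
    Ex p s (fun Q => if b < ((Q ∩ s).card : ℝ) then 1 else 0) ≤ 1 / 12 := by
  have h1 : Ex p s (fun Q => if b < ((Q ∩ s).card : ℝ) then 1 else 0) ≤
      Ex p s (fun Q => (∑ v ∈ s, if {v} ⊆ Q then (1 : ℝ) else 0) * b⁻¹) := by
    refine Ex_mono hp0 hp1 _ _ _ fun Q => ?_
    have : (∑ v ∈ s, if {v} ⊆ Q then (1 : ℝ) else 0) = ((Q ∩ s).card : ℝ) := by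
      simp only [Finset.singleton_subset_iff]
      rw [Finset.sum_boole, Finset.filter_mem_eq_inter, Finset.inter_comm]
    rw [this, ← div_eq_mul_inv]
    split_ifs with hh
    · rw [le_div_iff₀ hb]; linarith
    · positivity
  refine h1.trans ?_
  rw [Ex_mul_const, Ex_sum, Finset.sum_congr rfl (g := fun _ => p)]
  · rw [Finset.sum_const, nsmul_eq_mul, ← div_eq_mul_inv, div_le_iff₀ hb]
    linarith
  · intro v hv
    rw [Ex_subset s {v} (by simpa using hv)]; simp
end Expectation


section Core
variable {A I : Type} {n : ℕ} [Fintype I]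

/-- Probability that coordinate `v` may be queried. -/
noncomputable def cdeg (U : I → Finset (Fin n)) (v : Fin n) : ℝ :=
  ((Finset.univ.filter fun i => v ∈ U i).card : ℝ) / (Fintype.card I : ℝ)

lemma cdeg_nonneg (U : I → Finset (Fin n)) (v : Fin n) : 0 ≤ cdeg U v := by
  unfold cdeg; positivity

lemma sum_cdeg (U : I → Finset (Fin n)) [Nonempty I] (L : ℝ)
    (hU : ∀ i, ((U i).card : ℝ) ≤ L) : ∑ v, cdeg U v ≤ L := by
  have hI : (0 : ℝ) < Fintype.card I := by exact_mod_cast Fintype.card_pos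
  unfold cdeg
  rw [← Finset.sum_div, div_le_iff₀ hI]
  have : ∑ v : Fin n, ((Finset.univ.filter fun i => v ∈ U i).card : ℝ) =
      ∑ i : I, ((U i).card : ℝ) := by
    have h1 : ∀ v : Fin n, ((Finset.univ.filter fun i => v ∈ U i).card : ℝ) =
        ∑ i : I, if v ∈ U i then (1 : ℝ) else 0 := fun v => by
      rw [Finset.sum_boole]
    simp_rw [h1]
    rw [Finset.sum_comm]
    refine Finset.sum_congr rfl fun i _ => ?_
    rw [Finset.sum_boole]; simp
  rw [this]
  calc _ ≤ ∑ i : I, L := Finset.sum_le_sum fun i _ => hU i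
    _ = L * Fintype.card I := by simp [mul_comm]

/-- Coordinates of large degree. -/
noncomputable def kern (U : I → Finset (Fin n)) (τ : ℝ) : Finset (Fin n) :=
  Finset.univ.filter fun v => τ ≤ cdeg U v

lemma card_kern (U : I → Finset (Fin n)) [Nonempty I] (L τ : ℝ)
    (hU : ∀ i, ((U i).card : ℝ) ≤ L) : τ * ((kern U τ).card : ℝ) ≤ L := by
  refine le_trans ?_ (sum_cdeg U L hU)
  calc τ * ((kern U τ).card : ℝ) = ∑ v ∈ kern U τ, τ := by simp [mul_comm]
    _ ≤ ∑ v ∈ kern U τ, cdeg U v :=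
      Finset.sum_le_sum fun v hv => (Finset.mem_filter.1 hv).2
    _ ≤ ∑ v, cdeg U v := Finset.sum_le_sum_of_subset_of_nonneg (Finset.subset_univ _)
      fun v _ _ => cdeg_nonneg U v

/-- The normalized weight of sampled petals. -/
noncomputable def Zf (e : I → (Fin n → A) → Prop) (S : I → (Fin n → A) → Finset (Fin n))
    (K : Finset (Fin n)) (good : Finset (Fin n) → Prop) (p : ℝ) (y : Fin n → A)
    (Q : Finset (Fin n)) : ℝ :=
  ∑ i : I, (if e i y ∧ good (S i y) then
    (if S i y \ K ⊆ Q then 1 else 0) * ((p ^ (S i y \ K).card)⁻¹ / (Fintype.card I : ℝ)) else 0)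

lemma Ex_Zf (e : I → (Fin n → A) → Prop) (S : I → (Fin n → A) → Finset (Fin n))
    (K : Finset (Fin n)) (good : Finset (Fin n) → Prop) (p : ℝ) (hp : 0 < p) (y : Fin n → A) :
    Ex p Finset.univ (Zf e S K good p y) =
      ((Finset.univ.filter fun i => e i y ∧ good (S i y)).card : ℝ) / (Fintype.card I : ℝ) := by
  have h : Ex p Finset.univ (Zf e S K good p y) = ∑ i : I, Ex p Finset.univ
      (fun Q => if e i y ∧ good (S i y) then (if S i y \ K ⊆ Q then 1 else 0) *
        ((p ^ (S i y \ K).card)⁻¹ / (Fintype.card I : ℝ)) else 0) := by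
    rw [← Ex_sum]; rfl
  rw [h, div_eq_mul_inv, ← Finset.sum_boole, Finset.sum_mul]
  refine Finset.sum_congr rfl fun i _ => ?_
  by_cases hi : e i y ∧ good (S i y)
  · simp only [hi, and_self, if_true]
    have hsub : Ex p Finset.univ (fun Q => if S i y \ K ⊆ Q then 1 else 0) =
        p ^ (S i y \ K).card := by
      convert Ex_subset (p := p) Finset.univ (S i y \ K) (Finset.subset_univ _)
    rw [Ex_mul_const, hsub]
    have : p ^ (S i y \ K).card ≠ 0 := by positivity
    field_simp
  · simp only [hi, if_false]
    rw [Ex_const]; simp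

lemma Zf_local (e : I → (Fin n → A) → Prop) (S : I → (Fin n → A) → Finset (Fin n))
    (hS : ∀ i x y, (∀ v ∈ S i x, x v = y v) → S i y = S i x ∧ (e i y ↔ e i x))
    (K : Finset (Fin n)) (good : Finset (Fin n) → Prop) (p : ℝ) (y y' : Fin n → A)
    (Q : Finset (Fin n)) (hy : ∀ v, v ∈ Q ∨ v ∈ K → y v = y' v) :
    Zf e S K good p y Q = Zf e S K good p y' Q := by
  have aux : ∀ z z' : Fin n → A, (∀ v, v ∈ Q ∨ v ∈ K → z v = z' v) → ∀ i, S i z \ K ⊆ Q →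
      S i z' = S i z ∧ (e i z' ↔ e i z) := by
    intro z z' h i hi
    refine hS i z z' fun v hv => h v ?_
    by_cases hK : v ∈ K
    · exact Or.inr hK
    · exact Or.inl (hi (Finset.mem_sdiff.2 ⟨hv, hK⟩))
  unfold Zf
  refine Finset.sum_congr rfl fun i _ => ?_
  by_cases h1 : S i y \ K ⊆ Q
  · obtain ⟨a, b⟩ := aux y y' hy i h1
    simp only [a, b]
  · by_cases h2 : S i y' \ K ⊆ Q
    · obtain ⟨a, b⟩ := aux y' y (fun v hv => (hy v hv).symm) i h2
      simp only [a, b]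
    · simp [h1, h2]

lemma Zf_diff (e : I → (Fin n → A) → Prop) (S : I → (Fin n → A) → Finset (Fin n))
    (U : I → Finset (Fin n)) (q : ℕ) (hSq : ∀ i x, (S i x).card ≤ q)
    (hSU : ∀ i x, S i x ⊆ U i) (K : Finset (Fin n)) (τ : ℝ)
    (p : ℝ) (hp : 0 < p) (hp1 : p ≤ 1) (y : Fin n → A) (v : Fin n) (Q : Finset (Fin n)) :
    |Zf e S K (fun T => ∀ v ∈ T, v ∉ K → cdeg U v < τ) p y (insert v Q) -
      Zf e S K (fun T => ∀ v ∈ T, v ∉ K → cdeg U v < τ) p y Q| ≤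
      if cdeg U v < τ then cdeg U v * (p ^ q)⁻¹ else 0 := by
  unfold Zf
  rw [← Finset.sum_sub_distrib]
  have hR : (if cdeg U v < τ then cdeg U v * (p ^ q)⁻¹ else 0) =
      ∑ i : I, if v ∈ U i ∧ cdeg U v < τ then (p ^ q)⁻¹ / (Fintype.card I : ℝ) else 0 := by
    by_cases h : cdeg U v < τ
    · simp only [h, and_true, if_true]
      rw [← Finset.sum_filter, Finset.sum_const, nsmul_eq_mul]
      unfold cdeg; ring
    · simp [h]
  rw [hR]
  refine (Finset.abs_sum_le_sum_abs _ _).trans (Finset.sum_le_sum fun i _ => ?_)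
  by_cases hg : e i y ∧ ∀ v ∈ S i y, v ∉ K → cdeg U v < τ
  swap
  · rw [if_neg hg, if_neg hg, sub_self, abs_zero]
    split_ifs <;> positivity
  rw [if_pos hg, if_pos hg]
  by_cases hv : v ∈ S i y \ K
  · have hv' := Finset.mem_sdiff.1 hv
    rw [if_pos (⟨hSU i y hv'.1, hg.2 v hv'.1 hv'.2⟩ : v ∈ U i ∧ cdeg U v < τ), ← sub_mul, abs_mul]
    have hb : (p ^ (S i y \ K).card)⁻¹ / (Fintype.card I : ℝ) ≤ (p ^ q)⁻¹ / (Fintype.card I : ℝ) := by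
      refine div_le_div_of_nonneg_right ?_ (by positivity)
      refine inv_anti₀ (by positivity) ?_
      exact pow_le_pow_of_le_one hp.le hp1
        ((Finset.card_le_card Finset.sdiff_subset).trans (hSq i y))
    have hn : 0 ≤ (p ^ (S i y \ K).card)⁻¹ / (Fintype.card I : ℝ) := by positivity
    rw [abs_of_nonneg hn]
    refine le_trans ?_ hb
    refine mul_le_of_le_one_left hn ?_
    split_ifs <;> simp
  · have : S i y \ K ⊆ insert v Q ↔ S i y \ K ⊆ Q := by
      rw [Finset.subset_insert_iff_of_notMem hv]
    simp only [this, sub_self, abs_zero]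
    split_ifs <;> positivity

lemma sum_c_sq (U : I → Finset (Fin n)) [Nonempty I] (L τ P : ℝ)
    (hU : ∀ i, ((U i).card : ℝ) ≤ L) (hτ : 0 ≤ τ) :
    ∑ v : Fin n, (if cdeg U v < τ then cdeg U v * P else 0) ^ 2 ≤ τ * L * P ^ 2 := by
  calc _ ≤ ∑ v : Fin n, τ * P ^ 2 * cdeg U v := by
        refine Finset.sum_le_sum fun v _ => ?_
        have h0 := cdeg_nonneg U v
        split_ifs with h
        · nlinarith [mul_le_mul_of_nonneg_right h.le (mul_nonneg h0 (sq_nonneg P))]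
        · rw [zero_pow two_ne_zero]; positivity
    _ = τ * P ^ 2 * ∑ v : Fin n, cdeg U v := by rw [Finset.mul_sum]
    _ ≤ τ * P ^ 2 * L := mul_le_mul_of_nonneg_left (sum_cdeg U L hU) (by positivity)
    _ = _ := by ring

lemma tail_exp (t P L τ R G k a : ℝ) (hP : 0 < P) (hL : 0 < L) (hτ : 0 < τ) (hR : 0 < R)
    (ha : 0 ≤ a) (h1 : τ * R * k ≤ L) (h2 : 8 * L ^ 2 * a ≤ R * (t ^ 2 * P ^ 2))
    (h3 : 8 * L * G * τ ≤ t ^ 2 * P ^ 2) :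
    k * a + G ≤ t ^ 2 / (4 * (τ * L * (P⁻¹) ^ 2)) := by
  have e : t ^ 2 / (4 * (τ * L * (P⁻¹) ^ 2)) = t ^ 2 * P ^ 2 / (4 * (τ * L)) := by
    field_simp
  rw [e, le_div_iff₀ (by positivity)]
  have h4 : 8 * (k * a * τ * L) ≤ t ^ 2 * P ^ 2 := by
    refine le_of_mul_le_mul_left ?_ hR
    have := mul_le_mul_of_nonneg_left h1 (by positivity : 0 ≤ 8 * L * a)
    nlinarith
  nlinarith

lemma pigeon (U : I → Finset (Fin n)) (q : ℕ) (T : Finset (Fin n)) (hT : T.card ≤ q)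
    (τ : ℕ → ℝ) (hτ : Monotone τ) :
    ∃ j ∈ Finset.range (q + 1), ∀ v ∈ T, v ∉ kern U (τ (j + 1)) → cdeg U v < τ j := by
  by_contra hcon
  push Not at hcon
  have : ∀ j, ∃ v, j ∈ Finset.range (q + 1) → v ∈ T ∧ cdeg U v < τ (j + 1) ∧ τ j ≤ cdeg U v := by
    intro j
    by_cases hj : j ∈ Finset.range (q + 1)
    · obtain ⟨v, h1, h2, h3⟩ := hcon j hj
      refine ⟨v, fun _ => ⟨h1, ?_, h3⟩⟩
      by_contra h
      exact h2 (Finset.mem_filter.2 ⟨Finset.mem_univ _, not_lt.1 h⟩)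
    · obtain ⟨v, -⟩ := hcon 0 (by simp)
      exact ⟨v, fun h => absurd h hj⟩
  choose g hg using this
  have hlt : ∀ j ∈ Finset.range (q + 1), ∀ k ∈ Finset.range (q + 1), j < k → g j ≠ g k := by
    intro j hj k hk hjk he
    have h1 := (hg j hj).2.1
    have h2 := (hg k hk).2.2
    rw [← he] at h2
    have := hτ (Nat.succ_le_of_lt hjk)
    simp only [Nat.succ_eq_add_one] at this
    linarith
  have := Finset.card_le_card_of_injOn (s := Finset.range (q + 1)) (t := T) g
    (fun j hj => (hg j (by exact_mod_cast hj)).1) (by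
      intro j hj k hk he
      have hj' : j ∈ Finset.range (q + 1) := by exact_mod_cast hj
      have hk' : k ∈ Finset.range (q + 1) := by exact_mod_cast hk
      rcases lt_trichotomy j k with h | h | h
      · exact absurd he (hlt j hj' k hk' h)
      · exact h
      · exact absurd he.symm (hlt k hk' j hj' h))
  rw [Finset.card_range] at this
  omega

end Core


lemma pr_eq_Ex {A : Type} {n : ℕ} (N : SampleAlg A n Bool) (x : Fin n → A) (b : Bool) :
    N.pr x (· = b) = Ex N.p Finset.univ (fun Q => N.out Q x b) := by
  unfold SampleAlg.pr Ex
  rw [Finset.powerset_univ, Finset.card_univ, Fintype.card_fin]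
  refine Finset.sum_congr rfl fun Q _ => ?_
  congr 1
  cases b <;> simp

/-- Overwrite `x` on `K`. -/
noncomputable def ovr {A : Type} {n : ℕ} (K : Finset (Fin n)) (x : Fin n → A) (κ : K → A) :
    Fin n → A := fun v => if h : v ∈ K then κ ⟨v, h⟩ else x v

lemma core {A I : Type} {n : ℕ} [Fintype I] [Nonempty I] [Fintype A]
    (b : Bool) (dom : Set (Fin n → A)) (f : (Fin n → A) → Bool)
    (e : I → (Fin n → A) → Prop) (S : I → (Fin n → A) → Finset (Fin n))
    (U : I → Finset (Fin n)) (q : ℕ)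
    (hS : ∀ i x y, (∀ v ∈ S i x, x v = y v) → S i y = S i x ∧ (e i y ↔ e i x))
    (hSq : ∀ i x, (S i x).card ≤ q)
    (hSU : ∀ i x, S i x ⊆ U i)
    (L ρ p s R G t : ℝ)
    (hU : ∀ i, ((U i).card : ℝ) ≤ L) (hL : 0 < L) (hρ : 0 < ρ) (hn : 0 < n)
    (hA : 1 ≤ Fintype.card A)
    (hp : 0 < p) (hp1 : p ≤ 1) (hs : 0 < s) (hps : 12 * (p * n) ≤ s) (hR : 1 ≤ R) (hG : 0 ≤ G)
    (ht : t = 1 / (4 * ((q : ℝ) + 1)))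
    (H1 : 8 * L ^ 2 * Real.log (Fintype.card A) ≤ R * (t ^ 2 * (p ^ q) ^ 2))
    (H2 : 8 * L * G * ((L / (ρ * n * R)) * R ^ q) ≤ t ^ 2 * (p ^ q) ^ 2)
    (H3 : ((q : ℝ) + 1) * Real.exp (-G) ≤ 1 / 12)
    (hrob : ∀ x ∈ dom, f x = b → ∀ w : Fin n → A,
      ((Finset.univ.filter fun i => w i ≠ x i).card : ℝ) ≤ ρ * n →
      ((Finset.univ.filter fun i => e i w).card : ℝ) ≤ t * Fintype.card I)
    (hcomp : ∀ x ∈ dom, f x = !b →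
      3 / 4 * (Fintype.card I : ℝ) ≤ ((Finset.univ.filter fun i => e i x).card : ℝ)) :
    ∃ N : SampleAlg A n Bool, (∀ x ∈ dom, 2 / 3 ≤ N.pr x (· = f x)) ∧ N.complexityLE s := by
  have hI : (0 : ℝ) < Fintype.card I := by exact_mod_cast Fintype.card_pos
  have hn' : (0 : ℝ) < n := by exact_mod_cast hn
  have hR0 : 0 < R := by linarith
  have ht0 : 0 < t := by rw [ht]; positivity
  set τ : ℕ → ℝ := fun j => (L / (ρ * n * R)) * R ^ j with hτ
  have hτ0 : ∀ j, 0 < τ j := fun j => by rw [hτ]; positivity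
  have hτm : Monotone τ := by
    intro a c hac
    rw [hτ]
    exact mul_le_mul_of_nonneg_left (pow_le_pow_right₀ hR hac) (by positivity)
  set K : ℕ → Finset (Fin n) := fun j => kern U (τ (j + 1)) with hK
  have hKc : ∀ j, τ (j + 1) * ((K j).card : ℝ) ≤ L := fun j => card_kern U L _ hU
  have hKn : ∀ j, ((K j).card : ℝ) ≤ ρ * n := by
    intro j
    have h1 : L / (ρ * n) ≤ τ (j + 1) := by
      have h2 := hτm (Nat.succ_le_succ (Nat.zero_le j))
      refine le_trans (le_of_eq ?_) h2
      rw [hτ]; simp only [Nat.succ_eq_add_one, zero_add, pow_one]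
      field_simp
    have h3 := (mul_le_mul_of_nonneg_right h1 (Nat.cast_nonneg (K j).card)).trans (hKc j)
    rw [div_mul_eq_mul_div, div_le_iff₀ (by positivity)] at h3
    exact le_of_mul_le_mul_left h3 hL
  set Z : ℕ → (Fin n → A) → Finset (Fin n) → ℝ := fun j y =>
    Zf e S (K j) (fun T => ∀ v ∈ T, v ∉ K j → cdeg U v < τ j) p y with hZ
  set V : ℕ → ℝ := fun j => τ j * L * ((p ^ q)⁻¹) ^ 2 with hV
  have hV0 : ∀ j, 0 < V j := fun j => by
    have := hτ0 j
    rw [hV]; positivity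
  have hdiff := fun (j : ℕ) (y : Fin n → A) =>
    Zf_diff e S U q hSq hSU (K j) (τ j) p hp hp1 y
  have hcV := fun j => sum_c_sq U L (τ j) (p ^ q)⁻¹ hU (hτ0 j).le
  have hlog : 0 ≤ Real.log (Fintype.card A) := Real.log_nonneg (by exact_mod_cast hA)
  have htail : ∀ j ∈ Finset.range (q + 1),
      ((K j).card : ℝ) * Real.log (Fintype.card A) + G ≤ t ^ 2 / (4 * V j) := by
    intro j hj
    refine tail_exp t (p ^ q) L (τ j) R G _ _ (by positivity) hL (hτ0 j) hR0 hlog ?_ H1 ?_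
    · refine le_trans (le_of_eq ?_) (hKc j)
      rw [hτ]; simp only [pow_succ]; ring
    · refine le_trans ?_ H2
      refine mul_le_mul_of_nonneg_left ?_ (by positivity)
      exact hτm (Nat.lt_succ_iff.1 (Finset.mem_range.1 hj))
  have htail' : ∀ j ∈ Finset.range (q + 1), Real.exp (-(t ^ 2 / (4 * V j))) ≤ 1 / 12 := by
    intro j hj
    have h1 : Real.exp (-(t ^ 2 / (4 * V j))) ≤ Real.exp (-G) := by
      refine Real.exp_le_exp.2 ?_
      have := htail j hj
      have h2 : 0 ≤ ((K j).card : ℝ) * Real.log (Fintype.card A) := by positivity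
      linarith
    have h2 : (0 : ℝ) ≤ q * Real.exp (-G) := by positivity
    linarith
  set event : Finset (Fin n) → (Fin n → A) → Prop := fun Q x =>
    ∃ j ∈ Finset.range (q + 1), ∃ y : Fin n → A, (∀ v ∈ Q, v ∉ K j → y v = x v) ∧
      2 * t ≤ Z j y Q with hev
  set ans : Finset (Fin n) → (Fin n → A) → Bool := fun Q x =>
    if (Q.card : ℝ) ≤ s ∧ event Q x then !b else b with hans
  let N : SampleAlg A n Bool :=
    { p := p
      out := fun Q x o => if o = ans Q x then 1 else 0
      p_nonneg := hp.le
      p_le_one := hp1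
      out_nonneg := fun Q x o => by split_ifs <;> norm_num
      out_sum := fun Q x => by simp
      local_out := fun Q x y hxy => by
        have h1 : event Q x ↔ event Q y := by
          simp only [hev]
          constructor
          · rintro ⟨j, hj, z, hz, h⟩
            exact ⟨j, hj, z, fun v hv hK => (hz v hv hK).trans (hxy v hv), h⟩
          · rintro ⟨j, hj, z, hz, h⟩
            exact ⟨j, hj, z, fun v hv hK => (hz v hv hK).trans (hxy v hv).symm, h⟩
        have h2 : ans Q x = ans Q y := by simp only [hans, h1]
        funext o
        rw [h2] }
  refine ⟨N, ?_, ?_⟩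
  swap
  · intro Q hQ x y
    have h1 : ∀ x, ans Q x = b := fun x => by
      simp only [hans]
      rw [if_neg]
      rintro ⟨h, -⟩
      linarith
    funext o
    change (if o = ans Q x then (1 : ℝ) else 0) = if o = ans Q y then (1 : ℝ) else 0
    rw [h1, h1]
  intro x hx
  rw [pr_eq_Ex]
  change 2 / 3 ≤ Ex p Finset.univ (fun Q => if f x = ans Q x then (1 : ℝ) else 0)
  -- reduce to a bound on the failure probability
  have hred : ∀ bad : Finset (Fin n) → ℝ, (∀ Q, 0 ≤ bad Q) →
      (∀ Q, f x ≠ ans Q x → 1 ≤ bad Q) → Ex p Finset.univ bad ≤ 1 / 3 →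
      2 / 3 ≤ Ex p Finset.univ (fun Q => if f x = ans Q x then (1 : ℝ) else 0) := by
    intro bad hb0 hb1 hb
    have h1 : Ex p Finset.univ (fun _ : Finset (Fin n) => (1 : ℝ)) ≤ Ex p Finset.univ
        (fun Q => (if f x = ans Q x then (1 : ℝ) else 0) + bad Q) := by
      refine Ex_mono hp.le hp1 _ _ _ fun Q => ?_
      split_ifs with h
      · linarith [hb0 Q]
      · linarith [hb1 Q h]
    rw [Ex_add, Ex_const] at h1
    linarith
  by_cases hfx : f x = b
  · -- robust side
    refine hred (fun Q => ∑ j ∈ Finset.range (q + 1), ∑ κ : (K j → A),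
      if 2 * t ≤ Z j (ovr (K j) x κ) Q then (1 : ℝ) else 0) ?_ ?_ ?_
    · intro Q
      exact Finset.sum_nonneg fun j _ => Finset.sum_nonneg fun κ _ => by split_ifs <;> norm_num
    · intro Q hQ
      have hE : event Q x := by
        by_contra h
        apply hQ
        simp only [hans]
        rw [if_neg (fun h' => h h'.2), hfx]
      obtain ⟨j, hj, y, hy, hZy⟩ := hE
      have hloc : Z j (ovr (K j) x (fun v => y v)) Q = Z j y Q := by
        refine Zf_local e S hS _ _ p _ _ Q ?_
        intro v hv
        unfold ovr
        split_ifs with hvK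
        · rfl
        · exact (hy v (hv.resolve_right hvK) hvK).symm
      have h1 : (1 : ℝ) ≤ ∑ κ : (K j → A),
          if 2 * t ≤ Z j (ovr (K j) x κ) Q then (1 : ℝ) else 0 := by
        refine le_trans ?_ (Finset.single_le_sum (f := fun κ : (K j → A) =>
          if 2 * t ≤ Z j (ovr (K j) x κ) Q then (1 : ℝ) else 0)
          (fun κ _ => by split_ifs <;> norm_num) (Finset.mem_univ (fun v : K j => y v)))
        simp only [hloc, hZy, if_true, le_refl]
      refine h1.trans ?_
      exact Finset.single_le_sum (f := fun j => ∑ κ : (K j → A),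
          if 2 * t ≤ Z j (ovr (K j) x κ) Q then (1 : ℝ) else 0)
          (fun j _ => Finset.sum_nonneg fun κ _ => by split_ifs <;> norm_num) hj
    · rw [Ex_sum]
      have hj : ∀ j ∈ Finset.range (q + 1), Ex p Finset.univ (fun Q => ∑ κ : (K j → A),
          if 2 * t ≤ Z j (ovr (K j) x κ) Q then (1 : ℝ) else 0) ≤ Real.exp (-G) := by
        intro j hj
        rw [Ex_sum]
        have hκ : ∀ κ : (K j → A), Ex p Finset.univ (fun Q =>
            if 2 * t ≤ Z j (ovr (K j) x κ) Q then (1 : ℝ) else 0) ≤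
            Real.exp (-(t ^ 2 / (4 * V j))) := by
          intro κ
          refine le_trans ?_ (mcdiarmid hp.le hp1 _ Finset.univ (Z j (ovr (K j) x κ))
            (hdiff j (ovr (K j) x κ)) (V j) t (hV0 j) (hcV j) ht0.le)
          refine Ex_mono hp.le hp1 _ _ _ fun Q => ?_
          have hmean : Ex p Finset.univ (Z j (ovr (K j) x κ)) ≤ t := by
            rw [hZ]
            simp only
            rw [Ex_Zf _ _ _ _ _ hp, div_le_iff₀ hI]
            refine le_trans ?_ (hrob x hx hfx (ovr (K j) x κ) ?_)
            · refine Nat.cast_le.2 (Finset.card_le_card fun i hi => ?_)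
              simp only [Finset.mem_filter] at hi ⊢
              exact ⟨hi.1, hi.2.1⟩
            · refine le_trans ?_ (hKn j)
              exact_mod_cast Finset.card_le_card (fun v hv => by
                have hv' := (Finset.mem_filter.1 hv).2
                by_contra hvK
                apply hv'
                unfold ovr
                rw [dif_neg hvK])
          split_ifs with h1 h2
          · exact le_rfl
          · exact absurd (by linarith) h2
          · norm_num
          · exact le_rfl
        refine (Finset.sum_le_sum fun κ _ => hκ κ).trans ?_
        rw [Finset.sum_const, Finset.card_univ, Fintype.card_fun, Fintype.card_coe, nsmul_eq_mul]
        push_cast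
        have hA0 : (0 : ℝ) < Fintype.card A := by exact_mod_cast hA
        rw [← Real.exp_log hA0, ← Real.exp_nat_mul, ← Real.exp_add]
        refine Real.exp_le_exp.2 ?_
        linarith [htail j hj]
      refine (Finset.sum_le_sum hj).trans ?_
      rw [Finset.sum_const, Finset.card_range, nsmul_eq_mul]
      push_cast
      linarith
  · -- the other side
    have hfx' : f x = !b := Bool.eq_not.2 hfx
    have hex : ∃ j ∈ Finset.range (q + 1), 3 * t ≤ Ex p Finset.univ (Z j x) := by
      by_contra hcon
      push Not at hcon
      have h1 : ((Finset.univ.filter fun i => e i x).card : ℝ) ≤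
          ∑ j ∈ Finset.range (q + 1), ((Finset.univ.filter fun i => e i x ∧
            ∀ v ∈ S i x, v ∉ K j → cdeg U v < τ j).card : ℝ) := by
        have h0 := Finset.card_biUnion_le (s := Finset.range (q + 1))
          (t := fun j => Finset.univ.filter fun i => e i x ∧
            ∀ v ∈ S i x, v ∉ K j → cdeg U v < τ j)
        have h0' := (Nat.cast_le (α := ℝ)).2 h0
        rw [Nat.cast_sum] at h0'
        refine le_trans ?_ h0'
        refine Nat.cast_le.2 (Finset.card_le_card fun i hi => ?_)
        obtain ⟨j, hj, h⟩ := pigeon U q (S i x) (hSq i x) τ hτm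
        rw [Finset.mem_biUnion]
        exact ⟨j, hj, Finset.mem_filter.2 ⟨Finset.mem_univ _, (Finset.mem_filter.1 hi).2, h⟩⟩
      have h2 : ∑ j ∈ Finset.range (q + 1), ((Finset.univ.filter fun i => e i x ∧
            ∀ v ∈ S i x, v ∉ K j → cdeg U v < τ j).card : ℝ) <
          ∑ j ∈ Finset.range (q + 1), 3 * t * Fintype.card I := by
        refine Finset.sum_lt_sum_of_nonempty (by simp) fun j hj => ?_
        have := hcon j hj
        rw [hZ] at this
        simp only at this
        rw [Ex_Zf _ _ _ _ _ hp, div_lt_iff₀ hI] at this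
        convert this
      rw [Finset.sum_const, Finset.card_range, nsmul_eq_mul] at h2
      have h3 := hcomp x hx hfx'
      have h4 : ((q + 1 : ℕ) : ℝ) * (3 * t * (Fintype.card I : ℝ)) = 3 / 4 * Fintype.card I := by
        rw [ht]; push_cast; field_simp
      linarith
    obtain ⟨j, hj, hmean⟩ := hex
    refine hred (fun Q => (if s < ((Q ∩ Finset.univ).card : ℝ) then (1 : ℝ) else 0) +
      if Z j x Q ≤ Ex p Finset.univ (Z j x) - t then (1 : ℝ) else 0) ?_ ?_ ?_
    · intro Q
      refine add_nonneg ?_ ?_ <;> split_ifs <;> norm_num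
    · intro Q hQ
      have hE : s < (Q.card : ℝ) ∨ Z j x Q < 2 * t := by
        by_contra h
        push Not at h
        apply hQ
        simp only [hans]
        rw [if_pos ⟨h.1, ⟨j, hj, x, fun _ _ _ => rfl, h.2⟩⟩, hfx']
      rw [Finset.inter_univ]
      rcases hE with h | h
      · rw [if_pos h]
        split_ifs <;> norm_num
      · have h' : Z j x Q ≤ Ex p Finset.univ (Z j x) - t := by linarith
        rw [if_pos h']
        split_ifs <;> norm_num
    · rw [Ex_add]
      have h1 := Ex_card (α := Fin n) hp.le hp1 Finset.univ s hs
        (by rw [Finset.card_univ, Fintype.card_fin]; exact hps)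
      have h2 := (mcdiarmid_lower hp.le hp1 _ Finset.univ (Z j x)
            (hdiff j x) (V j) t (hV0 j) (hcV j) ht0.le).trans (htail' j hj)
      have h1' : Ex p Finset.univ (fun Q : Finset (Fin n) =>
          if s < ((Q ∩ Finset.univ).card : ℝ) then (1 : ℝ) else 0) ≤ 1 / 12 := by
        convert h1
      linarith


namespace DTree

/-- All coordinates appearing in a decision tree. -/
noncomputable def support {A O : Type} [Fintype A] {n : ℕ} : DTree A n O → Finset (Fin n)
  | leaf _ => ∅
  | node i ts => insert i (Finset.univ.biUnion fun a => (ts a).support)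

variable {A O : Type} {n : ℕ}

lemma queries_subset_support [Fintype A] (T : DTree A n O) (x : Fin n → A) :
    T.queries x ⊆ T.support := by
  induction T with
  | leaf o => simp [queries]
  | node i ts ih =>
    simp only [queries, support]
    refine Finset.insert_subset_insert _ ((ih (x i)).trans ?_)
    intro v hv
    exact Finset.mem_biUnion.2 ⟨x i, Finset.mem_univ _, hv⟩

lemma card_queries_le [Fintype A] (T : DTree A n O) (x : Fin n → A) :
    (T.queries x).card ≤ T.depth := by
  induction T with
  | leaf o => simp [queries]
  | node i ts ih =>
    simp only [queries, depth]
    refine (Finset.card_insert_le _ _).trans ?_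
    have := Finset.le_sup (f := fun a => (ts a).depth) (Finset.mem_univ (x i))
    have h2 := ih (x i)
    omega

lemma queries_local (T : DTree A n O) (x y : Fin n → A) (h : ∀ v ∈ T.queries x, x v = y v) :
    T.queries y = T.queries x ∧ T.eval y = T.eval x := by
  induction T with
  | leaf o => simp [queries, eval]
  | node i ts ih =>
    simp only [queries, eval] at h ⊢
    have hi : x i = y i := h i (Finset.mem_insert_self _ _)
    rw [← hi]
    obtain ⟨h1, h2⟩ := ih (x i) (fun v hv => h v (Finset.mem_insert_of_mem hv))
    rw [h1, h2]
    exact ⟨rfl, rfl⟩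

lemma card_support_le [Fintype A] (T : DTree A n O) :
    T.support.card ≤ (Fintype.card A + 1) ^ T.depth := by
  induction T with
  | leaf o => simp [support]
  | node i ts ih =>
    simp only [support, depth]
    refine (Finset.card_insert_le _ _).trans ?_
    have h1 : (Finset.univ.biUnion fun a => (ts a).support).card ≤
        Fintype.card A * (Fintype.card A + 1) ^ (Finset.univ.sup fun a => (ts a).depth) := by
      refine Finset.card_biUnion_le.trans ?_
      refine (Finset.sum_le_card_nsmul _ _ ((Fintype.card A + 1) ^ (Finset.univ.sup fun a => (ts a).depth)) ?_).trans (le_of_eq ?_)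
      · intro a ha
        refine (ih a).trans (Nat.pow_le_pow_right (by omega) ?_)
        exact Finset.le_sup (f := fun a => (ts a).depth) ha
      · simp
    have h2 : 1 ≤ (Fintype.card A + 1) ^ (Finset.univ.sup fun a => (ts a).depth) :=
      Nat.one_le_pow _ _ (by omega)
    rw [pow_add, pow_one, add_mul]
    omega

end DTree

lemma amp {J : Type} [Fintype J] (m : ℕ) (g : J → Prop)
    (hg : 3 * ((Finset.univ.filter fun i => g i).card : ℝ) ≤ Fintype.card J) :
    ((Finset.univ.filter fun T : Fin (2 * m) → J =>
      m ≤ (Finset.univ.filter fun a => g (T a)).card).card : ℝ) ≤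
      (8 / 9 : ℝ) ^ m * (Fintype.card (Fin (2 * m) → J) : ℝ) := by
  have h1 : (∑ i : J, if g i then (2 : ℝ) else 1) ≤ 4 / 3 * Fintype.card J := by
    have : (∑ i : J, if g i then (2 : ℝ) else 1) = ∑ i : J, ((if g i then (1 : ℝ) else 0) + 1) :=
      Finset.sum_congr rfl fun i _ => by split_ifs <;> norm_num
    rw [this, Finset.sum_add_distrib, Finset.sum_boole]
    simp only [Finset.sum_const, Finset.card_univ, nsmul_eq_mul, mul_one]
    linarith
  have h0 : 0 ≤ (∑ i : J, if g i then (2 : ℝ) else 1) :=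
    Finset.sum_nonneg fun i _ => by split_ifs <;> norm_num
  have h2 : (∑ i : J, if g i then (2 : ℝ) else 1) ^ (2 * m) =
      ∑ T : Fin (2 * m) → J, (2 : ℝ) ^ (Finset.univ.filter fun a => g (T a)).card := by
    have := Fintype.sum_pow (fun i : J => if g i then (2 : ℝ) else 1) (2 * m)
    rw [this]
    refine Finset.sum_congr rfl fun T _ => ?_
    rw [Finset.prod_ite]
    simp
  have h3 : (2 : ℝ) ^ m * ((Finset.univ.filter fun T : Fin (2 * m) → J =>
      m ≤ (Finset.univ.filter fun a => g (T a)).card).card : ℝ) ≤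
      ∑ T : Fin (2 * m) → J, (2 : ℝ) ^ (Finset.univ.filter fun a => g (T a)).card := by
    rw [← Finset.sum_boole, Finset.mul_sum]
    refine Finset.sum_le_sum fun T _ => ?_
    split_ifs with h
    · rw [mul_one]; exact pow_le_pow_right₀ (by norm_num) h
    · rw [mul_zero]; positivity
  rw [← h2] at h3
  have h4 := h3.trans (pow_le_pow_left₀ h0 h1 _)
  rw [Fintype.card_fun, Fintype.card_fin]
  push_cast
  have h5 : (4 / 3 * (Fintype.card J : ℝ)) ^ (2 * m) =
      2 ^ m * ((8 / 9 : ℝ) ^ m * (Fintype.card J : ℝ) ^ (2 * m)) := by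
    rw [mul_pow, pow_mul, ← mul_assoc, ← mul_pow]; norm_num
  rw [h5] at h4
  exact le_of_mul_le_mul_left h4 (by positivity)

lemma amp_num (a ℓ : ℕ) (ha : ℓ + 2 ≤ 2 ^ a) (ha1 : 1 ≤ a) :
    (8 / 9 : ℝ) ^ (72 * a) ≤ 1 / (4 * (((2 * (72 * a) * ℓ : ℕ) : ℝ) + 1)) := by
  have h1 : (8 / 9 : ℝ) ^ (72 * a) ≤ (1 / 2) ^ (12 * a) := by
    rw [pow_mul, pow_mul]
    exact pow_le_pow_left₀ (by positivity) (by norm_num) _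
  refine h1.trans ?_
  rw [one_div_pow]
  refine one_div_le_one_div_of_le (by positivity) ?_
  have h2 : 2047 * a ≤ 2048 ^ a := by
    have := one_add_mul_le_pow (a := (2047 : ℤ)) (by norm_num) a
    norm_num at this
    zify
    linarith
  have h3 : 4 * (2 * (72 * a) * ℓ + 1) ≤ 2 ^ (12 * a) := by
    have e : 2 ^ (12 * a) = 2 ^ a * 2048 ^ a := by
      rw [pow_mul, ← mul_pow]; norm_num
    rw [e]
    refine le_trans ?_ (Nat.mul_le_mul ha h2)
    nlinarith
  exact_mod_cast h3

lemma countP_eq {α : Type} (M : Multiset α) (P : α → Prop) :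
    Multiset.countP P M = (Finset.univ.filter fun i : M => P i.1).card := by
  conv_lhs => rw [← Multiset.map_univ_coe M]
  rw [Multiset.countP_map]
  rfl

lemma numeric (q : ℕ) (r L ρ G t a : ℝ) (hr : 0 < r) (hqr : 2 * (q : ℝ) ≤ r) (hL : 0 < L)
    (hρ : 0 < ρ) (hG : 0 ≤ G) (ht : 0 < t) (ha : 0 ≤ a) :
    ∃ n₀ : ℕ, ∀ n : ℕ, n₀ ≤ n → 0 < n ∧ ∃ p R : ℝ, 0 < p ∧ p ≤ 1 ∧
      p * n = (n : ℝ) ^ (1 - 1 / (2 * r ^ 2)) ∧ 1 ≤ R ∧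
      8 * L ^ 2 * a ≤ R * (t ^ 2 * (p ^ q) ^ 2) ∧
      8 * L * G * ((L / (ρ * n * R)) * R ^ q) ≤ t ^ 2 * (p ^ q) ^ 2 := by
  set C := max 1 (8 * L ^ 2 * a / t ^ 2) with hC
  have hC1 : 1 ≤ C := le_max_left _ _
  have hC2 : 8 * L ^ 2 * a ≤ C * t ^ 2 := by
    rw [← div_le_iff₀ (by positivity)]; exact le_max_right _ _
  set D := 8 * L * G * L * C ^ q / (ρ * t ^ 2 * C) with hD
  have hD0 : 0 ≤ D := by positivity
  refine ⟨⌈D ^ 2⌉₊ + 1, fun n hn => ?_⟩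
  have hn0 : 0 < n := by omega
  have hn1 : (1 : ℝ) ≤ n := by exact_mod_cast hn0
  have hnp : (0 : ℝ) < n := by linarith
  have hDn : D ^ 2 ≤ n := (Nat.le_ceil _).trans (by exact_mod_cast (by omega : ⌈D ^ 2⌉₊ ≤ n))
  have hDs : D ≤ (n : ℝ) ^ (1 / 2 : ℝ) := by
    rw [← Real.sqrt_eq_rpow]; exact Real.le_sqrt_of_sq_le hDn
  refine ⟨hn0, (n : ℝ) ^ (-(1 / (2 * r ^ 2))), C * (n : ℝ) ^ ((q : ℝ) / r ^ 2), ?_, ?_, ?_, ?_, ?_, ?_⟩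
  · positivity
  · exact Real.rpow_le_one_of_one_le_of_nonpos hn1 (by
      have : 0 ≤ 1 / (2 * r ^ 2) := by positivity
      linarith)
  · conv_lhs => rw [mul_comm]
    rw [sub_eq_add_neg, Real.rpow_add hnp, Real.rpow_one]
  · exact one_le_mul_of_one_le_of_one_le hC1 (Real.one_le_rpow hn1 (by positivity))
  · have hP : (((n : ℝ) ^ (-(1 / (2 * r ^ 2)))) ^ q) ^ 2 = ((n : ℝ) ^ ((q : ℝ) / r ^ 2))⁻¹ := by
      rw [← Real.rpow_natCast, ← Real.rpow_natCast, ← Real.rpow_mul hnp.le, ← Real.rpow_mul hnp.le,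
        ← Real.rpow_neg hnp.le]
      congr 1
      push_cast
      field_simp
    rw [hP]
    have : (n : ℝ) ^ ((q : ℝ) / r ^ 2) ≠ 0 := by positivity
    refine hC2.trans (le_of_eq ?_)
    field_simp
  · have hP : (((n : ℝ) ^ (-(1 / (2 * r ^ 2)))) ^ q) ^ 2 = ((n : ℝ) ^ ((q : ℝ) / r ^ 2))⁻¹ := by
      rw [← Real.rpow_natCast, ← Real.rpow_natCast, ← Real.rpow_mul hnp.le, ← Real.rpow_mul hnp.le,
        ← Real.rpow_neg hnp.le]
      congr 1
      push_cast
      field_simp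
    rw [hP]
    set W := (n : ℝ) ^ ((q : ℝ) / r ^ 2) with hW
    have hW0 : 0 < W := by positivity
    have hWq : W ^ q ≤ (n : ℝ) ^ (1 / 2 : ℝ) := by
      rw [hW, ← Real.rpow_natCast, ← Real.rpow_mul hnp.le]
      refine Real.rpow_le_rpow_of_exponent_le hn1 ?_
      rw [div_mul_eq_mul_div, div_le_iff₀ (by positivity)]
      have hq0 : (0 : ℝ) ≤ q := by positivity
      nlinarith
    have hDW : D * W ^ q ≤ n := by
      calc D * W ^ q ≤ (n : ℝ) ^ (1 / 2 : ℝ) * (n : ℝ) ^ (1 / 2 : ℝ) := by gcongr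
        _ = n := by rw [← Real.rpow_add hnp]; norm_num
    rw [hD, div_mul_eq_mul_div, div_le_iff₀ (by positivity)] at hDW
    have e1 : 8 * L * G * ((L / (ρ * n * (C * W))) * (C * W) ^ q) =
        (8 * L * G * L * C ^ q * W ^ q) / (ρ * n * (C * W)) := by
      rw [mul_pow]; field_simp
    rw [e1, div_le_iff₀ (by positivity)]
    refine hDW.trans (le_of_eq ?_)
    field_simp

lemma trivial_alg {A : Type} {n : ℕ} (dom : Set (Fin n → A)) (f : (Fin n → A) → Bool) (s : ℝ)
    (h : (n : ℝ) ≤ s ∨ Subsingleton (Fin n → A)) :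
    ∃ N : SampleAlg A n Bool, (∀ x ∈ dom, 2 / 3 ≤ N.pr x (· = f x)) ∧ N.complexityLE s := by
  let N : SampleAlg A n Bool :=
    { p := 1
      out := fun Q x o => if o = (if Q = Finset.univ then f x else true) then 1 else 0
      p_nonneg := by norm_num
      p_le_one := le_rfl
      out_nonneg := fun Q x o => by split_ifs <;> norm_num
      out_sum := fun Q x => by simp
      local_out := fun Q x y hxy => by
        funext o
        by_cases hQ : Q = Finset.univ
        · have : x = y := funext fun i => hxy i (by rw [hQ]; exact Finset.mem_univ i)
          rw [this]
        · simp [hQ] }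
  refine ⟨N, fun x _ => ?_, ?_⟩
  · rw [pr_eq_Ex]
    have h1 : Ex (1 : ℝ) Finset.univ (fun Q : Finset (Fin n) => if Finset.univ ⊆ Q then (1 : ℝ) else 0)
        = 1 := by
      have := Ex_subset (p := 1) (Finset.univ : Finset (Fin n)) Finset.univ (Finset.subset_univ _)
      rw [this, one_pow]
    have h2 : (1 : ℝ) ≤ Ex N.p Finset.univ (fun Q => N.out Q x (f x)) := by
      rw [← h1]
      refine Ex_mono (by norm_num) le_rfl _ _ _ fun Q => ?_
      change _ ≤ if f x = (if Q = Finset.univ then f x else true) then (1 : ℝ) else 0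
      by_cases hQ : Q = Finset.univ
      · simp [hQ]
      · have : ¬ Finset.univ ⊆ Q := fun h => hQ (Finset.univ_subset_iff.1 h)
        rw [if_neg this]
        split_ifs <;> norm_num
    linarith
  · intro Q hQ x y
    rcases h with h | h
    · have h1 : (Q.card : ℝ) ≤ n := by
        have := Finset.card_le_univ Q
        rw [Fintype.card_fin] at this
        exact_mod_cast this
      linarith
    · rw [Subsingleton.elim x y]


/-- The tree `t` does not output `b` on `w`. -/
def isWrong {A : Type} {n : ℕ} (b : Bool) (w : Fin n → A) (t : DTree A n Bool) : Prop :=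
  t.eval w ≠ b

/-- More than `m` of the trees do not output `b`. -/
def majW {A : Type} {n : ℕ} {M : Multiset (DTree A n Bool)} (b : Bool) (m : ℕ)
    (T : Fin (2 * m) → M) (w : Fin n → A) : Prop :=
  m < (Finset.univ.filter fun i => isWrong b w (T i).1).card

lemma prP_bound {A : Type} {n : ℕ} (M : Multiset (DTree A n Bool)) (hM : M ≠ 0) (w : Fin n → A)
    (b : Bool) (h : 1 - 1 / 3 ≤ prP M w (· = b)) :
    3 * ((Finset.univ.filter fun i : M => isWrong b w i.1).card : ℝ) ≤ Fintype.card M := by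
  have hc : (0 : ℝ) < Multiset.card M := by
    exact_mod_cast Multiset.card_pos.2 hM
  have hcp : Multiset.countP (fun t : DTree A n Bool => t.eval w = b) M =
      (Finset.univ.filter fun i : M => ¬ isWrong b w i.1).card := by
    have h0 := countP_eq M (fun t => t.eval w = b)
    have h1 : ∀ i : M, ¬ isWrong b w i.1 ↔ i.1.eval w = b := fun i => by simp [isWrong]
    rw [Finset.filter_congr (fun i _ => h1 i)]
    convert h0
  have h' : (1 - 1 / 3 : ℝ) ≤
      ((Finset.univ.filter fun i : M => ¬ isWrong b w i.1).card : ℝ) / Multiset.card M := by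
    rw [← hcp]
    refine h.trans (le_of_eq ?_)
    unfold prP
    congr!
  rw [le_div_iff₀ hc] at h'
  have h1 := Finset.card_filter_add_card_filter_not (s := (Finset.univ : Finset M))
    (fun i : M => isWrong b w i.1)
  rw [Finset.card_univ] at h1
  have h2 : ((Finset.univ.filter fun i : M => isWrong b w i.1).card : ℝ) +
    ((Finset.univ.filter fun i : M => ¬ isWrong b w i.1).card : ℝ) = Fintype.card M := by
    exact_mod_cast h1
  have h3 : (Fintype.card M : ℝ) = Multiset.card M := by
    rw [Multiset.card_coe]
  linarith

lemma amp_rob {A : Type} {n : ℕ} (M : Multiset (DTree A n Bool)) (hM : M ≠ 0) (w : Fin n → A)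
    (b : Bool) (m : ℕ) (h : 1 - 1 / 3 ≤ prP M w (· = b)) :
    ((Finset.univ.filter fun T : Fin (2 * m) → M => majW b m T w).card : ℝ) ≤
      (8 / 9 : ℝ) ^ m * Fintype.card (Fin (2 * m) → M) := by
  refine le_trans ?_ (amp m (fun i : M => isWrong b w i.1) (prP_bound M hM w b h))
  refine Nat.cast_le.2 (Finset.card_le_card fun T hT => ?_)
  rw [Finset.mem_filter] at hT ⊢
  exact ⟨hT.1, le_of_lt hT.2⟩

lemma amp_comp {A : Type} {n : ℕ} (M : Multiset (DTree A n Bool)) (hM : M ≠ 0) (x : Fin n → A)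
    (b : Bool) (m : ℕ) (h : 1 - 1 / 3 ≤ prP M x (· = !b)) :
    (1 - (8 / 9 : ℝ) ^ m) * Fintype.card (Fin (2 * m) → M) ≤
    ((Finset.univ.filter fun T : Fin (2 * m) → M => majW b m T x).card : ℝ) := by
  have h2 := amp m (fun i : M => isWrong (!b) x i.1) (prP_bound M hM x (!b) h)
  have h4 := Finset.card_filter_add_card_filter_not
    (s := (Finset.univ : Finset (Fin (2 * m) → M))) (fun T => majW b m T x)
  rw [Finset.card_univ] at h4
  have h5 : (Finset.univ.filter fun T : Fin (2 * m) → M => ¬ majW b m T x).card ≤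
      (Finset.univ.filter fun T : Fin (2 * m) → M =>
        m ≤ (Finset.univ.filter fun i => isWrong (!b) x (T i).1).card).card := by
    refine Finset.card_le_card fun T hT => ?_
    rw [Finset.mem_filter] at hT ⊢
    refine ⟨hT.1, ?_⟩
    have hT2 := not_lt.1 hT.2
    have h6 := Finset.card_filter_add_card_filter_not
      (s := (Finset.univ : Finset (Fin (2 * m)))) (fun i => isWrong b x (T i).1)
    rw [Finset.card_univ, Fintype.card_fin] at h6
    have h7 : (Finset.univ.filter fun i => ¬ isWrong b x (T i).1) =
        (Finset.univ.filter fun i => isWrong (!b) x (T i).1) := by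
      refine Finset.filter_congr fun i _ => ?_
      unfold isWrong
      cases b <;> simp
    rw [h7] at h6
    omega
  have h4' : ((Finset.univ.filter fun T : Fin (2 * m) → M => majW b m T x).card : ℝ) +
      ((Finset.univ.filter fun T : Fin (2 * m) → M => ¬ majW b m T x).card : ℝ) =
      Fintype.card (Fin (2 * m) → M) := by exact_mod_cast h4
  have h8 := ((Nat.cast_le (α := ℝ)).2 h5).trans h2
  linarith

set_option maxHeartbeats 1000000 in
theorem robust_local_to_sample_based :
    ∀ ρ : ℝ, 0 < ρ → ρ < 1 →
    ∃ c : ℝ, 0 < c ∧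
    ∀ (ℓ : ℕ) (A : Type) [Fintype A] [DecidableEq A],
    ∃ n₀ : ℕ, ∀ n : ℕ, n₀ ≤ n →
    ∀ (dom : Set ((Fin n) → A)) (f : ((Fin n) → A) → Bool) (ρ0 ρ1 : ℝ)
      (M : Multiset (DTree A n Bool)),
      M ≠ 0 →
      (∀ t ∈ M, DTree.depth t ≤ ℓ) →
      (∀ x ∈ dom, 1 - 1/3 ≤ prP M x (· = f x)) →
      (∀ x ∈ dom, ∀ w : (Fin n) → A,
        relDist w x ≤ (if f x then ρ1 else ρ0) → 1 - 1/3 ≤ prP M w (· = f x)) →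
      ρ ≤ max ρ0 ρ1 →
      ∃ N : SampleAlg A n Bool,
        (∀ x ∈ dom, 2/3 ≤ N.pr x (· = f x)) ∧
        N.complexityLE
          (2 * (48 * (Fintype.card A : ℝ) ^ (c * ℓ * Real.logb 2 ((ℓ : ℝ) + 2)) *
              Real.log (Fintype.card A)) *
            (n : ℝ) ^ (1 - 1 / (2 * (c * ℓ * Real.logb 2 ((ℓ : ℝ) + 2)) ^ 2))) := by
  intro ρ hρ _
  refine ⟨576, by norm_num, ?_⟩
  intro ℓ A _ _
  by_cases hA : Fintype.card A ≤ 1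
  · refine ⟨0, fun n _ dom f ρ0 ρ1 M _ _ _ _ _ => trivial_alg dom f _ (Or.inr ?_)⟩
    have := Fintype.card_le_one_iff_subsingleton.1 hA
    infer_instance
  push Not at hA
  have hA2 : (2 : ℝ) ≤ Fintype.card A := by exact_mod_cast hA
  have hlogA : 1 / 2 ≤ Real.log (Fintype.card A) := by
    have h1 := Real.log_le_log (by norm_num) hA2
    have h2 := Real.log_two_gt_d9
    linarith
  rcases Nat.eq_zero_or_pos ℓ with hℓ | hℓ
  · refine ⟨0, fun n _ dom f ρ0 ρ1 M _ _ _ _ _ => trivial_alg dom f _ (Or.inl ?_)⟩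
    subst hℓ
    simp only [Nat.cast_zero, mul_zero, zero_mul, Real.rpow_zero, mul_one]
    norm_num
    have hn : (0 : ℝ) ≤ n := Nat.cast_nonneg n
    nlinarith
  set a := Nat.log 2 (ℓ + 2) + 1 with ha
  set m := 72 * a with hm
  set q := 2 * m * ℓ with hq
  set r : ℝ := 576 * ℓ * Real.logb 2 ((ℓ : ℝ) + 2) with hr
  have ha2 : ℓ + 2 ≤ 2 ^ a := (Nat.lt_pow_succ_log_self (by norm_num) _).le
  have hℓ1 : (1 : ℝ) ≤ ℓ := by exact_mod_cast hℓ
  have hlb : (1 : ℝ) ≤ Real.logb 2 ((ℓ : ℝ) + 2) := by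
    rw [Real.le_logb_iff_rpow_le (by norm_num) (by positivity), Real.rpow_one]
    linarith
  have hlog : (a : ℝ) ≤ 2 * Real.logb 2 ((ℓ : ℝ) + 2) := by
    have h1 : ((Nat.log 2 (ℓ + 2) : ℕ) : ℝ) ≤ Real.logb 2 ((ℓ + 2 : ℕ) : ℝ) := by
      rw [Real.le_logb_iff_rpow_le (by norm_num) (by positivity), Real.rpow_natCast]
      exact_mod_cast Nat.pow_log_le_self 2 (by omega)
    push_cast at h1
    rw [ha]; push_cast
    linarith
  have hr0 : 0 < r := by rw [hr]; positivity
  have hqr : 2 * (q : ℝ) ≤ r := by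
    rw [hq, hm, hr]; push_cast
    nlinarith [mul_le_mul_of_nonneg_left hlog (by positivity : (0 : ℝ) ≤ ℓ)]
  set L : ℝ := ((2 * m * (Fintype.card A + 1) ^ ℓ : ℕ) : ℝ) with hL
  have hL0 : 0 < L := by
    rw [hL, hm, ha]; positivity
  set t : ℝ := 1 / (4 * ((q : ℝ) + 1)) with ht
  have ht0 : 0 < t := by rw [ht]; positivity
  have ht4 : t ≤ 1 / 4 := by
    rw [ht]
    refine one_div_le_one_div_of_le (by norm_num) ?_
    have : (0 : ℝ) ≤ q := Nat.cast_nonneg q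
    linarith
  set G : ℝ := Real.log (12 * ((q : ℝ) + 1)) with hG
  have hq0 : (0 : ℝ) ≤ q := Nat.cast_nonneg q
  have hG0 : 0 ≤ G := Real.log_nonneg (by linarith)
  have H3 : ((q : ℝ) + 1) * Real.exp (-G) ≤ 1 / 12 := by
    rw [Real.exp_neg, hG, Real.exp_log (by positivity)]
    refine le_of_eq ?_
    field_simp
  obtain ⟨n₀, hn₀⟩ := numeric q r L ρ G t (Real.log (Fintype.card A)) hr0 hqr hL0 hρ hG0 ht0
    (by linarith)
  refine ⟨n₀, fun n hn dom f ρ0 ρ1 M hM hdepth hcomp hrob hmax => ?_⟩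
  obtain ⟨hnpos, p, R, hp, hp1, hpn, hR, H1, H2⟩ := hn₀ n hn
  have hn' : (0 : ℝ) < n := by exact_mod_cast hnpos
  obtain ⟨b, hb⟩ : ∃ b : Bool, ρ ≤ (if b then ρ1 else ρ0) := by
    rcases le_max_iff.1 hmax with h | h
    · exact ⟨false, by simpa using h⟩
    · exact ⟨true, by simpa using h⟩
  have hne : Nonempty M := by
    obtain ⟨x, hx⟩ := Multiset.exists_mem_of_ne_zero hM
    have : 0 < Fintype.card M := by
      rw [Multiset.card_coe]; exact Multiset.card_pos.2 hM
    exact Fintype.card_pos_iff.1 this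
  have hampn : (8 / 9 : ℝ) ^ m ≤ t := amp_num a ℓ ha2 (by omega)
  have hIpos : (0 : ℝ) ≤ Fintype.card (Fin (2 * m) → M) := Nat.cast_nonneg _
  rw [← hpn]
  refine core (I := Fin (2 * m) → M) b dom f
    (fun T x => majW b m T x)
    (fun T x => Finset.univ.biUnion fun i => (T i).1.queries x)
    (fun T => Finset.univ.biUnion fun i => (T i).1.support)
    q ?_ ?_ ?_ L ρ p _ R G t ?_ hL0 hρ hnpos (by omega) hp hp1 ?_ ?_ hR hG0 ht H1 H2 H3 ?_ ?_
  · intro T x y hxy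
    have h1 : ∀ i, (T i).1.queries y = (T i).1.queries x ∧ (T i).1.eval y = (T i).1.eval x :=
      fun i => DTree.queries_local _ x y fun v hv =>
        hxy v (Finset.mem_biUnion.2 ⟨i, Finset.mem_univ _, hv⟩)
    have hw : ∀ i, isWrong b y (T i).1 ↔ isWrong b x (T i).1 := fun i => by
      unfold isWrong; rw [(h1 i).2]
    refine ⟨by simp only [fun i => (h1 i).1], ?_⟩
    simp only [majW]
    rw [Finset.filter_congr (fun i _ => hw i)]
  · intro T x
    refine Finset.card_biUnion_le.trans ?_
    refine (Finset.sum_le_card_nsmul _ _ ℓ ?_).trans (le_of_eq ?_)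
    · intro i _
      exact (DTree.card_queries_le _ x).trans (hdepth _ (Multiset.coe_mem))
    · simp [hq]
  · intro T x v hv
    obtain ⟨i, hi, h⟩ := Finset.mem_biUnion.1 hv
    exact Finset.mem_biUnion.2 ⟨i, hi, DTree.queries_subset_support _ x h⟩
  · intro T
    rw [hL]
    refine Nat.cast_le.2 (Finset.card_biUnion_le.trans ?_)
    refine (Finset.sum_le_card_nsmul _ _ ((Fintype.card A + 1) ^ ℓ) ?_).trans (le_of_eq ?_)
    · intro i _
      exact (DTree.card_support_le _).trans
        (Nat.pow_le_pow_right (by omega) (hdepth _ (Multiset.coe_mem)))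
    · simp
  · positivity
  · have h1 : (1 : ℝ) ≤ (Fintype.card A : ℝ) ^ r := Real.one_le_rpow (by linarith) hr0.le
    have h2 : (1 / 2 : ℝ) ≤ (Fintype.card A : ℝ) ^ r * Real.log (Fintype.card A) := by
      nlinarith
    have h3 : 0 ≤ p * n := by positivity
    have h4 := mul_le_mul_of_nonneg_right h2 h3
    have e : 2 * (48 * (Fintype.card A : ℝ) ^ r * Real.log (Fintype.card A)) * (p * n) =
        96 * ((Fintype.card A : ℝ) ^ r * Real.log (Fintype.card A) * (p * n)) := by ring
    rw [e]
    linarith only [h3, h4]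
  · intro x hx hfx w hw
    have hw' : relDist w x ≤ (if f x then ρ1 else ρ0) := by
      rw [hfx]
      refine le_trans ?_ hb
      unfold relDist
      rw [div_le_iff₀ hn']
      refine le_trans (le_of_eq ?_) hw
      congr!
    have h1 := hrob x hx w hw'
    rw [hfx] at h1
    exact (amp_rob M hM w b m h1).trans (mul_le_mul_of_nonneg_right hampn hIpos)
  · intro x hx hfx
    have h1 := hcomp x hx
    rw [hfx] at h1
    refine le_trans (mul_le_mul_of_nonneg_right ?_ hIpos) (amp_comp M hM x b m h1)
    linarith only [hampn, ht4]
end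

section
/- There exists a universal constant c > 0 such that for every fixed finite alphabet Σ, every fixed ε > 0, and every q ∈ ℕ, there is a threshold n₀ such that for all n ≥ n₀: if a property Π ⊆ Σ^n admits an (ε/2)-tester with q queries and error rate 1/3, then Π admits a sample-based ε-tester with error rate 1/3 and sample complexity at most n^{1 − 1/(c·q²·log₂²(q+2))}. -/
open scoped Classical

namespace QS

/-- Weight of a `p`-biased random subset. -/
noncomputable def wt {n : ℕ} (p : ℝ) (R : Finset (Fin n)) : ℝ :=
  p ^ R.card * (1 - p) ^ (n - R.card)

lemma wt_nonneg {n : ℕ} {p : ℝ} (h0 : 0 ≤ p) (h1 : p ≤ 1) (R : Finset (Fin n)) :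
    0 ≤ wt p R :=
  mul_nonneg (pow_nonneg h0 _) (pow_nonneg (by linarith) _)

lemma wt_subset {n : ℕ} (p : ℝ) (U : Finset (Fin n)) :
    ∑ R : Finset (Fin n), wt p R * (if U ⊆ R then 1 else 0) = p ^ U.card := by
  have h := Finset.prod_add (fun _ : Fin n => p) (fun i => if i ∈ U then 0 else 1 - p)
    Finset.univ
  have hl : ∏ i : Fin n, (p + if i ∈ U then 0 else 1 - p) = p ^ U.card := by
    have : ∀ i : Fin n, (p + if i ∈ U then 0 else 1 - p) = if i ∈ U then p else 1 := by
      intro i; split_ifs <;> ring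
    simp_rw [this]
    rw [Finset.prod_ite]
    simp
  rw [hl] at h
  rw [h, Finset.powerset_univ]
  refine Finset.sum_congr rfl fun R _ => ?_
  rw [Finset.prod_const]
  unfold wt
  by_cases hU : U ⊆ R
  · have : ∏ i ∈ Finset.univ \ R, (if i ∈ U then (0:ℝ) else 1 - p) = (1 - p) ^ (n - R.card) := by
      rw [Finset.prod_congr rfl (g := fun _ => 1 - p)]
      · rw [Finset.prod_const, Finset.card_sdiff_of_subset (Finset.subset_univ _)]
        simp
      · intro i hi
        rw [if_neg]
        intro hiU
        exact (Finset.mem_sdiff.1 hi).2 (hU hiU)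
    rw [this, if_pos hU, mul_one]
  · obtain ⟨i, hi, hiR⟩ := Finset.not_subset.1 hU
    have : ∏ i ∈ Finset.univ \ R, (if i ∈ U then (0:ℝ) else 1 - p) = 0 :=
      Finset.prod_eq_zero (i := i) (by simp [hiR]) (by simp [hi])
    rw [this, if_neg hU]; ring

lemma wt_sum {n : ℕ} (p : ℝ) : ∑ R : Finset (Fin n), wt p R = 1 := by
  simpa using wt_subset (n := n) p ∅

lemma wt_card {n : ℕ} (p : ℝ) : ∑ R : Finset (Fin n), wt p R * (R.card : ℝ) = n * p := by
  have : ∀ R : Finset (Fin n), wt p R * (R.card : ℝ) =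
      ∑ i : Fin n, wt p R * (if ({i} : Finset (Fin n)) ⊆ R then 1 else 0) := by
    intro R
    rw [← Finset.mul_sum]
    simp
  simp_rw [this]
  rw [Finset.sum_comm]
  simp_rw [wt_subset]
  simp

/-- The (weighted) number of sampled petals. -/
noncomputable def Yv {n : ℕ} {Ω : Type} (G : Finset Ω) (w : Ω → ℝ)
    (P : Ω → Finset (Fin n)) (R : Finset (Fin n)) : ℝ :=
  ∑ o ∈ G, w o * (if P o ⊆ R then 1 else 0)

lemma Yv_nonneg {n : ℕ} {Ω : Type} (G : Finset Ω) (w : Ω → ℝ) (hw : ∀ o, 0 ≤ w o)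
    (P : Ω → Finset (Fin n)) (R : Finset (Fin n)) : 0 ≤ Yv G w P R :=
  Finset.sum_nonneg fun o _ => mul_nonneg (hw o) (by split_ifs <;> norm_num)

lemma moment {n : ℕ} {Ω : Type} (G : Finset Ω) (w : Ω → ℝ) (hw : ∀ o, 0 ≤ w o)
    (P : Ω → Finset (Fin n)) (j : ℕ) (hP : ∀ o ∈ G, (P o).card = j) (d : ℝ) (hd : 0 ≤ d)
    (hdeg : ∀ v, ∑ o ∈ G.filter (fun o => v ∈ P o), w o ≤ d) (p : ℝ) (h0 : 0 ≤ p) (h1 : p ≤ 1)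
    (k : ℕ) : ∀ U : Finset (Fin n),
    ∑ R, wt p R * ((if U ⊆ R then 1 else 0) * Yv G w P R ^ k) ≤
      p ^ U.card * (p ^ j * (∑ o ∈ G, w o) + (U.card + k * j) * d) ^ k := by
  have hs : 0 ≤ ∑ o ∈ G, w o := Finset.sum_nonneg fun o _ => hw o
  induction k with
  | zero => intro U; simpa using (wt_subset p U).le
  | succ k ih =>
    intro U
    set s := ∑ o ∈ G, w o with hsdef
    have e1 : ∑ R, wt p R * ((if U ⊆ R then 1 else 0) * Yv G w P R ^ (k+1)) =
        ∑ o ∈ G, w o * ∑ R, wt p R * ((if U ∪ P o ⊆ R then 1 else 0) * Yv G w P R ^ k) := by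
      simp_rw [Finset.mul_sum]
      rw [Finset.sum_comm]
      refine Finset.sum_congr rfl fun R _ => ?_
      rw [pow_succ]
      conv_lhs => rw [show Yv G w P R ^ k * Yv G w P R =
        Yv G w P R ^ k * ∑ o ∈ G, w o * (if P o ⊆ R then 1 else 0) from rfl]
      simp_rw [Finset.mul_sum]
      refine Finset.sum_congr rfl fun o _ => ?_
      by_cases hU : U ⊆ R <;> by_cases hPo : P o ⊆ R <;>
        simp [hU, hPo, Finset.union_subset_iff] <;> ring
    rw [e1]
    set X := p ^ j * s + (U.card + (k+1 : ℕ) * j) * d with hX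
    have hX0 : 0 ≤ X := by positivity
    have hb : ∀ o ∈ G, ∑ R, wt p R * ((if U ∪ P o ⊆ R then 1 else 0) * Yv G w P R ^ k) ≤
        p ^ U.card * X ^ k * (p ^ j + ∑ v ∈ U, if v ∈ P o then 1 else 0) := by
      intro o ho
      have hc : ((U ∪ P o).card : ℝ) ≤ U.card + j := by
        have := Finset.card_union_le U (P o)
        rw [hP o ho] at this
        exact_mod_cast this
      have hle : (p ^ j * s + ((U ∪ P o).card + k * j) * d) ^ k ≤ X ^ k := by
        apply pow_le_pow_left₀ (by positivity)
        rw [hX]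
        push_cast
        nlinarith
      have hp : p ^ (U ∪ P o).card ≤ p ^ U.card * (p ^ j + ∑ v ∈ U, if v ∈ P o then 1 else 0) := by
        by_cases hdis : Disjoint U (P o)
        · rw [Finset.card_union_of_disjoint hdis, hP o ho, pow_add]
          apply mul_le_mul_of_nonneg_left _ (by positivity)
          have : 0 ≤ ∑ v ∈ U, if v ∈ P o then (1:ℝ) else 0 :=
            Finset.sum_nonneg fun v _ => by split_ifs <;> norm_num
          linarith
        · obtain ⟨v, hvU, hvP⟩ := Finset.not_disjoint_iff.1 hdis
          have h2 : (1:ℝ) ≤ ∑ v ∈ U, if v ∈ P o then (1:ℝ) else 0 := by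
            have := Finset.single_le_sum (f := fun v => if v ∈ P o then (1:ℝ) else 0)
              (fun v _ => by split_ifs <;> norm_num) hvU
            simpa [hvP] using this
          calc p ^ (U ∪ P o).card ≤ p ^ U.card :=
                pow_le_pow_of_le_one h0 h1 (Finset.card_le_card Finset.subset_union_left)
            _ = p ^ U.card * 1 := by ring
            _ ≤ _ := mul_le_mul_of_nonneg_left (by have := pow_nonneg h0 j; linarith) (by positivity)
      calc _ ≤ _ := ih (U ∪ P o)
        _ ≤ (p ^ U.card * (p ^ j + ∑ v ∈ U, if v ∈ P o then 1 else 0)) * X ^ k :=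
          mul_le_mul hp hle (by positivity) (le_trans (by positivity) hp)
        _ = _ := by ring
    calc ∑ o ∈ G, w o * ∑ R, wt p R * ((if U ∪ P o ⊆ R then 1 else 0) * Yv G w P R ^ k)
        ≤ ∑ o ∈ G, w o * (p ^ U.card * X ^ k * (p ^ j + ∑ v ∈ U, if v ∈ P o then 1 else 0)) :=
          Finset.sum_le_sum fun o ho => mul_le_mul_of_nonneg_left (hb o ho) (hw o)
      _ = p ^ U.card * X ^ k * (p ^ j * s + ∑ v ∈ U, ∑ o ∈ G.filter (fun o => v ∈ P o), w o) := by
          simp_rw [Finset.sum_filter]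
          rw [Finset.sum_comm (s := U), hsdef, Finset.mul_sum, ← Finset.sum_add_distrib,
            Finset.mul_sum]
          refine Finset.sum_congr rfl fun o _ => ?_
          have : ∑ v ∈ U, (if v ∈ P o then w o else 0) = w o * ∑ v ∈ U, if v ∈ P o then 1 else 0 := by
            rw [Finset.mul_sum]
            exact Finset.sum_congr rfl fun v _ => by split_ifs <;> simp
          rw [this]; ring
      _ ≤ p ^ U.card * X ^ k * X := by
          apply mul_le_mul_of_nonneg_left _ (by positivity)
          have : ∑ v ∈ U, ∑ o ∈ G.filter (fun o => v ∈ P o), w o ≤ U.card * d := by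
            calc _ ≤ ∑ v ∈ U, d := Finset.sum_le_sum fun v _ => hdeg v
              _ = _ := by simp
          have h3 : 0 ≤ ((k+1 : ℕ) : ℝ) * j * d := by positivity
          rw [hX]; linarith
      _ = _ := by ring

lemma moment' {n : ℕ} {Ω : Type} (G : Finset Ω) (w : Ω → ℝ) (hw : ∀ o, 0 ≤ w o)
    (P : Ω → Finset (Fin n)) (j : ℕ) (hP : ∀ o ∈ G, (P o).card = j) (d : ℝ) (hd : 0 ≤ d)
    (hdeg : ∀ v, ∑ o ∈ G.filter (fun o => v ∈ P o), w o ≤ d) (p : ℝ) (h0 : 0 ≤ p) (h1 : p ≤ 1)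
    (k : ℕ) :
    ∑ R, wt p R * Yv G w P R ^ k ≤ (p ^ j * (∑ o ∈ G, w o) + k * j * d) ^ k := by
  simpa using moment G w hw P j hP d hd hdeg p h0 h1 k ∅

lemma upper_tail {n : ℕ} {Ω : Type} (G : Finset Ω) (w : Ω → ℝ) (hw : ∀ o, 0 ≤ w o)
    (P : Ω → Finset (Fin n)) (j : ℕ) (hP : ∀ o ∈ G, (P o).card = j) (d : ℝ) (hd : 0 ≤ d)
    (hdeg : ∀ v, ∑ o ∈ G.filter (fun o => v ∈ P o), w o ≤ d) (p : ℝ) (h0 : 0 < p) (h1 : p ≤ 1)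
    (k : ℕ) (s t : ℝ) (hs : ∑ o ∈ G, w o ≤ s) (ht : 0 < t) (hst : 4 * s ≤ t)
    (hk : k * j * d ≤ p ^ j * s) :
    ∑ R, wt p R * (if t * p ^ j ≤ Yv G w P R then 1 else 0) ≤ (1/2 : ℝ) ^ k := by
  have hpj : 0 < p ^ j := pow_pos h0 j
  have hs0 : 0 ≤ ∑ o ∈ G, w o := Finset.sum_nonneg fun o _ => hw o
  have htp : 0 < (t * p ^ j) ^ k := by positivity
  have h2 : (t * p ^ j) ^ k * ∑ R, wt p R * (if t * p ^ j ≤ Yv G w P R then 1 else 0) ≤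
      ∑ R, wt p R * Yv G w P R ^ k := by
    rw [Finset.mul_sum]
    refine Finset.sum_le_sum fun R _ => ?_
    have hw0 := wt_nonneg h0.le h1 R
    have hY := Yv_nonneg G w hw P R
    split_ifs with h
    · have := pow_le_pow_left₀ (by positivity) h k
      nlinarith
    · rw [mul_zero, mul_zero]; positivity
  have h3 := moment' G w hw P j hP d hd hdeg p h0.le h1 k
  have h4 : (p ^ j * (∑ o ∈ G, w o) + k * j * d) ^ k ≤ (1/2 : ℝ) ^ k * (t * p ^ j) ^ k := by
    rw [← mul_pow]
    apply pow_le_pow_left₀ (by positivity)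
    nlinarith
  have h5 := (h2.trans h3).trans h4
  rw [mul_comm ((1/2 : ℝ) ^ k)] at h5
  exact le_of_mul_le_mul_left h5 htp

lemma lower_tail {n : ℕ} {Ω : Type} (G : Finset Ω) (w : Ω → ℝ) (hw : ∀ o, 0 ≤ w o)
    (P : Ω → Finset (Fin n)) (j : ℕ) (hP : ∀ o ∈ G, (P o).card = j) (d : ℝ) (hd : 0 ≤ d)
    (hdeg : ∀ v, ∑ o ∈ G.filter (fun o => v ∈ P o), w o ≤ d) (p : ℝ) (h0 : 0 < p) (h1 : p ≤ 1)
    (t : ℝ) (hs : 2 * t ≤ ∑ o ∈ G, w o) (ht : 0 < t)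
    (hk : 100 * j * d ≤ p ^ j * t) :
    ∑ R, wt p R * (if t * p ^ j ≤ Yv G w P R then 0 else 1) ≤ 1/6 := by
  have hpj : 0 < p ^ j := pow_pos h0 j
  have h3 := moment' G w hw P j hP d hd hdeg p h0.le h1 2
  set m := p ^ j * ∑ o ∈ G, w o with hm
  have hmt : 2 * (t * p ^ j) ≤ m := by rw [hm]; nlinarith
  have hm0 : 0 < m := by have : 0 < t * p ^ j := by positivity
                         linarith
  have hE : ∑ R, wt p R * Yv G w P R = m := by
    unfold Yv
    simp_rw [Finset.mul_sum]
    rw [Finset.sum_comm, hm, Finset.mul_sum]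
    refine Finset.sum_congr rfl fun o ho => ?_
    rw [← hP o ho, ← wt_subset p (P o), Finset.sum_mul]
    exact Finset.sum_congr rfl fun R _ => by ring
  have hV : ∑ R, wt p R * (Yv G w P R - m) ^ 2 = ∑ R, wt p R * Yv G w P R ^ 2 - m ^ 2 := by
    have : ∀ R, wt p R * (Yv G w P R - m) ^ 2 =
      wt p R * Yv G w P R ^ 2 - (2 * m) * (wt p R * Yv G w P R) + m ^ 2 * wt p R := fun R => by ring
    simp_rw [this]
    rw [Finset.sum_add_distrib, Finset.sum_sub_distrib, ← Finset.mul_sum, ← Finset.mul_sum,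
      wt_sum, hE]; ring
  have h2 : m ^ 2 / 4 * ∑ R, wt p R * (if t * p ^ j ≤ Yv G w P R then 0 else 1) ≤
      ∑ R, wt p R * (Yv G w P R - m) ^ 2 := by
    rw [Finset.mul_sum]
    refine Finset.sum_le_sum fun R _ => ?_
    have hw0 := wt_nonneg h0.le h1 R
    split_ifs with h
    · rw [mul_zero, mul_zero]; positivity
    · have : m ^ 2 / 4 ≤ (Yv G w P R - m) ^ 2 := by nlinarith
      nlinarith
  rw [hV] at h2
  push_cast at h3
  have hjd : 0 ≤ j * d := by positivity
  have hjm : 200 * (j * d) ≤ m := by nlinarith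
  have h4 : (m + 2 * j * d) ^ 2 - m ^ 2 ≤ m ^ 2 / 4 * (1/6) := by nlinarith
  have h5 : m ^ 2 / 4 * ∑ R, wt p R * (if t * p ^ j ≤ Yv G w P R then 0 else 1) ≤
    m ^ 2 / 4 * (1/6) := by linarith
  exact le_of_mul_le_mul_left h5 (by positivity)

/-- Replace the coordinates of `x` in `K` by `κ`. -/
def repl {A : Type} {n : ℕ} (K : Finset (Fin n)) (κ : K → A) (x : Fin n → A) : Fin n → A :=
  fun i => if h : i ∈ K then κ ⟨i, h⟩ else x i

lemma repl_self {A : Type} {n : ℕ} (K : Finset (Fin n)) (x : Fin n → A) :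
    repl K (fun i => x i) x = x := by
  funext i; unfold repl; split_ifs <;> rfl

lemma relDist_repl {A : Type} [DecidableEq A] {n : ℕ} (K : Finset (Fin n)) (κ : K → A)
    (x y : Fin n → A) : relDist x y ≤ K.card / n + relDist (repl K κ x) y := by
  unfold relDist
  rw [← add_div]
  apply div_le_div_of_nonneg_right _ (Nat.cast_nonneg n)
  have : (Finset.univ.filter fun i => x i ≠ y i) ⊆
      K ∪ (Finset.univ.filter fun i => repl K κ x i ≠ y i) := by
    intro i hi
    by_cases h : i ∈ K
    · exact Finset.mem_union_left _ h
    · apply Finset.mem_union_right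
      have h2 : repl K κ x i = x i := by simp [repl, h]
      rw [Finset.mem_filter] at hi ⊢
      rw [h2]; exact hi
  have := (Finset.card_le_card this).trans (Finset.card_union_le _ _)
  exact_mod_cast this

section core
variable {A : Type} {n : ℕ} {Ω : Type} [Fintype Ω]

/-- Degree of a coordinate. -/
noncomputable def deg (All : Ω → Finset (Fin n)) (v : Fin n) : ℝ :=
  ∑ o ∈ Finset.univ.filter (fun o => v ∈ All o), (1 / Fintype.card Ω : ℝ)

/-- The kernel at level `j`. -/
noncomputable def Kr (All : Ω → Finset (Fin n)) (D : ℕ → ℝ) (j : ℕ) : Finset (Fin n) :=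
  Finset.univ.filter (fun v => D (j+1) ≤ deg All v)

/-- The accepting part of the daisy at level `j`, on input `y`. -/
noncomputable def Gd (S : Ω → (Fin n → A) → Finset (Fin n)) (out : Ω → (Fin n → A) → Prop)
    (All : Ω → Finset (Fin n)) (D : ℕ → ℝ) (j : ℕ) (y : Fin n → A) : Finset Ω :=
  Finset.univ.filter (fun o => out o y ∧ (S o y \ Kr All D j).card = j ∧
    ∀ i ∈ S o y \ Kr All D j, deg All i < D j)

/-- Votes -/
noncomputable def Vt (S : Ω → (Fin n → A) → Finset (Fin n)) (out : Ω → (Fin n → A) → Prop)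
    (All : Ω → Finset (Fin n)) (D : ℕ → ℝ) (j : ℕ) (y : Fin n → A) (R : Finset (Fin n)) : ℝ :=
  Yv (Gd S out All D j y) (fun _ => (1 / Fintype.card Ω : ℝ)) (fun o => S o y \ Kr All D j) R

lemma sum_deg [Nonempty Ω] (All : Ω → Finset (Fin n)) (B : ℕ) (hB : ∀ o, (All o).card ≤ B) :
    ∑ v, deg All v ≤ B := by
  unfold deg
  simp_rw [Finset.sum_filter]
  rw [Finset.sum_comm]
  have hc : (0:ℝ) < Fintype.card Ω := by exact_mod_cast Fintype.card_pos
  calc _ ≤ ∑ o : Ω, (B : ℝ) * (1 / Fintype.card Ω) := by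
        refine Finset.sum_le_sum fun o _ => ?_
        rw [← Finset.sum_filter]
        simp only [Finset.filter_mem_eq_inter, Finset.univ_inter, Finset.sum_const, nsmul_eq_mul]
        apply mul_le_mul_of_nonneg_right _ (by positivity)
        exact_mod_cast hB o
    _ = _ := by
      rw [Finset.sum_const, nsmul_eq_mul, Finset.card_univ]; field_simp

lemma deg_nonneg (All : Ω → Finset (Fin n)) (v : Fin n) : 0 ≤ deg All v :=
  Finset.sum_nonneg fun _ _ => by positivity

lemma card_Kr [Nonempty Ω] (All : Ω → Finset (Fin n)) (D : ℕ → ℝ) (hD : ∀ j, 0 < D j)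
    (B : ℕ) (hB : ∀ o, (All o).card ≤ B) (j : ℕ) : ((Kr All D j).card : ℝ) ≤ B / D (j+1) := by
  rw [le_div_iff₀ (hD _)]
  calc ((Kr All D j).card : ℝ) * D (j+1) = ∑ v ∈ Kr All D j, D (j+1) := by simp
    _ ≤ ∑ v ∈ Kr All D j, deg All v :=
      Finset.sum_le_sum fun v hv => (Finset.mem_filter.1 hv).2
    _ ≤ ∑ v, deg All v := Finset.sum_le_sum_of_subset_of_nonneg (Finset.subset_univ _)
      fun v _ _ => deg_nonneg All v
    _ ≤ B := sum_deg All B hB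

lemma deg_bound (S : Ω → (Fin n → A) → Finset (Fin n)) (out : Ω → (Fin n → A) → Prop)
    (All : Ω → Finset (Fin n)) (hSA : ∀ o x, S o x ⊆ All o) (D : ℕ → ℝ) (hD : ∀ j, 0 < D j)
    (j : ℕ) (y : Fin n → A) (v : Fin n) :
    ∑ o ∈ (Gd S out All D j y).filter (fun o => v ∈ S o y \ Kr All D j),
      (1 / Fintype.card Ω : ℝ) ≤ D j := by
  by_cases h : ((Gd S out All D j y).filter (fun o => v ∈ S o y \ Kr All D j)).Nonempty
  · obtain ⟨o, ho⟩ := h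
    rw [Finset.mem_filter] at ho
    have h1 : deg All v < D j := ((Finset.mem_filter.1 ho.1).2.2.2) v ho.2
    refine le_trans ?_ h1.le
    unfold deg
    apply Finset.sum_le_sum_of_subset_of_nonneg
    · intro o' ho'
      rw [Finset.mem_filter] at ho' ⊢
      exact ⟨Finset.mem_univ _, hSA o' y (Finset.mem_sdiff.1 ho'.2).1⟩
    · intros; positivity
  · rw [Finset.not_nonempty_iff_eq_empty.1 h]
    simpa using (hD j).le

lemma Gd_card (S : Ω → (Fin n → A) → Finset (Fin n)) (out : Ω → (Fin n → A) → Prop)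
    (All : Ω → Finset (Fin n)) (D : ℕ → ℝ)
    (j : ℕ) (y : Fin n → A) : ∀ o ∈ Gd S out All D j y, (S o y \ Kr All D j).card = j :=
  fun _ ho => (Finset.mem_filter.1 ho).2.2.1

lemma Gd_cover (S : Ω → (Fin n → A) → Finset (Fin n)) (out : Ω → (Fin n → A) → Prop)
    (All : Ω → Finset (Fin n)) (D : ℕ → ℝ) (hD : Monotone D) (Q : ℕ)
    (hQ : ∀ o x, (S o x).card ≤ Q) (y : Fin n → A) (o : Ω) (ho : out o y) :
    ∃ j ∈ Finset.range (Q+1), o ∈ Gd S out All D j y := by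
  have hex : ∃ j, (S o y \ Kr All D j).card ≤ j :=
    ⟨Q, (Finset.card_le_card Finset.sdiff_subset).trans (hQ o y)⟩
  have hspec := Nat.find_spec hex
  have hmin : ∀ m < Nat.find hex, ¬ _ := fun m hm => Nat.find_min hex hm
  have hle : Nat.find hex ≤ Q :=
    Nat.find_min' hex ((Finset.card_le_card Finset.sdiff_subset).trans (hQ o y))
  generalize Nat.find hex = j at *
  refine ⟨j, Finset.mem_range.2 (by omega), ?_⟩
  unfold Gd
  rw [Finset.mem_filter]
  refine ⟨Finset.mem_univ _, ho, ?_⟩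
  cases j with
  | zero =>
    have : S o y \ Kr All D 0 = ∅ := Finset.card_eq_zero.1 (by omega)
    rw [this]; simp
  | succ j =>
    have h1 := hmin j (Nat.lt_succ_self j)
    have hsub : S o y \ Kr All D j ⊆ S o y \ Kr All D (j+1) := by
      apply Finset.sdiff_subset_sdiff (le_refl _)
      intro v hv
      unfold Kr at *
      rw [Finset.mem_filter] at *
      exact ⟨hv.1, (hD (by omega)).trans hv.2⟩
    have h2 := Finset.card_le_card hsub
    have heq := Finset.eq_of_subset_of_card_le hsub (by omega)
    refine ⟨by omega, ?_⟩
    intro i hi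
    rw [← heq] at hi
    have := (Finset.mem_sdiff.1 hi).2
    unfold Kr at this
    simpa using this

lemma Vt_local (S : Ω → (Fin n → A) → Finset (Fin n)) (out : Ω → (Fin n → A) → Prop)
    (All : Ω → Finset (Fin n))
    (hloc : ∀ o x y, (∀ i ∈ S o x, x i = y i) → S o y = S o x ∧ (out o y ↔ out o x))
    (D : ℕ → ℝ) (j : ℕ) (R : Finset (Fin n)) (κ : Kr All D j → A) (x y : Fin n → A)
    (hxy : ∀ i ∈ R, x i = y i) :
    Vt S out All D j (repl _ κ x) R = Vt S out All D j (repl _ κ y) R := by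
  have key : ∀ x y : Fin n → A, (∀ i ∈ R, x i = y i) → ∀ o,
      S o (repl _ κ x) \ Kr All D j ⊆ R →
      S o (repl _ κ y) = S o (repl _ κ x) ∧ (out o (repl _ κ y) ↔ out o (repl _ κ x)) := by
    intro x y hxy o ho
    apply hloc
    intro i hi
    unfold repl
    split_ifs with h
    · rfl
    · exact hxy i (ho (Finset.mem_sdiff.2 ⟨hi, h⟩))
  unfold Vt Yv Gd
  simp_rw [Finset.sum_filter]
  refine Finset.sum_congr rfl fun o _ => ?_
  by_cases h1 : S o (repl _ κ x) \ Kr All D j ⊆ R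
  · obtain ⟨h2, h3⟩ := key x y hxy o h1
    simp only [h2, h3]
  · by_cases h4 : S o (repl _ κ y) \ Kr All D j ⊆ R
    · obtain ⟨h2, h3⟩ := key y x (fun i hi => (hxy i hi).symm) o h4
      simp only [h2, h3]
    · rw [if_neg h1, if_neg h4]; simp

/-- The acceptance test of the sample-based tester. -/
def Test (S : Ω → (Fin n → A) → Finset (Fin n)) (out : Ω → (Fin n → A) → Prop)
    (All : Ω → Finset (Fin n)) (D : ℕ → ℝ) (Q : ℕ) (t p cap : ℝ) (R : Finset (Fin n))
    (x : Fin n → A) : Prop :=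
  (R.card : ℝ) ≤ cap ∧ ∃ j ∈ Finset.range (Q+1), ∃ κ : Kr All D j → A,
    t * p ^ j ≤ Vt S out All D j (repl _ κ x) R

/-- The sample-based tester. -/
noncomputable def mkAlg (S : Ω → (Fin n → A) → Finset (Fin n)) (out : Ω → (Fin n → A) → Prop)
    (All : Ω → Finset (Fin n))
    (hloc : ∀ o x y, (∀ i ∈ S o x, x i = y i) → S o y = S o x ∧ (out o y ↔ out o x))
    (D : ℕ → ℝ) (Q : ℕ) (t p cap : ℝ) (h0 : 0 ≤ p) (h1 : p ≤ 1) : SampleAlg A n Bool where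
  p := p
  out R x b := if (b = true ↔ Test S out All D Q t p cap R x) then 1 else 0
  p_nonneg := h0
  p_le_one := h1
  out_nonneg _ _ _ := by split_ifs <;> norm_num
  out_sum R x := by
    by_cases h : Test S out All D Q t p cap R x <;> simp [h]
  local_out R x y hxy := by
    have : Test S out All D Q t p cap R x ↔ Test S out All D Q t p cap R y := by
      unfold Test
      refine and_congr_right fun _ => exists_congr fun j => and_congr_right fun _ =>
        exists_congr fun κ => ?_
      rw [Vt_local S out All hloc D j R κ x y hxy]
    funext b
    rw [this]

lemma core [Fintype A] [DecidableEq A] [Nonempty Ω]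
    (S : Ω → (Fin n → A) → Finset (Fin n)) (out : Ω → (Fin n → A) → Prop)
    (All : Ω → Finset (Fin n))
    (hloc : ∀ o x y, (∀ i ∈ S o x, x i = y i) → S o y = S o x ∧ (out o y ↔ out o x))
    (hSA : ∀ o x, S o x ⊆ All o) (B Q M : ℕ) (hB : ∀ o, (All o).card ≤ B)
    (hQ : ∀ o x, (S o x).card ≤ Q)
    (D : ℕ → ℝ) (hD0 : ∀ j, 0 < D j) (hD : Monotone D)
    (s t p cap ε : ℝ) (hp0 : 0 < p) (hp1 : p ≤ 1) (ht : 0 < t) (hst : 4 * s ≤ t)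
    (htQ : (Q + 1) * (2 * t) ≤ 1 - s) (hs0 : 0 ≤ s) (hn : 0 < n)
    (hnum : ∀ j ≤ Q, (Fintype.card A * (B / D (j+1)) + M) * j * D j ≤ p ^ j * s)
    (hker : ∀ j ≤ Q, B / D (j+1) ≤ ε / 2 * n)
    (hM : 100 ≤ M) (hQM : (Q + 1) * (1/2 : ℝ) ^ M ≤ 1/3)
    (hcap0 : 0 < cap) (hcap : n * p ≤ cap / 6)
    (Pty : Set (Fin n → A))
    (hcomp : ∀ x ∈ Pty, 1 - s ≤ ∑ o ∈ Finset.univ.filter (fun o => out o x),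
      (1 / Fintype.card Ω : ℝ))
    (hsound : ∀ x, (∀ y ∈ Pty, ε / 2 < relDist x y) →
      ∑ o ∈ Finset.univ.filter (fun o => out o x), (1 / Fintype.card Ω : ℝ) ≤ s) :
    ∃ N : SampleAlg A n Bool,
        (∀ x ∈ Pty, 2/3 ≤ N.pr x (· = true)) ∧
        (∀ x : (Fin n) → A, (∀ y ∈ Pty, ε < relDist x y) →
          2/3 ≤ N.pr x (· = false)) ∧
        N.complexityLE cap := by
  have hw : ∀ _ : Ω, 0 ≤ (1 / Fintype.card Ω : ℝ) := fun _ => by positivity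
  have hwt : ∀ R : Finset (Fin n), 0 ≤ wt p R := wt_nonneg hp0.le hp1
  have hprt : ∀ x, (mkAlg S out All hloc D Q t p cap hp0.le hp1).pr x (· = true) =
      ∑ R, wt p R * (if Test S out All D Q t p cap R x then 1 else 0) := by
    intro x
    unfold SampleAlg.pr
    refine Finset.sum_congr rfl fun R _ => ?_
    change wt p R * _ = _
    congr 1
    by_cases h : Test S out All D Q t p cap R x <;> simp [mkAlg, h]
  have hprf : ∀ x, (mkAlg S out All hloc D Q t p cap hp0.le hp1).pr x (· = false) =
      ∑ R, wt p R * (if Test S out All D Q t p cap R x then 0 else 1) := by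
    intro x
    unfold SampleAlg.pr
    refine Finset.sum_congr rfl fun R _ => ?_
    change wt p R * _ = _
    congr 1
    by_cases h : Test S out All D Q t p cap R x <;> simp [mkAlg, h]
  have hadd : ∀ x, ∑ R, wt p R * (if Test S out All D Q t p cap R x then 1 else 0) +
      ∑ R, wt p R * (if Test S out All D Q t p cap R x then 0 else 1) = 1 := by
    intro x
    rw [← Finset.sum_add_distrib]
    refine Eq.trans ?_ (wt_sum (n := n) p)
    refine Finset.sum_congr rfl fun R _ => ?_
    split_ifs <;> ring
  refine ⟨mkAlg S out All hloc D Q t p cap hp0.le hp1, ?_, ?_, ?_⟩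
  · intro x hx
    rw [hprt]
    suffices h : ∑ R, wt p R * (if Test S out All D Q t p cap R x then 0 else 1) ≤ 1/3 by
      linarith [hadd x]
    -- find a good level
    obtain ⟨j, hj, hjs⟩ : ∃ j ∈ Finset.range (Q+1),
        2 * t ≤ ∑ o ∈ Gd S out All D j x, (1 / Fintype.card Ω : ℝ) := by
      by_contra hcon
      push Not at hcon
      have h1 : ∑ o ∈ Finset.univ.filter (fun o => out o x), (1 / Fintype.card Ω : ℝ) ≤
          ∑ j ∈ Finset.range (Q+1), ∑ o ∈ Gd S out All D j x, (1 / Fintype.card Ω : ℝ) := by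
        have hsub : Finset.univ.filter (fun o => out o x) ⊆
            (Finset.range (Q+1)).biUnion (fun j => Gd S out All D j x) := by
          intro o ho
          rw [Finset.mem_biUnion]
          exact Gd_cover S out All D hD Q hQ x o (Finset.mem_filter.1 ho).2
        have hcard : ((Finset.univ.filter (fun o => out o x)).card : ℝ) ≤
            ∑ j ∈ Finset.range (Q+1), ((Gd S out All D j x).card : ℝ) := by
          exact_mod_cast (Finset.card_le_card hsub).trans Finset.card_biUnion_le
        simp only [Finset.sum_const, nsmul_eq_mul]
        rw [← Finset.sum_mul]
        exact mul_le_mul_of_nonneg_right hcard (by positivity)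
      have h2 : ∑ j ∈ Finset.range (Q+1), ∑ o ∈ Gd S out All D j x, (1 / Fintype.card Ω : ℝ) <
          ∑ j ∈ Finset.range (Q+1), 2 * t :=
        Finset.sum_lt_sum_of_nonempty (by simp) hcon
      have h3 := hcomp x hx
      simp only [Finset.sum_const, Finset.card_range, nsmul_eq_mul] at h2
      push_cast at h2
      simp only [Finset.sum_const, nsmul_eq_mul] at h1 h3
      linarith
    have hjQ : j ≤ Q := by have := Finset.mem_range.1 hj; omega
    have hlow := lower_tail (Gd S out All D j x) (fun _ => (1 / Fintype.card Ω : ℝ)) hw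
      (fun o => S o x \ Kr All D j) j (Gd_card S out All D j x) (D j) (hD0 j).le
      (deg_bound S out All hSA D hD0 j x) p hp0 hp1 t hjs ht (by
        have h1 := hnum j hjQ
        have hjD : 0 ≤ j * D j := mul_nonneg (Nat.cast_nonneg _) (hD0 j).le
        have hM' : (100:ℝ) ≤ Fintype.card A * (B / D (j+1)) + M := by
          have : (100:ℝ) ≤ M := by exact_mod_cast hM
          have h2 : 0 ≤ (Fintype.card A : ℝ) * (B / D (j+1)) :=
            mul_nonneg (Nat.cast_nonneg _) (div_nonneg (Nat.cast_nonneg _) (hD0 _).le)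
          linarith
        have h4 : p ^ j * s ≤ p ^ j * t :=
          mul_le_mul_of_nonneg_left (by linarith) (by positivity)
        nlinarith)
    have hmark : ∑ R : Finset (Fin n), wt p R * (if (R.card : ℝ) ≤ cap then 0 else 1) ≤ 1/6 := by
      have : cap * ∑ R : Finset (Fin n), wt p R * (if (R.card : ℝ) ≤ cap then 0 else 1) ≤ n * p := by
        rw [← wt_card, Finset.mul_sum]
        refine Finset.sum_le_sum fun R _ => ?_
        have := hwt R
        split_ifs with h
        · rw [mul_zero, mul_zero]; positivity
        · push Not at h; nlinarith
      have h2 : cap * ∑ R : Finset (Fin n), wt p R * (if (R.card : ℝ) ≤ cap then 0 else 1) ≤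
        cap * (1/6) := by linarith
      exact le_of_mul_le_mul_left h2 hcap0
    calc _ ≤ ∑ R, (wt p R * (if t * p ^ j ≤ Vt S out All D j x R then 0 else 1) +
          wt p R * (if (R.card : ℝ) ≤ cap then 0 else 1)) := by
          refine Finset.sum_le_sum fun R _ => ?_
          rw [← mul_add]
          apply mul_le_mul_of_nonneg_left _ (hwt R)
          by_cases h1 : t * p ^ j ≤ Vt S out All D j x R
          · by_cases h2 : (R.card : ℝ) ≤ cap
            · rw [if_pos]
              · simp [h1, h2]
              · refine ⟨h2, j, hj, fun i => x i, ?_⟩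
                rw [repl_self]; exact h1
            · rw [if_neg h2]; split_ifs <;> norm_num
          · rw [if_neg h1]; split_ifs <;> norm_num
      _ ≤ 1/3 := by
        rw [Finset.sum_add_distrib]
        have : ∑ R, wt p R * (if t * p ^ j ≤ Vt S out All D j x R then 0 else 1) ≤ 1/6 := hlow
        linarith
  · intro x hx
    rw [hprf]
    suffices h : ∑ R, wt p R * (if Test S out All D Q t p cap R x then 1 else 0) ≤ 1/3 by
      linarith [hadd x]
    have hone : ∀ j ∈ Finset.range (Q+1), ∀ κ : Kr All D j → A,
        ∑ R, wt p R * (if t * p ^ j ≤ Vt S out All D j (repl _ κ x) R then 1 else 0) ≤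
          (1/2 : ℝ) ^ (Fintype.card A * (Kr All D j).card + M) := by
      intro j hj κ
      have hjQ : j ≤ Q := by have := Finset.mem_range.1 hj; omega
      have hKc := card_Kr All D hD0 B hB j
      refine upper_tail (Gd S out All D j (repl _ κ x)) (fun _ => (1 / Fintype.card Ω : ℝ)) hw
        (fun o => S o (repl _ κ x) \ Kr All D j) j (Gd_card S out All D j _) (D j) (hD0 j).le
        (deg_bound S out All hSA D hD0 j _) p hp0 hp1 _ s t ?_ ht hst ?_
      · refine le_trans ?_ (hsound (repl _ κ x) ?_)
        · apply Finset.sum_le_sum_of_subset_of_nonneg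
          · intro o ho
            rw [Finset.mem_filter]
            exact ⟨Finset.mem_univ _, (Finset.mem_filter.1 ho).2.1⟩
          · intros; positivity
        · intro y hy
          have h1 := hx y hy
          have h2 := relDist_repl (Kr All D j) κ x y
          have h3 : ((Kr All D j).card : ℝ) / n ≤ ε / 2 := by
            rw [div_le_iff₀ (by exact_mod_cast hn)]
            exact hKc.trans (hker j hjQ)
          linarith
      · refine le_trans ?_ (hnum j hjQ)
        apply mul_le_mul_of_nonneg_right _ (hD0 j).le
        apply mul_le_mul_of_nonneg_right _ (Nat.cast_nonneg _)
        push_cast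
        gcongr
    have hlev : ∀ j ∈ Finset.range (Q+1), ∑ κ : Kr All D j → A,
        ∑ R, wt p R * (if t * p ^ j ≤ Vt S out All D j (repl _ κ x) R then 1 else 0) ≤
          (1/2 : ℝ) ^ M := by
      intro j hj
      calc _ ≤ ∑ κ : Kr All D j → A, (1/2 : ℝ) ^ (Fintype.card A * (Kr All D j).card + M) :=
            Finset.sum_le_sum fun κ _ => hone j hj κ
        _ = ((Fintype.card A : ℝ) * (1/2) ^ Fintype.card A) ^ (Kr All D j).card * (1/2) ^ M := by
            rw [Finset.sum_const, nsmul_eq_mul, Finset.card_univ, Fintype.card_fun,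
              Fintype.card_coe, pow_add, pow_mul, mul_pow]
            push_cast; ring
        _ ≤ 1 * (1/2) ^ M := by
            apply mul_le_mul_of_nonneg_right _ (by positivity)
            apply pow_le_one₀ (by positivity)
            rw [one_div, inv_pow, ← div_eq_mul_inv, div_le_one (by positivity)]
            exact_mod_cast Nat.lt_two_pow_self.le
        _ = _ := one_mul _
    calc _ ≤ ∑ R, ∑ j ∈ Finset.range (Q+1), ∑ κ : Kr All D j → A,
          wt p R * (if t * p ^ j ≤ Vt S out All D j (repl _ κ x) R then 1 else 0) := by
          refine Finset.sum_le_sum fun R _ => ?_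
          have hnn : ∀ j (κ : Kr All D j → A),
            0 ≤ wt p R * (if t * p ^ j ≤ Vt S out All D j (repl _ κ x) R then 1 else 0) :=
            fun j κ => mul_nonneg (hwt R) (by split_ifs <;> norm_num)
          split_ifs with h
          · obtain ⟨_, j, hj, κ, hκ⟩ := h
            have h1 := Finset.single_le_sum (f := fun j => ∑ κ : Kr All D j → A,
              wt p R * (if t * p ^ j ≤ Vt S out All D j (repl _ κ x) R then (1:ℝ) else 0))
              (fun j _ => Finset.sum_nonneg fun κ _ => hnn j κ) hj
            have h2 := Finset.single_le_sum (f := fun κ : Kr All D j → A =>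
              wt p R * (if t * p ^ j ≤ Vt S out All D j (repl _ κ x) R then (1:ℝ) else 0))
              (fun κ _ => hnn j κ) (Finset.mem_univ κ)
            simp only [if_pos hκ] at h2
            exact h2.trans h1
          · rw [mul_zero]
            exact Finset.sum_nonneg fun j _ => Finset.sum_nonneg fun κ _ => hnn j κ
      _ = ∑ j ∈ Finset.range (Q+1), ∑ κ : Kr All D j → A, ∑ R,
          wt p R * (if t * p ^ j ≤ Vt S out All D j (repl _ κ x) R then 1 else 0) := by
          rw [Finset.sum_comm]
          exact Finset.sum_congr rfl fun j _ => Finset.sum_comm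
      _ ≤ ∑ j ∈ Finset.range (Q+1), (1/2 : ℝ) ^ M := Finset.sum_le_sum hlev
      _ ≤ 1/3 := by
          rw [Finset.sum_const, Finset.card_range, nsmul_eq_mul]
          push_cast
          exact hQM
  · intro R hR x y
    have : ∀ x, ¬ Test S out All D Q t p cap R x := fun x h => by
      have := h.1; linarith
    funext b
    simp [mkAlg, this]

end core

/-- All coordinates appearing in a decision tree. -/
noncomputable def allQ {A O : Type} [Fintype A] {n : ℕ} : DTree A n O → Finset (Fin n)
  | .leaf _ => ∅
  | .node i ts => insert i (Finset.univ.biUnion fun a => allQ (ts a))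

lemma queries_subset {A O : Type} [Fintype A] {n : ℕ} (t : DTree A n O) (x : Fin n → A) :
    t.queries x ⊆ allQ t := by
  induction t with
  | leaf b => simp [DTree.queries]
  | node i ts ih =>
    simp only [DTree.queries, allQ]
    apply Finset.insert_subset_insert
    exact (ih (x i)).trans (Finset.subset_biUnion_of_mem (fun a => allQ (ts a)) (Finset.mem_univ _))

lemma allQ_card {A O : Type} [Fintype A] {n : ℕ} (t : DTree A n O) :
    (allQ t).card ≤ (Fintype.card A + 1) ^ t.depth := by
  induction t with
  | leaf b => simp [allQ]
  | node i ts ih =>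
    simp only [allQ, DTree.depth]
    set d := Finset.univ.sup fun a => (ts a).depth with hd
    have h1 : (Finset.univ.biUnion fun a => allQ (ts a)).card ≤
        Fintype.card A * (Fintype.card A + 1) ^ d := by
      calc _ ≤ ∑ a : A, (allQ (ts a)).card := Finset.card_biUnion_le
        _ ≤ ∑ a : A, (Fintype.card A + 1) ^ d := by
          refine Finset.sum_le_sum fun a _ => (ih a).trans ?_
          apply Nat.pow_le_pow_right (by omega)
          rw [hd]
          exact Finset.le_sup (f := fun a => (ts a).depth) (Finset.mem_univ a)
        _ = _ := by simp
    have h2 := Finset.card_insert_le i (Finset.univ.biUnion fun a => allQ (ts a))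
    have h3 : 1 ≤ (Fintype.card A + 1) ^ d := Nat.one_le_pow _ _ (by omega)
    rw [pow_add, pow_one]
    nlinarith

lemma queries_card {A O : Type} [Fintype A] {n : ℕ} (t : DTree A n O) (x : Fin n → A) :
    (t.queries x).card ≤ t.depth := by
  induction t with
  | leaf b => simp [DTree.queries]
  | node i ts ih =>
    simp only [DTree.queries, DTree.depth]
    have h1 := Finset.card_insert_le i ((ts (x i)).queries x)
    have h2 := ih (x i)
    have h3 := Finset.le_sup (f := fun a => (ts a).depth) (Finset.mem_univ (x i))
    omega

lemma tree_local {A O : Type} {n : ℕ} (t : DTree A n O) (x y : Fin n → A)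
    (h : ∀ i ∈ t.queries x, x i = y i) : t.queries y = t.queries x ∧ t.eval y = t.eval x := by
  induction t with
  | leaf b => simp [DTree.queries, DTree.eval]
  | node i ts ih =>
    simp only [DTree.queries, DTree.eval] at *
    have hi : x i = y i := h i (Finset.mem_insert_self _ _)
    have := ih (x i) (fun k hk => h k (Finset.mem_insert_of_mem hk))
    rw [← hi, this.1, this.2]
    simp

/-- Chernoff type bound for repetition. -/
lemma amplify {I : Type} [Fintype I] (bad : I → Prop) [DecidablePred bad]
    (h : ((Finset.univ.filter bad).card : ℝ) ≤ 1/3 * Fintype.card I) (k : ℕ) :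
    ((Finset.univ.filter fun f : Fin (2*k) → I =>
      k ≤ (Finset.univ.filter fun i => bad (f i)).card).card : ℝ) ≤
      (8/9) ^ k * Fintype.card (Fin (2*k) → I) := by
  have h1 : (2:ℝ)^k * ((Finset.univ.filter fun f : Fin (2*k) → I =>
      k ≤ (Finset.univ.filter fun i => bad (f i)).card).card : ℝ) ≤
      ∑ f : Fin (2*k) → I, ∏ i, (if bad (f i) then (2:ℝ) else 1) := by
    rw [Finset.card_filter]
    push_cast
    rw [Finset.mul_sum]
    refine Finset.sum_le_sum fun f _ => ?_
    rw [Finset.prod_ite]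
    simp only [Finset.prod_const, one_pow, mul_one]
    split_ifs with hk
    · rw [mul_one]; exact pow_le_pow_right₀ (by norm_num) hk
    · rw [mul_zero]; positivity
  have h1' := Fintype.sum_pow (fun a : I => if bad a then (2:ℝ) else 1) (2*k)
  rw [← h1'] at h1
  have h2 : ∑ a : I, (if bad a then (2:ℝ) else 1) ≤ 4/3 * Fintype.card I := by
    have : ∀ a, (if bad a then (2:ℝ) else 1) = 1 + if bad a then 1 else 0 := fun a => by
      split_ifs <;> norm_num
    simp_rw [this]
    rw [Finset.sum_add_distrib, Finset.sum_boole]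
    simp only [Finset.sum_const, Finset.card_univ, nsmul_eq_mul, mul_one]
    linarith
  have h3 : (∑ a : I, (if bad a then (2:ℝ) else 1)) ^ (2*k) ≤ (4/3 * Fintype.card I) ^ (2*k) :=
    pow_le_pow_left₀ (Finset.sum_nonneg fun a _ => by split_ifs <;> norm_num) h2 _
  have h4 : (4/3 * (Fintype.card I : ℝ)) ^ (2*k) =
      2 ^ k * ((8/9) ^ k * Fintype.card (Fin (2*k) → I)) := by
    rw [Fintype.card_fun, Fintype.card_fin]
    push_cast
    rw [← mul_assoc, ← mul_pow, mul_pow (4/3 : ℝ), pow_mul (4/3 : ℝ)]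
    norm_num
  rw [h4] at h3
  exact le_of_mul_le_mul_left (h1.trans h3) (by positivity)

lemma multiset_index {α : Type} (T : Multiset α) : ∃ (I : Type) (_ : Fintype I) (g : I → α),
    T = (Finset.univ : Finset I).val.map g :=
  ⟨T.ToType, inferInstance, fun x => x.1, by simp⟩

/-- Final reduction with numeric parameters. -/
lemma combine {A : Type} [Fintype A] [DecidableEq A] {n : ℕ} (q k M : ℕ) (ε : ℝ)
    (D : ℕ → ℝ) (hD0 : ∀ j, 0 < D j) (hD : Monotone D)
    (t p cap : ℝ) (hp0 : 0 < p) (hp1 : p ≤ 1) (ht : 0 < t) (hst : 4 * (8/9 : ℝ) ^ k ≤ t)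
    (htQ : (((2 * k * q : ℕ) : ℝ) + 1) * (2 * t) ≤ 1 - (8/9 : ℝ) ^ k) (hn : 0 < n)
    (hnum : ∀ j ≤ 2 * k * q, (Fintype.card A *
      (((2 * k * (Fintype.card A + 1) ^ q : ℕ) : ℝ) / D (j+1)) + M) * j * D j ≤ p ^ j * (8/9) ^ k)
    (hker : ∀ j ≤ 2 * k * q, ((2 * k * (Fintype.card A + 1) ^ q : ℕ) : ℝ) / D (j+1) ≤ ε / 2 * n)
    (hM : 100 ≤ M) (hQM : (((2 * k * q : ℕ) : ℝ) + 1) * (1/2 : ℝ) ^ M ≤ 1/3)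
    (hcap0 : 0 < cap) (hcap : n * p ≤ cap / 6)
    (Pty : Set (Fin n → A)) (T : Multiset (DTree A n Bool)) (hT : T ≠ 0)
    (hdep : ∀ t ∈ T, DTree.depth t ≤ q)
    (hcomp : ∀ x ∈ Pty, 2/3 ≤ prP T x (· = true))
    (hsound : ∀ x : (Fin n) → A, (∀ y ∈ Pty, ε / 2 < relDist x y) →
        2/3 ≤ prP T x (· = false)) :
    ∃ N : SampleAlg A n Bool,
        (∀ x ∈ Pty, 2/3 ≤ N.pr x (· = true)) ∧
        (∀ x : (Fin n) → A, (∀ y ∈ Pty, ε < relDist x y) →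
          2/3 ≤ N.pr x (· = false)) ∧
        N.complexityLE cap := by
  obtain ⟨I, hI, g, rfl⟩ := multiset_index T
  have hne : Nonempty I := by
    by_contra h
    rw [not_nonempty_iff] at h
    apply hT
    simp
  have hdep' : ∀ i, (g i).depth ≤ q := fun i => hdep _ (by simp)
  have hcI : (0:ℝ) < Fintype.card I := by exact_mod_cast Fintype.card_pos
  have hpr : ∀ x (b : Bool), prP ((Finset.univ : Finset I).val.map g) x (· = b) =
      ((Finset.univ.filter fun i => (g i).eval x = b).card : ℝ) / Fintype.card I := by
    intro x b
    unfold prP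
    rw [Multiset.countP_map, Multiset.card_map, Finset.card_def, Finset.filter_val]
    congr!
  have hcompl : ∀ x (b : Bool), 2/3 ≤ prP ((Finset.univ : Finset I).val.map g) x (· = b) →
      ((Finset.univ.filter fun i => (g i).eval x = !b).card : ℝ) ≤ 1/3 * Fintype.card I := by
    intro x b h
    rw [hpr, le_div_iff₀ hcI] at h
    have h1 := Finset.card_filter_add_card_filter_not (s := (Finset.univ : Finset I))
      (fun i => (g i).eval x = b)
    have h2 : (Finset.univ.filter fun i => ¬ (g i).eval x = b) =
      (Finset.univ.filter fun i => (g i).eval x = !b) := by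
      ext i; simp [Bool.eq_not]
    rw [h2] at h1
    have h3 : ((Finset.univ.filter fun i => (g i).eval x = b).card : ℝ) +
      (Finset.univ.filter fun i => (g i).eval x = !b).card = Fintype.card I := by exact_mod_cast h1
    linarith
  have hcO : (0:ℝ) < Fintype.card (Fin (2*k) → I) := by exact_mod_cast Fintype.card_pos
  refine core (Ω := Fin (2*k) → I)
    (fun f x => Finset.univ.biUnion fun i => (g (f i)).queries x)
    (fun f x => k < (Finset.univ.filter fun i => (g (f i)).eval x = true).card)
    (fun f => Finset.univ.biUnion fun i => allQ (g (f i)))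
    ?_ ?_ (2 * k * (Fintype.card A + 1) ^ q) (2 * k * q) M ?_ ?_ D hD0 hD ((8/9)^k) t p cap ε
    hp0 hp1 ht hst htQ (by positivity) hn hnum hker hM hQM hcap0 hcap Pty ?_ ?_
  · intro f x y h
    have h1 : ∀ i, (g (f i)).queries y = (g (f i)).queries x ∧
        (g (f i)).eval y = (g (f i)).eval x := fun i =>
      tree_local _ x y fun v hv => h v (Finset.mem_biUnion.2 ⟨i, Finset.mem_univ _, hv⟩)
    simp only [fun i => (h1 i).1, fun i => (h1 i).2, and_self]
  · intro f x
    exact Finset.biUnion_mono fun i _ => queries_subset _ _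
  · intro f
    calc _ ≤ ∑ i : Fin (2*k), (allQ (g (f i))).card := Finset.card_biUnion_le
      _ ≤ ∑ i : Fin (2*k), (Fintype.card A + 1) ^ q := Finset.sum_le_sum fun i _ =>
        (allQ_card _).trans (Nat.pow_le_pow_right (by omega) (hdep' _))
      _ = _ := by simp
  · intro f x
    calc _ ≤ ∑ i : Fin (2*k), ((g (f i)).queries x).card := Finset.card_biUnion_le
      _ ≤ ∑ i : Fin (2*k), q := Finset.sum_le_sum fun i _ =>
        (queries_card _ _).trans (hdep' _)
      _ = _ := by simp
  · intro x hx
    have h0 := hcompl x true (hcomp x hx)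
    simp only [Bool.not_true] at h0
    have h1 := amplify (fun i => (g i).eval x = false) h0 k
    have h2 := Finset.card_filter_add_card_filter_not (s := (Finset.univ : Finset (Fin (2*k) → I)))
      (fun f => k < (Finset.univ.filter fun i => (g (f i)).eval x = true).card)
    have h3 : (Finset.univ.filter fun f : Fin (2*k) → I =>
        ¬ k < (Finset.univ.filter fun i => (g (f i)).eval x = true).card) ⊆
        (Finset.univ.filter fun f : Fin (2*k) → I =>
        k ≤ (Finset.univ.filter fun i => (g (f i)).eval x = false).card) := by
      intro f
      simp only [Finset.mem_filter, Finset.mem_univ, true_and]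
      intro hf
      have h4 := Finset.card_filter_add_card_filter_not (s := (Finset.univ : Finset (Fin (2*k))))
        (fun i => (g (f i)).eval x = true)
      simp only [Bool.not_eq_true, Finset.card_univ, Fintype.card_fin] at h4
      omega
    have h5 : ((Finset.univ.filter fun f : Fin (2*k) → I =>
        ¬ k < (Finset.univ.filter fun i => (g (f i)).eval x = true).card).card : ℝ) ≤
        (8/9) ^ k * Fintype.card (Fin (2*k) → I) :=
      le_trans (by exact_mod_cast Finset.card_le_card h3) h1
    have h6 : ((Finset.univ.filter fun f : Fin (2*k) → I =>
        k < (Finset.univ.filter fun i => (g (f i)).eval x = true).card).card : ℝ) +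
        ((Finset.univ.filter fun f : Fin (2*k) → I =>
        ¬ k < (Finset.univ.filter fun i => (g (f i)).eval x = true).card).card : ℝ) =
        Fintype.card (Fin (2*k) → I) := by exact_mod_cast h2
    rw [Finset.sum_const, nsmul_eq_mul, mul_one_div, le_div_iff₀ hcO]
    have h7 : (1 - (8/9 : ℝ) ^ k) * Fintype.card (Fin (2*k) → I) ≤
        ((Finset.univ.filter fun f : Fin (2*k) → I =>
        k < (Finset.univ.filter fun i => (g (f i)).eval x = true).card).card : ℝ) := by linarith
    convert h7 <;> rfl
  · intro x hx
    have h0 := hcompl x false (hsound x hx)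
    simp only [Bool.not_false] at h0
    have h1 := amplify (fun i => (g i).eval x = true) h0 k
    rw [Finset.sum_const, nsmul_eq_mul, mul_one_div, div_le_iff₀ hcO]
    refine le_trans ?_ h1
    have : (Finset.univ.filter fun f : Fin (2*k) → I =>
        k < (Finset.univ.filter fun i => (g (f i)).eval x = true).card) ⊆
        (Finset.univ.filter fun f : Fin (2*k) → I =>
        k ≤ (Finset.univ.filter fun i => (g (f i)).eval x = true).card) := by
      intro f
      simp only [Finset.mem_filter, Finset.mem_univ, true_and]
      exact le_of_lt
    have h7 : ((Finset.univ.filter fun f : Fin (2*k) → I =>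
        k < (Finset.univ.filter fun i => (g (f i)).eval x = true).card).card : ℝ) ≤
        ((Finset.univ.filter fun f : Fin (2*k) → I =>
        k ≤ (Finset.univ.filter fun i => (g (f i)).eval x = true).card).card : ℝ) := by
      exact_mod_cast Finset.card_le_card this
    convert h7 <;> rfl

lemma sigma_bound (q : ℕ) : (16:ℝ) * (((2 * (84 * Nat.clog 2 (q+2)) * q : ℕ) : ℝ) + 1) *
    (8/9 : ℝ) ^ (84 * Nat.clog 2 (q+2)) ≤ 1 := by
  set L := Nat.clog 2 (q+2) with hL
  have h1 : q + 2 ≤ 2 ^ L := Nat.le_pow_clog (by norm_num) _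
  have hL1 : 1 ≤ L := Nat.clog_pos (by norm_num) (by omega)
  have h2 : (8/9 : ℝ) ^ (84 * L) ≤ (1/2) ^ (14 * L) := by
    rw [show 84 * L = 6 * (14 * L) by ring, pow_mul]
    exact pow_le_pow_left₀ (by norm_num) (by norm_num) _
  have h3 : 16 * (2 * (84 * L) * q + 1) ≤ 2 ^ (14 * L) := by
    have h4 : L < 2 ^ L := Nat.lt_two_pow_self
    have h5 : 2 ^ 12 ≤ 2 ^ (12 * L) := Nat.pow_le_pow_right (by norm_num) (by omega)
    have h6 : L * q ≤ 2 ^ L * 2 ^ L := Nat.mul_le_mul h4.le (by omega)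
    have h7 : 1 ≤ 2 ^ L * 2 ^ L := Nat.mul_pos (by positivity) (by positivity)
    have h8 : 2 ^ (14 * L) = 2 ^ (12 * L) * (2 ^ L * 2 ^ L) := by
      rw [← pow_add, ← pow_add]; congr 1; ring
    rw [h8]
    nlinarith
  have h3' : (16:ℝ) * (((2 * (84 * L) * q : ℕ) : ℝ) + 1) ≤ 2 ^ (14 * L) := by exact_mod_cast h3
  calc _ ≤ (2:ℝ) ^ (14 * L) * (1/2) ^ (14 * L) := by gcongr
    _ = 1 := by rw [← mul_pow]; norm_num

lemma delta_bound (q : ℕ) :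
    1 / ((2 * 337 ^ 2) * (q : ℝ) ^ 2 * (Real.logb 2 ((q : ℝ) + 2)) ^ 2) ≤
      1 / (((2 * (84 * Nat.clog 2 (q+2)) * q : ℕ) : ℝ) + 1) ^ 2 / 2 := by
  rcases Nat.eq_zero_or_pos q with rfl | hq
  · simp
  have hq' : (1:ℝ) ≤ q := by exact_mod_cast hq
  set l := Real.logb 2 ((q : ℝ) + 2) with hl
  have hl1 : 1 ≤ l := by
    rw [hl, Real.le_logb_iff_rpow_le (by norm_num) (by linarith)]
    norm_num
  have hL : (Nat.clog 2 (q+2) : ℝ) ≤ 2 * l := by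
    have h1 := Real.natCeil_logb_natCast 2 (q+2)
    have h2 : (⌈l⌉₊ : ℝ) < l + 1 := Nat.ceil_lt_add_one (by linarith)
    push_cast at h1
    rw [← h1]
    linarith
  have hQ : (((2 * (84 * Nat.clog 2 (q+2)) * q : ℕ) : ℝ) + 1) ≤ 337 * q * l := by
    push_cast
    nlinarith
  rw [div_div]
  apply one_div_le_one_div_of_le (by positivity)
  calc _ ≤ (337 * q * l) ^ 2 * 2 := by gcongr
    _ = _ := by ring

end QS

set_option maxHeartbeats 4000000 in
/-- **Query-to-sample transformation for adaptive testers.** There is a universal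
constant `c > 0` such that for every finite alphabet `Σ`, every `ε > 0` and every
`q`, there is a threshold `n₀` such that for all `n ≥ n₀`: if a property `Pty ⊆ Σⁿ`
admits an `(ε/2)`-tester with `q` queries and error rate `1/3`, then it admits a
sample-based `ε`-tester with error rate `1/3` and sample complexity at most
`n^(1 - 1/(c·q²·log₂²(q+2)))`. -/
theorem tester_to_sample_based :
    ∃ c : ℝ, 0 < c ∧
    ∀ (A : Type) [Fintype A] [DecidableEq A] (ε : ℝ), 0 < ε →
    ∀ q : ℕ, ∃ n₀ : ℕ, ∀ n : ℕ, n₀ ≤ n →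
    ∀ (Pty : Set ((Fin n) → A)) (T : Multiset (DTree A n Bool)),
      T ≠ 0 →
      (∀ t ∈ T, DTree.depth t ≤ q) →
      (∀ x ∈ Pty, 2/3 ≤ prP T x (· = true)) →
      (∀ x : (Fin n) → A, (∀ y ∈ Pty, ε / 2 < relDist x y) →
        2/3 ≤ prP T x (· = false)) →
      ∃ N : SampleAlg A n Bool,
        (∀ x ∈ Pty, 2/3 ≤ N.pr x (· = true)) ∧
        (∀ x : (Fin n) → A, (∀ y ∈ Pty, ε < relDist x y) →
          2/3 ≤ N.pr x (· = false)) ∧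
        N.complexityLE
          ((n : ℝ) ^ (1 - 1 / (c * (q : ℝ) ^ 2 * (Real.logb 2 ((q : ℝ) + 2)) ^ 2))) := by
  refine ⟨2 * 337 ^ 2, by norm_num, ?_⟩
  intro A _ _ ε hε q
  have hsig := QS.sigma_bound q
  have hdel := QS.delta_bound q
  set k := 84 * Nat.clog 2 (q+2) with hk
  set Q : ℕ := 2 * k * q with hQ
  set B : ℕ := 2 * k * (Fintype.card A + 1) ^ q with hB
  set M : ℕ := Q + 100 with hM
  set σ : ℝ := (8/9 : ℝ) ^ k with hσ
  set δ : ℝ := 1 / ((2 * 337 ^ 2) * (q : ℝ) ^ 2 * (Real.logb 2 ((q : ℝ) + 2)) ^ 2) with hδ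
  have hσ0 : 0 < σ := by positivity
  set γ : ℝ := 1 / ((Q : ℝ) + 1) ^ 2 with hγ
  set h : ℝ := 1 / ((Q : ℝ) + 1) with hh
  have hQ0 : (0:ℝ) ≤ Q := Nat.cast_nonneg _
  have hγ0 : 0 < γ := by positivity
  have hh0 : 0 < h := by positivity
  have hγh : h = γ * (Q + 1) := by rw [hγ, hh]; field_simp
  have hhQ : (Q + 1) * h = 1 := by rw [hh]; field_simp
  set C : ℝ := (Fintype.card A * B + M) * Q with hC
  have hC0 : 0 ≤ C := by positivity
  set η : ℝ := min (σ / (C + 1)) (min (ε / (2 * (B + 1))) (1/6)) with hη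
  have hη0 : 0 < η := by positivity
  have htend : Filter.Tendsto (fun n : ℕ => (n : ℝ) ^ (-(γ / 2))) Filter.atTop (nhds 0) :=
    (tendsto_rpow_neg_atTop (by positivity)).comp tendsto_natCast_atTop_atTop
  obtain ⟨n₁, hn₁⟩ := Filter.eventually_atTop.1 (htend.eventually (Iio_mem_nhds hη0))
  refine ⟨max n₁ 1, ?_⟩
  intro n hn Pty T hT hdep hcomp hsound
  have hn1 : 1 ≤ n := le_trans (le_max_right _ _) hn
  have hnr : (1:ℝ) ≤ n := by exact_mod_cast hn1
  have hnp : (0:ℝ) < n := by linarith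
  have hu2 : (n : ℝ) ^ (-(γ / 2)) < η := hn₁ n (le_trans (le_max_left _ _) hn)
  have hu : (n : ℝ) ^ (-γ) < η :=
    lt_of_le_of_lt (Real.rpow_le_rpow_of_exponent_le hnr (by linarith)) hu2
  have hu0 : 0 < (n : ℝ) ^ (-γ) := Real.rpow_pos_of_pos hnp _
  have hη1 : η ≤ σ / (C + 1) := min_le_left _ _
  have hη2 : η ≤ ε / (2 * (B + 1)) := (min_le_right _ _).trans (min_le_left _ _)
  have hη3 : η ≤ 1/6 := (min_le_right _ _).trans (min_le_right _ _)
  have hcu : C * (n : ℝ) ^ (-γ) ≤ σ := by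
    have h1 : (n : ℝ) ^ (-γ) ≤ σ / (C + 1) := hu.le.trans hη1
    rw [le_div_iff₀ (by positivity)] at h1
    nlinarith
  have hbu : B * (n : ℝ) ^ (-γ) ≤ ε / 2 := by
    have h1 : (n : ℝ) ^ (-γ) ≤ ε / (2 * (B + 1)) := hu.le.trans hη2
    rw [le_div_iff₀ (by positivity)] at h1
    nlinarith
  have hDinv : ∀ j : ℕ, 1 / (n : ℝ) ^ ((j : ℝ) * h - 1) = (n : ℝ) ^ (1 - (j : ℝ) * h) := by
    intro j
    rw [one_div, ← Real.rpow_neg hnp.le]; congr 1; ring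
  refine QS.combine q k M ε (fun j => (n : ℝ) ^ ((j : ℝ) * h - 1))
    (fun j => Real.rpow_pos_of_pos hnp _) ?_ (1 / (4 * (Q + 1))) ((n : ℝ) ^ (-γ))
    ((n : ℝ) ^ (1 - δ)) hu0 ?_ (by positivity) ?_ ?_ hn1 ?_ ?_ (by omega) ?_
    (Real.rpow_pos_of_pos hnp _) ?_ Pty T hT hdep hcomp hsound
  · intro i j hij
    apply Real.rpow_le_rpow_of_exponent_le hnr
    have : (i : ℝ) ≤ j := by exact_mod_cast hij
    nlinarith
  · exact Real.rpow_le_one_of_one_le_of_nonpos hnr (by linarith)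
  · rw [le_div_iff₀ (by positivity)]
    linarith
  · have h1 : ((Q : ℝ) + 1) * (2 * (1 / (4 * (Q + 1)))) = 1/2 := by field_simp; norm_num
    rw [← hQ, h1]
    nlinarith
  · intro j hj
    have hjQ : (j : ℝ) ≤ Q := by exact_mod_cast hj
    have hinv : (1:ℝ) ≤ 1 / (n : ℝ) ^ (((j + 1 : ℕ) : ℝ) * h - 1) := by
      rw [hDinv]
      apply Real.one_le_rpow hnr
      push_cast
      nlinarith
    have hD0 : 0 < (n : ℝ) ^ ((j : ℝ) * h - 1) := Real.rpow_pos_of_pos hnp _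
    have hpj : ((n : ℝ) ^ (-γ)) ^ j = (n : ℝ) ^ (-γ * j) := by
      rw [← Real.rpow_natCast, ← Real.rpow_mul hnp.le]
    have hratio : 1 / (n : ℝ) ^ (((j + 1 : ℕ) : ℝ) * h - 1) * (n : ℝ) ^ ((j : ℝ) * h - 1) ≤
        (n : ℝ) ^ (-γ) * ((n : ℝ) ^ (-γ)) ^ j := by
      rw [hDinv, hpj, ← Real.rpow_add hnp, ← Real.rpow_add hnp]
      apply Real.rpow_le_rpow_of_exponent_le hnr
      push_cast
      nlinarith
    set X := 1 / (n : ℝ) ^ (((j + 1 : ℕ) : ℝ) * h - 1) with hX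
    set Y := (n : ℝ) ^ ((j : ℝ) * h - 1) with hY
    have hpj0 : 0 < ((n : ℝ) ^ (-γ)) ^ j := by positivity
    calc (Fintype.card A * ((B : ℝ) / (n : ℝ) ^ (((j + 1 : ℕ) : ℝ) * h - 1)) + M) * j * Y
        = (Fintype.card A * B * X + M * 1) * j * Y := by rw [hX]; ring
      _ ≤ (Fintype.card A * B * X + M * X) * Q * Y := by gcongr
      _ = C * (X * Y) := by rw [hC]; ring
      _ ≤ C * ((n : ℝ) ^ (-γ) * ((n : ℝ) ^ (-γ)) ^ j) := by gcongr
      _ = (C * (n : ℝ) ^ (-γ)) * ((n : ℝ) ^ (-γ)) ^ j := by ring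
      _ ≤ σ * ((n : ℝ) ^ (-γ)) ^ j := by gcongr
      _ = _ := by ring
  · intro j hj
    have h1 : 1 / (n : ℝ) ^ (((j + 1 : ℕ) : ℝ) * h - 1) ≤ n * (n : ℝ) ^ (-γ) := by
      rw [hDinv]
      have : (n : ℝ) * (n : ℝ) ^ (-γ) = (n : ℝ) ^ (1 + -γ) := by
        rw [Real.rpow_add hnp, Real.rpow_one]
      rw [this]
      apply Real.rpow_le_rpow_of_exponent_le hnr
      push_cast
      have hj0 : (0:ℝ) ≤ j := Nat.cast_nonneg _
      nlinarith [mul_nonneg hj0 hh0.le, mul_nonneg hγ0.le hQ0]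
    calc (B : ℝ) / (n : ℝ) ^ (((j + 1 : ℕ) : ℝ) * h - 1)
        = B * (1 / (n : ℝ) ^ (((j + 1 : ℕ) : ℝ) * h - 1)) := by ring
      _ ≤ B * (n * (n : ℝ) ^ (-γ)) := by gcongr
      _ = (B * (n : ℝ) ^ (-γ)) * n := by ring
      _ ≤ _ := by gcongr
  · rw [← hQ, hM, show Q + 100 = (Q + 1) + 99 by ring, pow_add]
    have h1 : ((Q : ℝ) + 1) ≤ 2 ^ (Q + 1) := by
      exact_mod_cast (Nat.lt_two_pow_self (n := Q + 1)).le
    have h2 : ((Q : ℝ) + 1) * (1/2) ^ (Q + 1) ≤ 1 := by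
      calc _ ≤ (2:ℝ) ^ (Q + 1) * (1/2) ^ (Q + 1) := by gcongr
        _ = 1 := by rw [← mul_pow]; norm_num
    rw [← mul_assoc]
    calc _ ≤ 1 * (1/2 : ℝ) ^ 99 := by gcongr
      _ ≤ 1/3 := by norm_num
  · have h1 : (n : ℝ) * (n : ℝ) ^ (-γ) = (n : ℝ) ^ (1 - γ / 2) * (n : ℝ) ^ (-(γ / 2)) := by
      rw [← Real.rpow_add hnp]
      nth_rewrite 1 [← Real.rpow_one (n : ℝ)]
      rw [← Real.rpow_add hnp]; congr 1; ring
    have h2 : (n : ℝ) ^ (1 - γ / 2) ≤ (n : ℝ) ^ (1 - δ) :=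
      Real.rpow_le_rpow_of_exponent_le hnr (by linarith)
    rw [h1]
    calc _ ≤ (n : ℝ) ^ (1 - δ) * (1/6) := by
          have := hu2.le.trans hη3
          gcongr
      _ = _ := by ring
end
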